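/- arXiv:1308.5522 — 4 statements merged into one kernel-verified Lean document; each statement's English description precedes it below -/
import Mathlib

section
/- Let K ⊂ ℝ² be a convex body that intersects every integer line {x ∈ ℝ² : m₁x₁ + m₂x₂ = 1} with (m₁,m₂) ∈ ℤ² \ {0}. Then the area of K is at least 3/2. Moreover, the area of K equals 3/2 if and only if K is the image under a unimodular transformation of the triangle with vertices (1,0), (0,1), (−1,−1). -/
open MeasureTheory

/-- The determinant of two vectors in the plane. -/
def planeCross (u v : Fin 2 → ℝ) : ℝ := u 0 * v 1 - u 1 * v 0

/-- The interior of the standard triangle. -/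
def openSimplex : Set (Fin 2 → ℝ) := {v | 0 < v 0 ∧ 0 < v 1 ∧ v 0 + v 1 < 1}

/-- The extremal triangle. -/
def extremalTriangle : Set (Fin 2 → ℝ) := convexHull ℝ {![(1 : ℝ), 0], ![0, 1], ![-1, -1]}

lemma volume_openSimplex : volume openSimplex = ENNReal.ofReal (1 / 2) := by
  have h := (volume_preserving_finTwoArrow ℝ).measure_preimage_equiv
    (regionBetween (fun _ => (0 : ℝ)) (fun x => 1 - x) (Set.Ioo 0 1))
  have hs : (MeasurableEquiv.finTwoArrow (α := ℝ)) ⁻¹'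
      (regionBetween (fun _ => (0 : ℝ)) (fun x => 1 - x) (Set.Ioo 0 1)) = openSimplex := by
    ext v
    simp only [regionBetween, openSimplex, Set.mem_preimage, Set.mem_ofPred_eq, Set.mem_Ioo,
      MeasurableEquiv.finTwoArrow_apply]
    constructor
    · rintro ⟨⟨h1, h2⟩, h3, h4⟩
      exact ⟨h1, h3, by linarith⟩
    · rintro ⟨h1, h2, h3⟩
      exact ⟨⟨h1, by linarith⟩, h2, by linarith⟩
  rw [← hs, h, Measure.volume_eq_prod, volume_regionBetween_eq_integral]
  · congr 1
    rw [← integral_Ioc_eq_integral_Ioo, ← intervalIntegral.integral_of_le zero_le_one]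
    simp only [Pi.sub_apply, sub_zero]
    rw [intervalIntegral.integral_sub (by simp) (by simp)]
    norm_num
  · exact (integrableOn_const (by simp)).mono_set subset_rfl
  · exact (Continuous.integrableOn_Icc (by fun_prop)).mono_set Set.Ioo_subset_Icc_self
  · exact measurableSet_Ioo
  · intro x hx
    simp only [Set.mem_Ioo] at hx
    linarith

lemma volume_toLin'_image (A : Matrix (Fin 2) (Fin 2) ℝ) (s : Set (Fin 2 → ℝ)) :
    volume (Matrix.toLin' A '' s) = ENNReal.ofReal |A.det| * volume s := by
  rw [Measure.addHaar_image_linearMap, LinearMap.det_toLin']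

lemma volume_affine_openSimplex (q u v : Fin 2 → ℝ) :
    volume ((fun z : Fin 2 → ℝ => q + (z 0 • u + z 1 • v)) '' openSimplex)
      = ENNReal.ofReal (|planeCross u v| / 2) := by
  have : (fun z : Fin 2 → ℝ => q + (z 0 • u + z 1 • v)) '' openSimplex
      = (fun z => q + z) '' (Matrix.toLin' !![u 0, v 0; u 1, v 1] '' openSimplex) := by
    rw [Set.image_image]
    apply Set.image_congr
    intro z _
    ext i
    fin_cases i <;> simp [Matrix.vecHead, Matrix.vecTail] <;> ring
  rw [this, Set.image_add_left, measure_preimage_add, volume_toLin'_image, volume_openSimplex,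
    ← ENNReal.ofReal_mul (abs_nonneg _), Matrix.det_fin_two]
  congr 1
  simp [planeCross]
  ring_nf

lemma le_volume_halfPlane {K : Set (Fin 2 → ℝ)} (hK : Convex ℝ K) {p q r : Fin 2 → ℝ}
    (hp : p ∈ K) (hq : q ∈ K) (hr : r ∈ K) :
    ENNReal.ofReal (|planeCross (p - q) (r - q)| / 2) ≤
      volume (K ∩ {z | 0 < planeCross (p - q) (r - q) * planeCross (p - q) (z - q)}) := by
  rcases eq_or_ne (planeCross (p - q) (r - q)) 0 with h0 | h0
  · simp [h0]
  rw [← volume_affine_openSimplex q]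
  apply measure_mono
  rintro _ ⟨z, ⟨h1, h2, h3⟩, rfl⟩
  constructor
  · have := hK.sum_mem (t := Finset.univ) (w := ![1 - z 0 - z 1, z 0, z 1]) (z := ![q, p, r])
      (by intro i _; fin_cases i <;> simp <;> linarith)
      (by simp [Fin.sum_univ_three]; ring)
      (by intro i _; fin_cases i <;> simp [hp, hq, hr])
    simp only [Fin.sum_univ_three] at this
    convert this using 1
    ext i
    simp
    ring
  · simp only [Set.mem_ofPred_eq]
    have : planeCross (p - q) (q + (z 0 • (p - q) + z 1 • (r - q)) - q)
        = z 1 * planeCross (p - q) (r - q) := by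
      simp [planeCross]; ring
    rw [this]
    have := mul_self_pos.mpr h0
    nlinarith [mul_pos h2 this]

/-- A planar convex body containing two segments has at least half the area of the parallelogram
they span. -/
lemma cross_le_volume {K : Set (Fin 2 → ℝ)} (hc : IsCompact K) (hK : Convex ℝ K)
    {p q r s : Fin 2 → ℝ} (hp : p ∈ K) (hq : q ∈ K) (hr : r ∈ K) (hs : s ∈ K) :
    ENNReal.ofReal (|planeCross (p - q) (r - s)| / 2) ≤ volume K := by
  have h1 := le_volume_halfPlane hK hp hq hr
  have h2 := le_volume_halfPlane hK hp hq hs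
  have e : planeCross (p - q) (r - s)
      = planeCross (p - q) (r - q) - planeCross (p - q) (s - q) := by
    simp [planeCross]; ring
  rw [e]
  set α := planeCross (p - q) (r - q)
  set β := planeCross (p - q) (s - q)
  rcases le_or_gt 0 (α * β) with h | h
  · have : |α - β| ≤ |α| ∨ |α - β| ≤ |β| := by
      by_contra! hcon
      have ha := sq_lt_sq.mpr hcon.1
      have hb := sq_lt_sq.mpr hcon.2
      nlinarith [sq_nonneg (α - β)]
    rcases this with h' | h'
    · exact (ENNReal.ofReal_le_ofReal (by linarith)).trans
        (h1.trans (measure_mono Set.inter_subset_left))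
    · exact (ENNReal.ofReal_le_ofReal (by linarith)).trans
        (h2.trans (measure_mono Set.inter_subset_left))
  · have hdisj : Disjoint (K ∩ {z | 0 < α * planeCross (p - q) (z - q)})
        (K ∩ {z | 0 < β * planeCross (p - q) (z - q)}) := by
      rw [Set.disjoint_left]
      rintro z ⟨_, hz1⟩ ⟨_, hz2⟩
      simp only [Set.mem_ofPred_eq] at hz1 hz2
      nlinarith [mul_pos hz1 hz2, sq_nonneg (planeCross (p - q) (z - q))]
    have hm : MeasurableSet (K ∩ {z | 0 < β * planeCross (p - q) (z - q)}) := by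
      refine hc.measurableSet.inter (IsOpen.measurableSet (isOpen_lt continuous_const ?_))
      unfold planeCross
      fun_prop
    calc ENNReal.ofReal (|α - β| / 2) ≤ ENNReal.ofReal (|α| / 2 + |β| / 2) :=
          ENNReal.ofReal_le_ofReal (by linarith [abs_sub α β])
      _ = ENNReal.ofReal (|α| / 2) + ENNReal.ofReal (|β| / 2) :=
          ENNReal.ofReal_add (by positivity) (by positivity)
      _ ≤ _ := add_le_add h1 h2
      _ = _ := (measure_union hdisj hm).symm
      _ ≤ volume K := measure_mono (Set.union_subset Set.inter_subset_left Set.inter_subset_left)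

lemma Convex.subset_of_measure_le {A B : Set (Fin 2 → ℝ)} (hA : IsCompact A) (hB : Convex ℝ B)
    (hB' : (interior B).Nonempty) (hAB : A ⊆ B) (h : volume B ≤ volume A) : B ⊆ A := by
  have h0 : volume (B \ A) = 0 := by
    rw [measure_sdiff hAB hA.measurableSet.nullMeasurableSet hA.measure_lt_top.ne]
    exact tsub_eq_zero_of_le h
  have h1 : interior B \ A = ∅ :=
    ((isOpen_interior.sdiff hA.isClosed).measure_eq_zero_iff volume).mp
      (measure_mono_null (Set.sdiff_subset_sdiff_left interior_subset) h0)
  calc B ⊆ closure B := subset_closure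
    _ = closure (interior B) := (hB.closure_interior_eq_closure_of_nonempty_interior hB').symm
    _ ⊆ A := closure_minimal (Set.sdiff_eq_empty.mp h1) hA.isClosed

lemma convex_openSimplex : Convex ℝ openSimplex := by
  rintro x ⟨hx1, hx2, hx3⟩ y ⟨hy1, hy2, hy3⟩ a b ha hb hab
  obtain rfl : b = 1 - a := by linarith
  simp only [openSimplex, Set.mem_ofPred_eq, Pi.add_apply, Pi.smul_apply, smul_eq_mul]
  rcases ha.eq_or_lt with rfl | ha'
  · simp [*]
  · refine ⟨?_, ?_, ?_⟩ <;> nlinarith [mul_pos ha' hx1, mul_pos ha' hx2]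

lemma volume_closure_openSimplex : volume (closure openSimplex) = ENNReal.ofReal (1 / 2) := by
  rw [← volume_openSimplex]
  refine le_antisymm ?_ (measure_mono subset_closure)
  rw [closure_eq_self_union_frontier]
  refine (measure_union_le _ _).trans ?_
  rw [convex_openSimplex.addHaar_frontier volume, add_zero]

lemma mem_closure_openSimplex {v : Fin 2 → ℝ} (h0 : 0 ≤ v 0) (h1 : 0 ≤ v 1)
    (h : v 0 + v 1 ≤ 1) : v ∈ closure openSimplex := by
  have ht : Filter.Tendsto (fun t : ℝ => (1 - t) • v + t • (fun _ => 1 / 3 : Fin 2 → ℝ))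
      (nhdsWithin 0 (Set.Ioo 0 1)) (nhds v) := by
    have : Continuous (fun t : ℝ => (1 - t) • v + t • (fun _ => 1 / 3 : Fin 2 → ℝ)) := by
      fun_prop
    simpa using (this.tendsto 0).mono_left nhdsWithin_le_nhds
  have : (nhdsWithin (0 : ℝ) (Set.Ioo 0 1)).NeBot := left_nhdsWithin_Ioo_neBot one_pos
  refine mem_closure_of_tendsto ht ?_
  filter_upwards [self_mem_nhdsWithin] with t ⟨ht0, ht1⟩
  simp only [openSimplex, Set.mem_ofPred_eq, Pi.add_apply, Pi.smul_apply, smul_eq_mul]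
  refine ⟨?_, ?_, ?_⟩ <;> nlinarith [mul_nonneg (sub_pos.mpr ht1).le h0,
    mul_nonneg (sub_pos.mpr ht1).le h1]

lemma isCompact_extremalTriangle : IsCompact extremalTriangle :=
  Set.Finite.isCompact_convexHull (𝕜 := ℝ) (Set.toFinite _)

lemma volume_extremalTriangle : volume extremalTriangle = ENNReal.ofReal (3 / 2) := by
  apply le_antisymm
  · have hsub : extremalTriangle ⊆
        (fun z => ![-1, -1] + z) '' (Matrix.toLin' !![2, 1; 1, 2] '' closure openSimplex) := by
      apply convexHull_min
      · have key : ∀ x y : ℝ, 0 ≤ x → 0 ≤ y → x + y ≤ 1 → ![2 * x + y - 1, x + 2 * y - 1] ∈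
            (fun z => ![-1, -1] + z) ''
              (Matrix.toLin' !![(2 : ℝ), 1; 1, 2] '' closure openSimplex) := by
          intro x y hx hy hxy
          refine ⟨_, ⟨![x, y], mem_closure_openSimplex (by simpa) (by simpa) (by simpa), rfl⟩, ?_⟩
          ext i
          fin_cases i <;> simp [Matrix.vecHead, Matrix.vecTail] <;> ring
        rintro _ (rfl | rfl | rfl)
        · convert key 1 0 (by norm_num) (by norm_num) (by norm_num) using 2 <;> norm_num
        · convert key 0 1 (by norm_num) (by norm_num) (by norm_num) using 2 <;> norm_num
        · convert key 0 0 (by norm_num) (by norm_num) (by norm_num) using 2 <;> norm_num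
      · have h := (convex_openSimplex.closure.linear_image
          (Matrix.toLin' !![(2 : ℝ), 1; 1, 2])).translate ![-1, -1]
        exact h
    refine (measure_mono hsub).trans ?_
    rw [Set.image_add_left, measure_preimage_add, volume_toLin'_image, volume_closure_openSimplex,
      ← ENNReal.ofReal_mul (abs_nonneg _), Matrix.det_fin_two]
    apply ENNReal.ofReal_le_ofReal
    norm_num
  · have h := cross_le_volume isCompact_extremalTriangle (convex_convexHull ℝ _)
      (p := ![1, 0]) (q := ![-1, -1]) (r := ![0, 1]) (s := ![-1, -1])
      (subset_convexHull ℝ _ (by simp)) (subset_convexHull ℝ _ (by simp))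
      (subset_convexHull ℝ _ (by simp)) (subset_convexHull ℝ _ (by simp))
    norm_num [planeCross] at h
    exact h

lemma volume_unimodular_image {M : Matrix (Fin 2) (Fin 2) ℤ} (hM : M.det = 1 ∨ M.det = -1)
    (s : Set (Fin 2 → ℝ)) :
    volume (Matrix.toLin' (M.map ((↑) : ℤ → ℝ)) '' s) = volume s := by
  have : (M.map ((↑) : ℤ → ℝ)).det = (M.det : ℝ) := (Int.cast_det M).symm
  rw [volume_toLin'_image, this]
  rcases hM with h | h <;> simp [h]

/-- If the pairwise determinants of the vectors `(w, t)`, `(u, w')` and `(-x, y)` are all at most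
`3`, then all parameters take their extremal values. -/
lemma eq_of_cross_le {w w' t u x y : ℝ} (hw : 2 ≤ w) (hw' : w ≤ w') (ht0 : 0 ≤ t)
    (ht : 2 * t ≤ w) (hu : u ≤ w) (hxy : w ≤ x + y) (h1 : w * w' - t * u ≤ 3)
    (h2 : w * y + t * x ≤ 3) (h3 : u * y + w' * x ≤ 3) :
    w = 2 ∧ w' = 2 ∧ t = 1 ∧ u = 1 ∧ x = 1 ∧ y = 1 := by
  have hu0 : 0 ≤ u := by
    by_contra! h
    nlinarith [mul_nonneg ht0 (neg_pos.mpr h).le]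
  have hx0 : 0 ≤ x := by
    by_contra! h
    nlinarith [mul_nonneg (neg_pos.mpr h).le (show 0 ≤ w - t by linarith)]
  have h1' : w ^ 2 - t * u ≤ 3 := by nlinarith
  have h2' : w ^ 2 - (w - t) * x ≤ 3 := by nlinarith
  have h3' : u * w + (w - u) * x ≤ 3 := by nlinarith
  have h4 : w * (w ^ 2 - t * u) ≤ 3 * (2 * w - (t + u)) := by
    nlinarith [mul_le_mul_of_nonneg_left h2' (sub_nonneg.mpr hu),
      mul_le_mul_of_nonneg_left h3' (show 0 ≤ w - t by linarith)]
  obtain ⟨s, hs0, hs⟩ : ∃ s : ℝ, 0 ≤ s ∧ s ^ 2 = t * u :=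
    ⟨√(t * u), Real.sqrt_nonneg _, Real.sq_sqrt (mul_nonneg ht0 hu0)⟩
  have hst : 2 * s ≤ t + u := by
    apply abs_le_of_sq_le_sq' _ (by linarith) |>.2
    nlinarith [sq_nonneg (t - u)]
  have hsw : s < w := by
    apply lt_of_pow_lt_pow_left₀ 2 (by linarith)
    nlinarith [mul_nonneg ht0 (sub_nonneg.mpr hu)]
  have h5 : w * (w + s) ≤ 6 := by
    by_contra! h
    nlinarith [mul_lt_mul_of_pos_right h (sub_pos.mpr hsw)]
  have hs1 : w + s ≤ 3 := by nlinarith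
  have hw2 : w = 2 := by nlinarith
  subst hw2
  have hs2 : s = 1 := by nlinarith
  subst hs2
  have htu : t + u = 2 := by nlinarith
  have ht1 : t = 1 := by nlinarith [sq_nonneg (t - u)]
  have hu1 : u = 1 := by linarith
  subst ht1 hu1
  refine ⟨rfl, ?_, rfl, rfl, ?_, ?_⟩ <;> nlinarith

/-- The value of an integer linear form at a point of the plane. -/
def latticeForm (m : Fin 2 → ℤ) (z : Fin 2 → ℝ) : ℝ := ∑ i, (m i : ℝ) * z i

lemma latticeForm_apply (m : Fin 2 → ℤ) (z : Fin 2 → ℝ) :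
    latticeForm m z = m 0 * z 0 + m 1 * z 1 := by
  simp [latticeForm, Fin.sum_univ_two]

lemma continuous_latticeForm (m : Fin 2 → ℤ) : Continuous (latticeForm m) := by
  unfold latticeForm
  fun_prop

lemma exists_latticeForm_extrema {K : Set (Fin 2 → ℝ)} (hc : IsCompact K) (hne : K.Nonempty)
    (m : Fin 2 → ℤ) : ∃ p ∈ K, ∃ q ∈ K,
      ∀ z ∈ K, latticeForm m q ≤ latticeForm m z ∧ latticeForm m z ≤ latticeForm m p := by
  obtain ⟨p, hp, hp'⟩ := hc.exists_isMaxOn hne (continuous_latticeForm m).continuousOn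
  obtain ⟨q, hq, hq'⟩ := hc.exists_isMinOn hne (continuous_latticeForm m).continuousOn
  exact ⟨p, hp, q, hq, fun z hz => ⟨hq' hz, hp' hz⟩⟩

/-- A convex body meeting all integer lines, of area at most `3/2`, whose coordinates are adapted
to its lattice width, is the extremal triangle or its negative. -/
lemma eq_triangle_of_reduced {K : Set (Fin 2 → ℝ)} (hc : IsCompact K) (hK : Convex ℝ K)
    (hintr : (interior K).Nonempty)
    (hline : ∀ m : Fin 2 → ℤ, m ≠ 0 → ∃ x ∈ K, latticeForm m x = 1)
    (hvol : volume K ≤ ENNReal.ofReal (3 / 2)) {p₁ q₁ : Fin 2 → ℝ} (hp₁ : p₁ ∈ K) (hq₁ : q₁ ∈ K)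
    (hmax : ∀ z ∈ K, q₁ 0 ≤ z 0 ∧ z 0 ≤ p₁ 0)
    (hmin : ∀ m : Fin 2 → ℤ, m ≠ 0 → ∃ p ∈ K, ∃ q ∈ K,
      p₁ 0 - q₁ 0 ≤ latticeForm m p - latticeForm m q)
    (ht0 : 0 ≤ p₁ 1 - q₁ 1) (ht : 2 * (p₁ 1 - q₁ 1) ≤ p₁ 0 - q₁ 0) :
    K = convexHull ℝ {![1, 0], ![-1, -1], ![0, 1], ![-1, -1]} ∨
      K = convexHull ℝ {![1, 1], ![-1, 0], ![1, 1], ![0, -1]} := by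
  have hcross : ∀ p ∈ K, ∀ q ∈ K, ∀ r ∈ K, ∀ s ∈ K, planeCross (p - q) (r - s) ≤ 3 := by
    intro p hp q hq r hr s hs
    have h := (ENNReal.ofReal_le_ofReal_iff (by norm_num)).mp
      ((cross_le_volume hc hK hp hq hr hs).trans hvol)
    linarith [le_abs_self (planeCross (p - q) (r - s))]
  have hne : K.Nonempty := ⟨p₁, hp₁⟩
  have hx : (![1, 0] : Fin 2 → ℤ) ≠ 0 := by simp
  have hx' : (![-1, 0] : Fin 2 → ℤ) ≠ 0 := by simp
  have hy : (![0, 1] : Fin 2 → ℤ) ≠ 0 := by simp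
  have hy' : (![0, -1] : Fin 2 → ℤ) ≠ 0 := by simp
  have hd : (![-1, 1] : Fin 2 → ℤ) ≠ 0 := by simp
  have hd' : (![1, -1] : Fin 2 → ℤ) ≠ 0 := by simp
  obtain ⟨p₂, hp₂, q₂, hq₂, hmax₂⟩ := exists_latticeForm_extrema hc hne ![0, 1]
  obtain ⟨p₃, hp₃, q₃, hq₃, hmax₃⟩ := exists_latticeForm_extrema hc hne ![-1, 1]
  obtain ⟨a₁, ha₁, ha₁'⟩ := hline _ hx
  obtain ⟨b₁, hb₁, hb₁'⟩ := hline _ hx'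
  obtain ⟨a₂, ha₂, ha₂'⟩ := hline _ hy
  obtain ⟨b₂, hb₂, hb₂'⟩ := hline _ hy'
  obtain ⟨a₃, ha₃, ha₃'⟩ := hline _ hd
  obtain ⟨b₃, hb₃, hb₃'⟩ := hline _ hd'
  obtain ⟨c₂, hc₂, e₂, he₂, hw₂⟩ := hmin _ hy
  obtain ⟨c₃, hc₃, e₃, he₃, hw₃⟩ := hmin _ hd
  have k12 := hcross _ hp₁ _ hq₁ _ hp₂ _ hq₂
  have k13 := hcross _ hp₁ _ hq₁ _ hp₃ _ hq₃
  have k23 := hcross _ hp₂ _ hq₂ _ hp₃ _ hq₃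
  simp only [latticeForm_apply, planeCross, Matrix.cons_val_zero, Matrix.cons_val_one,
    Pi.sub_apply, Int.cast_neg, Int.cast_one, Int.cast_zero, zero_mul, one_mul, zero_add,
    add_zero, neg_mul] at *
  have hw : 2 ≤ p₁ 0 - q₁ 0 := by linarith [(hmax a₁ ha₁).2, (hmax b₁ hb₁).1]
  have hw' : p₁ 0 - q₁ 0 ≤ p₂ 1 - q₂ 1 := by linarith [(hmax₂ c₂ hc₂).2, (hmax₂ e₂ he₂).1]
  have hu : p₂ 0 - q₂ 0 ≤ p₁ 0 - q₁ 0 := by linarith [(hmax p₂ hp₂).2, (hmax q₂ hq₂).1]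
  have hxy : p₁ 0 - q₁ 0 ≤ -(p₃ 0 - q₃ 0) + (p₃ 1 - q₃ 1) := by
    linarith [(hmax₃ c₃ hc₃).2, (hmax₃ e₃ he₃).1]
  obtain ⟨E1, E2, E3, E4, E5, E6⟩ := eq_of_cross_le hw hw' ht0 ht hu hxy (by linarith)
    (by linarith) (by linarith)
  have P1 : p₁ 0 = 1 := by linarith [(hmax a₁ ha₁).2, (hmax b₁ hb₁).1]
  have Q1 : q₁ 0 = -1 := by linarith
  have P2 : p₂ 1 = 1 := by linarith [(hmax₂ a₂ ha₂).2, (hmax₂ b₂ hb₂).1]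
  have Q2 : q₂ 1 = -1 := by linarith
  have P3 : p₃ 1 - p₃ 0 = 1 := by linarith [(hmax₃ a₃ ha₃).2, (hmax₃ b₃ hb₃).1]
  have Q3 : q₃ 1 - q₃ 0 = -1 := by linarith
  have hhull : K = convexHull ℝ {p₁, q₁, p₂, q₂} := by
    have hsub : convexHull ℝ {p₁, q₁, p₂, q₂} ⊆ K := by
      apply convexHull_min _ hK
      rintro _ (rfl | rfl | rfl | rfl) <;> assumption
    have hcomp : IsCompact (convexHull ℝ {p₁, q₁, p₂, q₂}) :=
      Set.Finite.isCompact_convexHull (𝕜 := ℝ) (Set.toFinite _)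
    refine (hK.subset_of_measure_le hcomp hintr hsub (hvol.trans ?_)).antisymm hsub
    refine le_trans (le_of_eq ?_) (cross_le_volume hcomp (convex_convexHull ℝ _)
      (p := p₁) (q := q₁) (r := p₂) (s := q₂)
      (subset_convexHull ℝ _ (by simp)) (subset_convexHull ℝ _ (by simp))
      (subset_convexHull ℝ _ (by simp)) (subset_convexHull ℝ _ (by simp)))
    simp only [planeCross, Pi.sub_apply, E1, E2, E3, E4]
    norm_num
  have L1 := hmax₃ p₁ hp₁
  have L2 := hmax₃ q₁ hq₁
  have L3 := hmax₃ p₂ hp₂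
  have L4 := hmax₃ q₂ hq₂
  have hlin : IsLinearMap ℝ (fun z : Fin 2 → ℝ => z 1 - z 0) :=
    ⟨fun x y => by simp; ring, fun c x => by simp; ring⟩
  have htop : p₁ 1 = 1 ∨ p₂ 0 = 0 := by
    by_contra! hcon
    have hsub : K ⊆ {z | z 1 - z 0 < 1} := by
      rw [hhull]
      apply convexHull_min _ (convex_halfSpace_lt hlin 1)
      have h1 : p₁ 1 < 2 := by linarith
      have h2 : q₁ 1 < 0 := lt_of_le_of_ne (by linarith) (fun h => hcon.1 (by linarith))
      have h3 : 0 < p₂ 0 := lt_of_le_of_ne (by linarith) (fun h => hcon.2 h.symm)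
      rintro _ (rfl | rfl | rfl | rfl) <;> simp only [Set.mem_ofPred_eq] <;> linarith
    have := hsub hp₃
    simp only [Set.mem_ofPred_eq] at this
    linarith
  have hbot : p₁ 1 = 0 ∨ p₂ 0 = 1 := by
    by_contra! hcon
    have hsub : K ⊆ {z | -1 < z 1 - z 0} := by
      rw [hhull]
      apply convexHull_min _ (convex_halfSpace_gt hlin (-1))
      have h2 : 0 < p₁ 1 := lt_of_le_of_ne (by linarith) (fun h => hcon.1 h.symm)
      have h3 : p₂ 0 < 1 := lt_of_le_of_ne
        (by linarith [(hmax p₂ hp₂).2]) (fun h => hcon.2 h)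
      rintro _ (rfl | rfl | rfl | rfl) <;> simp only [Set.mem_ofPred_eq] <;> linarith
    have := hsub hq₃
    simp only [Set.mem_ofPred_eq] at this
    linarith
  have hvec : ∀ (z : Fin 2 → ℝ) (a b : ℝ), z 0 = a → z 1 = b → z = ![a, b] := by
    rintro z a b rfl rfl
    ext i
    fin_cases i <;> rfl
  have hcases : (p₁ 1 = 0 ∧ p₂ 0 = 0) ∨ (p₁ 1 = 1 ∧ p₂ 0 = 1) := by
    rcases htop with h | h <;> rcases hbot with h' | h'
    · linarith
    · exact Or.inr ⟨h, h'⟩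
    · exact Or.inl ⟨h', h⟩
    · linarith
  rcases hcases with ⟨h, h'⟩ | ⟨h, h'⟩
  · left
    rw [hhull, hvec p₁ 1 0 P1 h, hvec q₁ (-1) (-1) Q1 (by linarith),
      hvec p₂ 0 1 h' P2, hvec q₂ (-1) (-1) (by linarith) Q2]
  · right
    rw [hhull, hvec p₁ 1 1 P1 h, hvec q₁ (-1) 0 Q1 (by linarith),
      hvec p₂ 1 1 h' P2, hvec q₂ 0 (-1) (by linarith) Q2]

/-- A body with interior has only finitely many lattice directions of bounded width, so one of
them realizes the lattice width. -/
lemma exists_lattice_width {K : Set (Fin 2 → ℝ)} (hc : IsCompact K)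
    (hintr : (interior K).Nonempty) : ∃ a : Fin 2 → ℤ, a ≠ 0 ∧ ∃ p ∈ K, ∃ q ∈ K,
      (∀ z ∈ K, latticeForm a q ≤ latticeForm a z ∧ latticeForm a z ≤ latticeForm a p) ∧
      ∀ m : Fin 2 → ℤ, m ≠ 0 → ∃ p' ∈ K, ∃ q' ∈ K,
        latticeForm a p - latticeForm a q ≤ latticeForm m p' - latticeForm m q' := by
  obtain ⟨c, hcK⟩ := hintr
  have hne : K.Nonempty := ⟨c, interior_subset hcK⟩
  choose p hp q hq hpq using exists_latticeForm_extrema hc hne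
  obtain ⟨ε, hε, hball⟩ := Metric.nhds_basis_closedBall.mem_iff.mp (mem_interior_iff_mem_nhds.mp hcK)
  have hshift : ∀ x y : ℝ, |x| ≤ ε → |y| ≤ ε → c + ![x, y] ∈ K := by
    intro x y hx hy
    apply hball
    rw [Metric.mem_closedBall, dist_eq_norm, add_sub_cancel_left,
      pi_norm_le_iff_of_nonneg hε.le]
    intro i
    fin_cases i <;> simpa
  let W : (Fin 2 → ℤ) → ℝ := fun m => latticeForm m (p m) - latticeForm m (q m)
  have hW : ∀ m, ∀ i, ε * |(m i : ℝ)| ≤ W m := by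
    intro m i
    have h1 := hpq m _ (hshift ε 0 (by simp [abs_of_pos hε]) (by simp [hε.le]))
    have h2 := hpq m _ (hshift (-ε) 0 (by simp [abs_of_pos hε]) (by simp [hε.le]))
    have h3 := hpq m _ (hshift 0 ε (by simp [hε.le]) (by simp [abs_of_pos hε]))
    have h4 := hpq m _ (hshift 0 (-ε) (by simp [hε.le]) (by simp [abs_of_pos hε]))
    have h5 := hpq m c (interior_subset hcK)
    simp only [W, latticeForm_apply, Pi.add_apply, Matrix.cons_val_zero,
      Matrix.cons_val_one] at h1 h2 h3 h4 h5 ⊢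
    fin_cases i <;> simp only [Fin.zero_eta, Fin.mk_one, Fin.isValue] <;>
      rcases abs_cases (m 0 : ℝ) with ⟨h, _⟩ | ⟨h, _⟩ <;>
      rcases abs_cases (m 1 : ℝ) with ⟨h', _⟩ | ⟨h', _⟩ <;>
      simp only [h, h'] <;> nlinarith
  let S : Set (Fin 2 → ℤ) := {m | m ≠ 0 ∧ W m ≤ W ![1, 0]}
  have hS : S.Finite := by
    have hfin : (Set.Icc (fun _ => -⌈W ![1, 0] / ε⌉) (fun _ => ⌈W ![1, 0] / ε⌉) :
        Set (Fin 2 → ℤ)).Finite := Set.finite_Icc _ _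
    refine hfin.subset ?_
    rintro m ⟨_, hm⟩
    have hb : ∀ i, |m i| ≤ ⌈W ![1, 0] / ε⌉ := by
      intro i
      have h : |(m i : ℝ)| ≤ W ![1, 0] / ε := by
        rw [le_div_iff₀ hε]
        linarith [hW m i]
      exact_mod_cast h.trans (Int.le_ceil _)
    exact ⟨fun i => (abs_le.mp (hb i)).1, fun i => (abs_le.mp (hb i)).2⟩
  obtain ⟨a, ⟨ha0, ha1⟩, hmin⟩ := Set.exists_min_image S W hS ⟨![1, 0], by simp, le_rfl⟩
  refine ⟨a, ha0, p a, hp a, q a, hq a, hpq a, fun m hm => ⟨p m, hp m, q m, hq m, ?_⟩⟩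
  by_cases h : W m ≤ W ![1, 0]
  · exact hmin m ⟨hm, h⟩
  · exact ha1.trans (not_le.mp h).le

/-- A lattice vector realizing the lattice width is primitive, and can be completed to a basis by
a vector reduced with respect to a given chord. -/
lemma exists_reduced_basis {K : Set (Fin 2 → ℝ)} {a : Fin 2 → ℤ} {p q : Fin 2 → ℝ}
    (ha : a ≠ 0) (hpos : 0 < latticeForm a p - latticeForm a q)
    (hmax : ∀ z ∈ K, latticeForm a q ≤ latticeForm a z ∧ latticeForm a z ≤ latticeForm a p)
    (hmin : ∀ m : Fin 2 → ℤ, m ≠ 0 → ∃ p' ∈ K, ∃ q' ∈ K,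
      latticeForm a p - latticeForm a q ≤ latticeForm m p' - latticeForm m q') :
    ∃ b : Fin 2 → ℤ, (a 0 * b 1 - a 1 * b 0 = 1 ∨ a 0 * b 1 - a 1 * b 0 = -1) ∧
      0 ≤ latticeForm b p - latticeForm b q ∧
      2 * (latticeForm b p - latticeForm b q) ≤ latticeForm a p - latticeForm a q := by
  have hcop : Int.gcd (a 0) (a 1) = 1 := by
    have hg0 : Int.gcd (a 0) (a 1) ≠ 0 := by
      intro h
      rw [Int.gcd_eq_zero_iff] at h
      apply ha
      ext i
      fin_cases i
      exacts [h.1, h.2]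
    obtain ⟨c, hc⟩ := Int.gcd_dvd_left (a 0) (a 1)
    obtain ⟨d, hd⟩ := Int.gcd_dvd_right (a 0) (a 1)
    set g := Int.gcd (a 0) (a 1)
    by_contra hg1
    have hg2 : (2 : ℝ) ≤ g := by
      have : 2 ≤ g := by omega
      exact_mod_cast this
    have hm : (![c, d] : Fin 2 → ℤ) ≠ 0 := by
      intro h
      have h0 : c = 0 := congrFun h 0
      have h1 : d = 0 := congrFun h 1
      apply ha
      ext i
      fin_cases i
      · simpa [h0] using hc
      · simpa [h1] using hd
    obtain ⟨p', hp', q', hq', hle⟩ := hmin _ hm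
    have h1 := (hmax p' hp').2
    have h2 := (hmax q' hq').1
    have hc' : (a 0 : ℝ) = g * c := by exact_mod_cast hc
    have hd' : (a 1 : ℝ) = g * d := by exact_mod_cast hd
    have e : ∀ z, latticeForm a z = g * latticeForm ![c, d] z := by
      intro z
      simp only [latticeForm_apply, hc', hd', Matrix.cons_val_zero, Matrix.cons_val_one]
      ring
    have h3 : g * (latticeForm ![c, d] p' - latticeForm ![c, d] q')
        ≤ latticeForm a p - latticeForm a q := by
      rw [mul_sub, ← e, ← e]
      linarith
    nlinarith
  set x := Int.gcdA (a 0) (a 1)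
  set y := Int.gcdB (a 0) (a 1)
  have hbez : a 0 * x + a 1 * y = 1 := by
    rw [← Int.gcd_eq_gcd_ab, hcop]; rfl
  set w := latticeForm a p - latticeForm a q
  set τ := latticeForm ![-y, x] p - latticeForm ![-y, x] q with hτ
  set k := round (τ / w)
  have hk : |τ - k * w| ≤ w / 2 := by
    have h := abs_sub_round (τ / w)
    have e : τ - k * w = (τ / w - k) * w := by field_simp
    rw [e, abs_mul, abs_of_pos hpos]
    nlinarith
  have hform : ∀ σ : ℤ, latticeForm ![σ * (-y - k * a 0), σ * (x - k * a 1)] p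
      - latticeForm ![σ * (-y - k * a 0), σ * (x - k * a 1)] q = σ * (τ - k * w) := by
    intro σ
    simp only [hτ, w, latticeForm_apply, Matrix.cons_val_zero, Matrix.cons_val_one]
    push_cast
    ring
  rcases le_total 0 (τ - k * w) with h | h
  · refine ⟨![1 * (-y - k * a 0), 1 * (x - k * a 1)], Or.inl ?_, ?_, ?_⟩
    · simp only [Matrix.cons_val_zero, Matrix.cons_val_one]
      linear_combination hbez
    · rw [hform]; simpa using h
    · rw [hform]
      rw [abs_of_nonneg h] at hk
      push_cast
      linarith
  · refine ⟨![-1 * (-y - k * a 0), -1 * (x - k * a 1)], Or.inr ?_, ?_, ?_⟩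
    · simp only [Matrix.cons_val_zero, Matrix.cons_val_one]
      linear_combination -hbez
    · rw [hform]; push_cast; linarith
    · rw [hform]
      rw [abs_of_nonpos h] at hk
      push_cast
      linarith

lemma latticeForm_toLin' (A : Matrix (Fin 2) (Fin 2) ℤ) (m : Fin 2 → ℤ) (z : Fin 2 → ℝ) :
    latticeForm m (Matrix.toLin' (A.map ((↑) : ℤ → ℝ)) z)
      = latticeForm (Matrix.vecMul m A) z := by
  simp only [latticeForm_apply, Matrix.toLin'_apply, Matrix.mulVec, Matrix.vecMul, dotProduct,
    Fin.sum_univ_two, Matrix.map_apply]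
  push_cast
  ring

lemma toLin'_map_mul (A B : Matrix (Fin 2) (Fin 2) ℤ) (s : Set (Fin 2 → ℝ)) :
    Matrix.toLin' ((A * B).map ((↑) : ℤ → ℝ)) '' s
      = Matrix.toLin' (A.map ((↑) : ℤ → ℝ)) '' (Matrix.toLin' (B.map ((↑) : ℤ → ℝ)) '' s) := by
  have h : (A * B).map ((↑) : ℤ → ℝ) = A.map ((↑) : ℤ → ℝ) * B.map ((↑) : ℤ → ℝ) :=
    Matrix.map_mul (f := Int.castRingHom ℝ)
  rw [h, Matrix.toLin'_mul, Set.image_image]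
  rfl

lemma toLin'_map_one_image (s : Set (Fin 2 → ℝ)) :
    Matrix.toLin' ((1 : Matrix (Fin 2) (Fin 2) ℤ).map ((↑) : ℤ → ℝ)) '' s = s := by
  rw [Matrix.map_one _ Int.cast_zero Int.cast_one, Matrix.toLin'_one]
  simp

/-- A convex body meeting all integer lines, of area at most `3/2`, is a unimodular image of the
extremal triangle. -/
lemma exists_unimodular_of_volume_le {K : Set (Fin 2 → ℝ)} (hc : IsCompact K) (hK : Convex ℝ K)
    (hintr : (interior K).Nonempty)
    (hline : ∀ m : Fin 2 → ℤ, m ≠ 0 → ∃ x ∈ K, latticeForm m x = 1)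
    (hvol : volume K ≤ ENNReal.ofReal (3 / 2)) :
    ∃ M : Matrix (Fin 2) (Fin 2) ℤ, (M.det = 1 ∨ M.det = -1) ∧
      K = Matrix.toLin' (M.map ((↑) : ℤ → ℝ)) '' extremalTriangle := by
  obtain ⟨a, ha, p, hp, q, hq, hmax, hmin⟩ := exists_lattice_width hc hintr
  have hpos : 0 < latticeForm a p - latticeForm a q := by
    obtain ⟨x, hx, hx'⟩ := hline a ha
    obtain ⟨y, hy, hy'⟩ := hline (-a) (neg_ne_zero.mpr ha)
    have : latticeForm (-a) y = -latticeForm a y := by simp [latticeForm_apply]; ring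
    linarith [(hmax x hx).2, (hmax y hy).1]
  obtain ⟨b, hdet, hb0, hb⟩ := exists_reduced_basis ha hpos hmax hmin
  let A : Matrix (Fin 2) (Fin 2) ℤ := !![a 0, a 1; b 0, b 1]
  have hA : A.det = 1 ∨ A.det = -1 := by simpa [A, Matrix.det_fin_two] using hdet
  have hAu : IsUnit A.det := Int.isUnit_iff.mpr hA
  have hBdet : A⁻¹.det = 1 ∨ A⁻¹.det = -1 :=
    Int.isUnit_iff.mp (Matrix.isUnit_nonsing_inv_det A hAu)
  let L := Matrix.toLin' (A.map ((↑) : ℤ → ℝ))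
  have hL : Continuous L := L.continuous_of_finiteDimensional
  have hKL : K = Matrix.toLin' (A⁻¹.map ((↑) : ℤ → ℝ)) '' (L '' K) := by
    rw [← toLin'_map_mul, Matrix.nonsing_inv_mul A hAu, toLin'_map_one_image]
  have hopen : IsOpenMap L := by
    apply L.isOpenMap_of_finiteDimensional
    intro z
    refine ⟨Matrix.toLin' (A⁻¹.map ((↑) : ℤ → ℝ)) z, ?_⟩
    have h : A.map ((↑) : ℤ → ℝ) * A⁻¹.map ((↑) : ℤ → ℝ)
        = (A * A⁻¹).map ((↑) : ℤ → ℝ) := (Matrix.map_mul (f := Int.castRingHom ℝ)).symm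
    rw [← LinearMap.comp_apply, ← Matrix.toLin'_mul, h, Matrix.mul_nonsing_inv A hAu,
      Matrix.map_one _ Int.cast_zero Int.cast_one, Matrix.toLin'_one, LinearMap.id_apply]
  have hL0 : ∀ z, L z 0 = latticeForm a z := by
    intro z
    simp [L, A, latticeForm_apply, Matrix.mulVec, dotProduct, Fin.sum_univ_two]
  have hL1 : ∀ z, L z 1 = latticeForm b z := by
    intro z
    simp [L, A, latticeForm_apply, Matrix.mulVec, dotProduct, Fin.sum_univ_two]
  have hne : ∀ m : Fin 2 → ℤ, m ≠ 0 → Matrix.vecMul m A ≠ 0 := by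
    intro m hm h
    apply hm
    have := congrArg (fun v => Matrix.vecMul v A⁻¹) h
    simpa [Matrix.vecMul_vecMul, Matrix.mul_nonsing_inv A hAu] using this
  have key := eq_triangle_of_reduced (hc.image hL) (hK.linear_image L)
    (hintr.image L |>.mono (hopen.image_interior_subset K))
    (by
      intro m hm
      obtain ⟨x, hx, hx'⟩ := hline _ (hne m hm)
      exact ⟨L x, ⟨x, hx, rfl⟩, by rw [latticeForm_toLin', hx']⟩)
    (by rwa [volume_unimodular_image hA]) (Set.mem_image_of_mem L hp) (Set.mem_image_of_mem L hq)
    (by rintro _ ⟨z, hz, rfl⟩; simpa only [hL0] using hmax z hz)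
    (by
      intro m hm
      obtain ⟨p', hp', q', hq', h⟩ := hmin _ (hne m hm)
      refine ⟨L p', ⟨p', hp', rfl⟩, L q', ⟨q', hq', rfl⟩, ?_⟩
      rwa [latticeForm_toLin', latticeForm_toLin', hL0, hL0])
    (by rwa [hL1, hL1]) (by rwa [hL0, hL0, hL1, hL1])
  rcases key with h | h
  · refine ⟨A⁻¹, hBdet, ?_⟩
    conv_lhs => rw [hKL, h]
    congr 2
    ext z
    simp only [Set.mem_insert_iff, Set.mem_singleton_iff]
    tauto
  · refine ⟨A⁻¹ * -1, by simpa [Matrix.det_mul, Matrix.det_neg] using hBdet, ?_⟩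
    conv_lhs => rw [hKL, h]
    rw [toLin'_map_mul]
    congr 1
    rw [extremalTriangle, LinearMap.image_convexHull]
    congr 1
    have hneg : ∀ x y : ℝ, Matrix.toLin' ((-1 : Matrix (Fin 2) (Fin 2) ℤ).map ((↑) : ℤ → ℝ))
        ![x, y] = ![-x, -y] := by
      intro x y
      ext i
      fin_cases i <;> simp [Matrix.mulVec, dotProduct, Matrix.one_apply]
    simp only [Set.image_insert_eq, Set.image_singleton, hneg, neg_neg, neg_zero]
    ext z
    simp only [Set.mem_insert_iff, Set.mem_singleton_iff]
    tauto

/-- A convex body in the plane that intersects every integer line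
`m₁x₁ + m₂x₂ = 1` has area at least `3/2`, with equality iff it is the image under a
unimodular transformation of the triangle with vertices `(1,0)`, `(0,1)`, `(-1,-1)`. -/
theorem stmt_0 (K : Set (Fin 2 → ℝ))
    (hK_compact : IsCompact K) (hK_convex : Convex ℝ K)
    (hK_int : (interior K).Nonempty)
    (hK_unavoidable : ∀ m : Fin 2 → ℤ, m ≠ 0 →
      ∃ x ∈ K, ∑ i, (m i : ℝ) * x i = 1) :
    ENNReal.ofReal (3 / 2) ≤ volume K ∧
      (volume K = ENNReal.ofReal (3 / 2) ↔
        ∃ M : Matrix (Fin 2) (Fin 2) ℤ, (M.det = 1 ∨ M.det = -1) ∧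
          K = (Matrix.toLin' (M.map ((↑) : ℤ → ℝ))) ''
            (convexHull ℝ {![(1 : ℝ), 0], ![0, 1], ![-1, -1]})) := by
  have himp := exists_unimodular_of_volume_le hK_compact hK_convex hK_int hK_unavoidable
  have hvol : ∀ M : Matrix (Fin 2) (Fin 2) ℤ, (M.det = 1 ∨ M.det = -1) →
      K = Matrix.toLin' (M.map ((↑) : ℤ → ℝ)) '' extremalTriangle →
      volume K = ENNReal.ofReal (3 / 2) := by
    intro M hM h
    rw [h, volume_unimodular_image hM, volume_extremalTriangle]
  refine ⟨?_, fun h => himp h.le, fun ⟨M, hM, h⟩ => hvol M hM h⟩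
  by_contra! hlt
  obtain ⟨M, hM, h⟩ := himp hlt.le
  exact hlt.ne (hvol M hM h)
end

section
/- Let K ⊂ ℝⁿ be a convex body that intersects every integer hyperplane {x ∈ ℝⁿ : m₁x₁ + ⋯ + mₙxₙ = 1}, m ∈ ℤⁿ \ {0}. Then the Lebesgue volume of K is at least (π/8)ⁿ · (n+1)/n!. -/
open MeasureTheory
open Module Set Filter Topology
open scoped NNReal ENNReal Pointwise RealInnerProductSpace

section ChangeOfVariables

variable {V : Type*} [NormedAddCommGroup V] [NormedSpace ℝ V] [FiniteDimensional ℝ V]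
  [MeasurableSpace V] [BorelSpace V] (μ : Measure V) [μ.IsAddHaarMeasure]

lemma LipschitzWith.addHaar_image_eq_zero {F : V → V} {C : ℝ≥0} (hF : LipschitzWith C F)
    {s : Set V} (hs : μ s = 0) : μ (F '' s) = 0 := by
  have h1 : (Measure.hausdorffMeasure (finrank ℝ V : ℝ) : Measure V) ≪ μ :=
    Measure.absolutelyContinuous_isAddHaarMeasure _ _
  have h2 : μ ≪ (Measure.hausdorffMeasure (finrank ℝ V : ℝ) : Measure V) :=
    Measure.absolutelyContinuous_isAddHaarMeasure _ _
  refine h2 (le_antisymm ((hF.hausdorffMeasure_image_le (by positivity) s).trans ?_) zero_le)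
  simp [h1 hs]

lemma exists_measurableSet_hasFDerivAt_ae_eq_univ {F : V → V} {C : ℝ≥0} (hF : LipschitzWith C F)
    (hbij : Function.Bijective F) {F' : V → V →L[ℝ] V} (hF' : ∀ᵐ p ∂μ, HasFDerivAt F (F' p) p) :
    ∃ s : Set V, MeasurableSet s ∧ (∀ p ∈ s, HasFDerivAt F (F' p) p) ∧
      s =ᵐ[μ] univ ∧ F '' s =ᵐ[μ] univ := by
  obtain ⟨t, hst, ht, ht0⟩ := exists_measurable_superset_of_null (ae_iff.1 hF')
  refine ⟨tᶜ, ht.compl, fun p hp => ?_, ?_, ?_⟩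
  · by_contra h
    exact hp (hst h)
  · rw [ae_eq_univ, compl_compl, ht0]
  · rw [ae_eq_univ, ← image_compl_eq hbij, compl_compl]
    exact hF.addHaar_image_eq_zero μ ht0

lemma LipschitzWith.integral_abs_det_smul_comp {G : Type*} [NormedAddCommGroup G] [NormedSpace ℝ G]
    {F : V → V} {C : ℝ≥0} (hF : LipschitzWith C F)
    (hbij : Function.Bijective F) {F' : V → V →L[ℝ] V} (hF' : ∀ᵐ p ∂μ, HasFDerivAt F (F' p) p)
    (g : V → G) : ∫ p, |(F' p).det| • g (F p) ∂μ = ∫ p, g p ∂μ := by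
  obtain ⟨s, hs, hd, h1, h2⟩ := exists_measurableSet_hasFDerivAt_ae_eq_univ μ hF hbij hF'
  have := integral_image_eq_integral_abs_det_fderiv_smul μ hs
    (fun p hp => (hd p hp).hasFDerivWithinAt) hbij.injective.injOn g
  rw [setIntegral_congr_set h2, setIntegral_congr_set h1, setIntegral_univ,
    setIntegral_univ] at this
  exact this.symm

lemma LipschitzWith.lintegral_abs_det_mul_comp {F : V → V} {C : ℝ≥0} (hF : LipschitzWith C F)
    (hbij : Function.Bijective F) {F' : V → V →L[ℝ] V} (hF' : ∀ᵐ p ∂μ, HasFDerivAt F (F' p) p)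
    (g : V → ℝ≥0∞) : ∫⁻ p, ENNReal.ofReal |(F' p).det| * g (F p) ∂μ = ∫⁻ p, g p ∂μ := by
  obtain ⟨s, hs, hd, h1, h2⟩ := exists_measurableSet_hasFDerivAt_ae_eq_univ μ hF hbij hF'
  have := lintegral_image_eq_lintegral_abs_det_fderiv_mul μ hs
    (fun p hp => (hd p hp).hasFDerivWithinAt) hbij.injective.injOn g
  rw [setLIntegral_congr h2, setLIntegral_congr h1, setLIntegral_univ, setLIntegral_univ] at this
  exact this.symm

omit [MeasurableSpace V] [BorelSpace V] in
lemma exists_abs_det_le_of_norm_le (C : ℝ) :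
    ∃ M : ℝ, ∀ A : V →L[ℝ] V, ‖A‖ ≤ C → |A.det| ≤ M := by
  have hc : IsCompact (Metric.closedBall (0 : V →L[ℝ] V) C) := isCompact_closedBall _ _
  obtain ⟨M, hM⟩ := hc.exists_bound_of_continuousOn
    (f := fun A : V →L[ℝ] V => A.det) ContinuousLinearMap.continuous_det.continuousOn
  exact ⟨M, fun A hA => hM A (by simpa using hA)⟩

end ChangeOfVariables

section Analytic

/-- Analyticity in `s` of the integral of `exp (-(s⁻¹ a + s b + c))` at a point where the real part
of the exponent is coercive. -/
lemma analyticAt_integral_cexp {X : Type*} [MeasurableSpace X] {μ : Measure X}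
    {a b c : X → ℂ} {R w : X → ℝ} {C : ℝ} (ha : Measurable a) (hb : Measurable b)
    (hc : Measurable c) (hw : Measurable w) (hR0 : ∀ p, 0 ≤ R p)
    (haR : ∀ p, ‖a p‖ ≤ C * R p) (hbR : ∀ p, ‖b p‖ ≤ C * R p)
    (hint : ∀ ε > 0, Integrable (fun p => Real.exp (-(ε * R p)) * w p) μ)
    {s₀ : ℂ} (hs₀ : s₀ ≠ 0) {ε : ℝ} (hε : 0 < ε)
    (hco : ∀ p, ε * R p ≤ (s₀⁻¹ * a p + s₀ * b p + c p).re) :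
    AnalyticAt ℂ (fun s => ∫ p, Complex.exp (-(s⁻¹ * a p + s * b p + c p)) * (w p : ℂ) ∂μ) s₀ := by
  have hinv : Tendsto (fun s : ℂ => ‖s⁻¹ - s₀⁻¹‖) (𝓝 s₀) (𝓝 0) := by
    have h1 : Tendsto (fun s : ℂ => s⁻¹) (𝓝 s₀) (𝓝 s₀⁻¹) := tendsto_inv₀ hs₀
    simpa using (h1.sub_const s₀⁻¹).norm
  have hid : Tendsto (fun s : ℂ => ‖s - s₀‖) (𝓝 s₀) (𝓝 0) := by
    simpa using ((continuous_id.tendsto s₀).sub_const s₀).norm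
  have hD : 0 < |C| + 1 := by positivity
  have hCD : C ≤ |C| + 1 := (le_abs_self C).trans (by linarith)
  set D := |C| + 1 with hDdef
  have haD : ∀ p, ‖a p‖ ≤ D * R p := fun p =>
    (haR p).trans (mul_le_mul_of_nonneg_right hCD (hR0 p))
  have hbD : ∀ p, ‖b p‖ ≤ D * R p := fun p =>
    (hbR p).trans (mul_le_mul_of_nonneg_right hCD (hR0 p))
  have hq : (0 : ℝ) < ε / (4 * D) := by positivity
  have ev : ∀ᶠ s in 𝓝 s₀, s ≠ 0 ∧ ‖s⁻¹ - s₀⁻¹‖ < ε / (4 * D) ∧ ‖s - s₀‖ < ε / (4 * D) :=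
    (continuous_id.continuousAt.eventually_ne hs₀).and
      ((hinv.eventually_lt_const hq).and (hid.eventually_lt_const hq))
  obtain ⟨U, hU, hUo, hsU⟩ := eventually_nhds_iff.1 ev
  have hre : ∀ s ∈ U, ∀ p, ε / 2 * R p ≤ (s⁻¹ * a p + s * b p + c p).re := by
    intro s hs p
    obtain ⟨-, h1, h2⟩ := hU s hs
    have e : s⁻¹ * a p + s * b p + c p =
        (s₀⁻¹ * a p + s₀ * b p + c p) + ((s⁻¹ - s₀⁻¹) * a p + (s - s₀) * b p) := by ring
    have h3 : ‖(s⁻¹ - s₀⁻¹) * a p + (s - s₀) * b p‖ ≤ ε / 2 * R p := by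
      refine (norm_add_le _ _).trans ?_
      rw [norm_mul, norm_mul]
      have h4 : ‖s⁻¹ - s₀⁻¹‖ * ‖a p‖ ≤ ε / (4 * D) * (D * R p) := by
        have := haD p
        gcongr
      have h5 : ‖s - s₀‖ * ‖b p‖ ≤ ε / (4 * D) * (D * R p) := by
        have := hbD p
        gcongr
      have e2 : ε / (4 * D) * (D * R p) = ε / 4 * R p := by field_simp
      rw [e2] at h4 h5
      linarith
    rw [e, Complex.add_re]
    have h6 := (abs_le.1 ((Complex.abs_re_le_norm _).trans h3)).1
    have := hco p
    linarith
  have hmeas : ∀ s : ℂ, Measurable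
      (fun p => Complex.exp (-(s⁻¹ * a p + s * b p + c p)) * (w p : ℂ)) := by
    intro s
    fun_prop
  have hbound : ∀ s ∈ U, ∀ p, ‖Complex.exp (-(s⁻¹ * a p + s * b p + c p)) * (w p : ℂ)‖ ≤
      ‖Real.exp (-(ε / 2 * R p)) * w p‖ := by
    intro s hs p
    rw [norm_mul, norm_mul, Complex.norm_exp, Complex.norm_real, Complex.neg_re,
      Real.norm_of_nonneg (Real.exp_pos _).le]
    gcongr
    exact hre s hs p
  have hdiff : DifferentiableOn ℂ
      (fun s => ∫ p, Complex.exp (-(s⁻¹ * a p + s * b p + c p)) * (w p : ℂ) ∂μ) U := by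
    intro s hs
    have hs0 : s ≠ 0 := (hU s hs).1
    have ev2 : ∀ᶠ z in 𝓝 s, z ∈ U ∧ ‖(z ^ 2)⁻¹‖ < ‖(s ^ 2)⁻¹‖ + 1 := by
      refine (hUo.eventually_mem hs).and ?_
      have : ContinuousAt (fun z : ℂ => ‖(z ^ 2)⁻¹‖) s :=
        ((continuousAt_id.pow 2).inv₀ (pow_ne_zero 2 hs0)).norm
      exact this.eventually_lt_const (by linarith)
    set B := ‖(s ^ 2)⁻¹‖ + 1 with hB
    have hB0 : 0 < B := by positivity
    refine (hasDerivAt_integral_of_dominated_loc_of_deriv_le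
      (F' := fun z p => Complex.exp (-(z⁻¹ * a p + z * b p + c p)) *
        (-(-(z ^ 2)⁻¹ * a p + b p)) * (w p : ℂ))
      (bound := fun p => (B + 1) * D * (4 / ε) * ‖Real.exp (-(ε / 4 * R p)) * w p‖)
      ev2 (Eventually.of_forall fun z => (hmeas z).aestronglyMeasurable) ?_ ?_ ?_ ?_
      ?_).2.differentiableAt.differentiableWithinAt
    · exact ((hint (ε / 2) (by positivity)).norm).mono' (hmeas s).aestronglyMeasurable
        (ae_of_all _ (hbound s hs))
    · refine Measurable.aestronglyMeasurable ?_
      fun_prop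
    · refine ae_of_all _ fun p z hz => ?_
      obtain ⟨hzU, hzB⟩ := hz
      have h1 := hre z hzU p
      rw [norm_mul, norm_mul, Complex.norm_exp, Complex.norm_real, Complex.neg_re, norm_neg,
        norm_mul, Real.norm_of_nonneg (Real.exp_pos _).le]
      have h2 : ‖-(z ^ 2)⁻¹ * a p + b p‖ ≤ (B + 1) * D * R p := by
        refine (norm_add_le _ _).trans ?_
        rw [norm_mul, norm_neg]
        have h3 : ‖(z ^ 2)⁻¹‖ * ‖a p‖ ≤ B * (D * R p) := by
          have := haD p
          gcongr
        have := hbD p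
        linarith
      have h3 : R p ≤ 4 / ε * Real.exp (ε / 4 * R p) := by
        have := Real.add_one_le_exp (ε / 4 * R p)
        rw [div_mul_eq_mul_div, le_div_iff₀ hε]
        linarith
      have h4 : Real.exp (-(z⁻¹ * a p + z * b p + c p).re) ≤
          Real.exp (-(ε / 4 * R p)) * Real.exp (-(ε / 4 * R p)) := by
        rw [← Real.exp_add]
        gcongr
        linarith
      have h5 : Real.exp (-(ε / 4 * R p)) * R p ≤ 4 / ε := by
        rw [Real.exp_neg, inv_mul_le_iff₀ (Real.exp_pos _)]
        linarith
      calc _ ≤ Real.exp (-(ε / 4 * R p)) * Real.exp (-(ε / 4 * R p)) * ((B + 1) * D * R p)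
            * ‖w p‖ := by gcongr
        _ = (B + 1) * D * (Real.exp (-(ε / 4 * R p)) * R p) *
            (Real.exp (-(ε / 4 * R p)) * ‖w p‖) := by
          ring
        _ ≤ _ := by gcongr
    · exact ((hint (ε / 4) (by positivity)).norm).const_mul _
    · refine ae_of_all _ fun p z hz => ?_
      have hz0 : z ≠ 0 := (hU z hz.1).1
      have h1 : HasDerivAt (fun z : ℂ => -(z⁻¹ * a p + z * b p + c p))
          (-(-(z ^ 2)⁻¹ * a p + b p)) z := by
        have := (((hasDerivAt_inv hz0).mul_const (a p)).add
          ((hasDerivAt_id z).mul_const (b p))).add_const (c p)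
        exact this.neg.congr_deriv (by ring)
      exact (h1.cexp).mul_const _
  exact hdiff.analyticAt (hUo.mem_nhds hsU)

end Analytic

section PairMap

variable {E : Type*} [NormedAddCommGroup E] [InnerProductSpace ℝ E] {T : E → E} {κ k : ℝ≥0}

/-- The map `(x, x') ↦ (x + s x', T x - s T x')`. -/
def pairMap (T : E → E) (s : ℝ) (p : E × E) : E × E :=
  (p.1 + s • p.2, T p.1 - s • T p.2)

lemma lipschitzWith_of_sub_smul (hT : LipschitzWith k (fun x => T x - (κ : ℝ) • x)) :
    LipschitzWith (k + κ) T := by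
  have h1 : LipschitzWith κ (fun x : E => (κ : ℝ) • x) := by
    have := lipschitzWith_smul (β := E) (κ : ℝ)
    simpa using this
  simpa using hT.add h1

lemma LipschitzWith.pairMap {C : ℝ≥0} (hT : LipschitzWith C T) (s : ℝ) :
    LipschitzWith (max (1 + ‖s‖₊ * 1) (C * 1 + ‖s‖₊ * (C * 1))) (pairMap T s) := by
  have h1 : LipschitzWith 1 (Prod.fst : E × E → E) := LipschitzWith.prod_fst
  have h2 : LipschitzWith 1 (Prod.snd : E × E → E) := LipschitzWith.prod_snd
  have hs := lipschitzWith_smul (β := E) s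
  exact (h1.add (hs.comp h2)).prodMk ((hT.comp h1).sub (hs.comp (hT.comp h2)))

lemma inner_sub_ge_of_sub_smul (hT : LipschitzWith k (fun x => T x - (κ : ℝ) • x)) (x y : E) :
    (κ - k : ℝ) * ‖x - y‖ ^ 2 ≤ ⟪x - y, T x - T y⟫ := by
  have h := hT.norm_sub_le x y
  have e : T x - T y = (T x - (κ : ℝ) • x - (T y - (κ : ℝ) • y)) + (κ : ℝ) • (x - y) := by module
  have h2 := neg_le_of_abs_le
    (abs_real_inner_le_norm (x - y) (T x - (κ : ℝ) • x - (T y - (κ : ℝ) • y)))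
  rw [e, inner_add_right, inner_smul_right, real_inner_self_eq_norm_sq]
  nlinarith [norm_nonneg (x - y)]

lemma pairMap_bijective [CompleteSpace E] (hT : LipschitzWith k (fun x => T x - (κ : ℝ) • x))
    (hk : k < κ) {s : ℝ} (hs : 0 < s) : Function.Bijective (pairMap T s) := by
  have hκ : (0 : ℝ) < κ := lt_of_le_of_lt k.2 hk
  have hkR : (k : ℝ) < κ := hk
  constructor
  · rintro ⟨x, x'⟩ ⟨y, y'⟩ h
    simp only [pairMap, Prod.mk.injEq] at h
    obtain ⟨h1, h2⟩ := h
    have e1 : x - y = -(s • (x' - y')) := by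
      rw [smul_sub, ← sub_eq_zero]
      rw [← sub_eq_zero] at h1
      rw [← h1]
      abel
    have e2 : T x - T y = s • (T x' - T y') := by
      rw [smul_sub, ← sub_eq_zero]
      rw [← sub_eq_zero] at h2
      rw [← h2]
      abel
    have m1 := inner_sub_ge_of_sub_smul hT x y
    have m2 := inner_sub_ge_of_sub_smul hT x' y'
    have e3 : ⟪x - y, T x - T y⟫ = -(s ^ 2 * ⟪x' - y', T x' - T y'⟫) := by
      rw [e1, e2, inner_neg_left, inner_smul_left, inner_smul_right]
      simp
      ring
    have h3 : (0 : ℝ) ≤ (κ - k) * ‖x' - y'‖ ^ 2 := by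
      have : (0 : ℝ) ≤ κ - k := by linarith
      positivity
    have h4 : ‖x - y‖ ^ 2 ≤ 0 := by
      by_contra! h
      have h5 : 0 < (κ - k : ℝ) * ‖x - y‖ ^ 2 := mul_pos (by linarith) h
      have h6 : 0 ≤ s ^ 2 * ⟪x' - y', T x' - T y'⟫ := mul_nonneg (by positivity) (h3.trans m2)
      linarith
    have h5 : x - y = 0 := by
      rw [← norm_eq_zero]
      exact pow_eq_zero_iff (two_ne_zero) |>.1 (le_antisymm h4 (by positivity))
    have h6 : x' - y' = 0 := by
      rw [h5, eq_comm, neg_eq_zero, smul_eq_zero] at e1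
      exact e1.resolve_left hs.ne'
    rw [sub_eq_zero.1 h5, sub_eq_zero.1 h6]
  · rintro ⟨a, b⟩
    let G : E → E := fun z => z + (2 * s * κ)⁻¹ • (T (a - s • z) - s • T z - b)
    have hG : ContractingWith (k / κ) G := by
      refine ⟨(div_lt_one (lt_of_le_of_lt k.2 hk)).2 hk, LipschitzWith.of_dist_le_mul fun z w => ?_⟩
      have e : G z - G w = (2 * s * κ)⁻¹ •
          ((T (a - s • z) - (κ : ℝ) • (a - s • z) - (T (a - s • w) - (κ : ℝ) • (a - s • w))) -
            s • (T z - (κ : ℝ) • z - (T w - (κ : ℝ) • w))) := by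
        have : z - w = (2 * s * κ)⁻¹ • ((2 * s * κ) • (z - w)) := by
          rw [smul_smul, inv_mul_cancel₀ (by positivity), one_smul]
        simp only [G]
        rw [add_sub_add_comm, this, ← smul_sub, ← smul_add]
        congr 1
        module
      have n1 := hT.norm_sub_le (a - s • z) (a - s • w)
      have n2 := hT.norm_sub_le z w
      have n3 : ‖a - s • z - (a - s • w)‖ = s * ‖z - w‖ := by
        rw [sub_sub_sub_cancel_left, ← smul_sub, norm_smul, Real.norm_of_nonneg hs.le,
          norm_sub_rev]
      rw [n3] at n1
      rw [dist_eq_norm, dist_eq_norm, e, norm_smul, Real.norm_of_nonneg (by positivity),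
        inv_mul_le_iff₀ (by positivity), NNReal.coe_div]
      refine (norm_sub_le _ _).trans ?_
      rw [norm_smul, Real.norm_of_nonneg hs.le]
      have e3 : 2 * s * κ * (k / κ * ‖z - w‖) = k * (s * ‖z - w‖) + s * (k * ‖z - w‖) := by
        field_simp
        ring
      rw [e3]
      gcongr
    have hfix := hG.fixedPoint_isFixedPt
    set z := ContractingWith.fixedPoint G hG
    have h1 : (2 * s * κ)⁻¹ • (T (a - s • z) - s • T z - b) = 0 := by
      have : z + (2 * s * κ)⁻¹ • (T (a - s • z) - s • T z - b) = z := hfix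
      simpa using this
    rw [smul_eq_zero] at h1
    have h2 := h1.resolve_left (by positivity)
    refine ⟨(a - s • z, z), ?_⟩
    simp only [pairMap, Prod.mk.injEq, sub_add_cancel, true_and]
    exact sub_eq_zero.1 h2

/-- The derivative of `pairMap T s` at `(x, x')`, when `T` has derivatives `H` at `x` and
`H'` at `x'`. -/
def pairDeriv (H H' : E →L[ℝ] E) (s : ℝ) : E × E →L[ℝ] E × E :=
  (ContinuousLinearMap.fst ℝ E E + s • ContinuousLinearMap.snd ℝ E E).prod
    (H ∘L ContinuousLinearMap.fst ℝ E E - s • (H' ∘L ContinuousLinearMap.snd ℝ E E))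

lemma hasFDerivAt_pairMap {H H' : E →L[ℝ] E} {p : E × E} (h : HasFDerivAt T H p.1)
    (h' : HasFDerivAt T H' p.2) (s : ℝ) : HasFDerivAt (pairMap T s) (pairDeriv H H' s) p := by
  have h1 : HasFDerivAt (fun q : E × E => T q.1) (H ∘L ContinuousLinearMap.fst ℝ E E) p :=
    h.comp p hasFDerivAt_fst
  have h2 : HasFDerivAt (fun q : E × E => T q.2) (H' ∘L ContinuousLinearMap.snd ℝ E E) p :=
    h'.comp p hasFDerivAt_snd
  exact (hasFDerivAt_fst.add (hasFDerivAt_snd.const_smul s)).prodMk (h1.sub (h2.const_smul s))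

lemma det_pairDeriv [FiniteDimensional ℝ E] (H H' : E →L[ℝ] E) (s : ℝ) :
    (pairDeriv H H' s).det = s ^ finrank ℝ E * (pairDeriv H H' 1).det := by
  have e : (pairDeriv H H' s : E × E →ₗ[ℝ] E × E) = (pairDeriv H H' 1 : E × E →ₗ[ℝ] E × E) ∘ₗ
      LinearMap.prodMap LinearMap.id (s • LinearMap.id) := by
    ext x <;> simp [pairDeriv]
  rw [ContinuousLinearMap.det, ContinuousLinearMap.det, e, LinearMap.det_comp,
    LinearMap.det_prodMap, LinearMap.det_smul]
  simp [mul_comm]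

lemma norm_pairDeriv_one_le (H H' : E →L[ℝ] E) {C : ℝ} (hH : ‖H‖ ≤ C) (hH' : ‖H'‖ ≤ C) :
    ‖pairDeriv H H' 1‖ ≤ 2 + 2 * C := by
  have hC : 0 ≤ C := (norm_nonneg H).trans hH
  refine ContinuousLinearMap.opNorm_le_bound _ (by positivity) fun p => ?_
  have h1 := norm_fst_le p
  have h2 := norm_snd_le p
  have h3 : ‖H p.1‖ ≤ C * ‖p‖ := (H.le_opNorm _).trans (by gcongr)
  have h4 : ‖H' p.2‖ ≤ C * ‖p‖ := (H'.le_opNorm _).trans (by gcongr)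
  have hp := norm_nonneg p
  simp only [pairDeriv, one_smul, ContinuousLinearMap.prod_apply, Prod.norm_mk]
  refine max_le ((norm_add_le _ _).trans ?_) ((norm_sub_le _ _).trans ?_)
  · change ‖p.1‖ + ‖p.2‖ ≤ _
    nlinarith
  · change ‖H p.1‖ + ‖H' p.2‖ ≤ _
    nlinarith

end PairMap

section Gaussian

variable (E : Type*) [NormedAddCommGroup E] [InnerProductSpace ℝ E] [FiniteDimensional ℝ E]
  [MeasurableSpace E] [BorelSpace E]

lemma integrable_exp_neg_mul_norm_sq {ε : ℝ} (hε : 0 < ε) :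
    Integrable (fun x : E => Real.exp (-(ε * ‖x‖ ^ 2))) := by
  have h := GaussianFourier.integrable_cexp_neg_mul_sq_norm_add (V := E) (b := (ε : ℂ))
    (by simpa using hε) 0 0
  refine h.norm.congr (ae_of_all _ fun x => ?_)
  simp only [Complex.norm_exp]
  congr 1
  simp [← Complex.ofReal_pow]

lemma integrable_exp_neg_mul_norm_sq_prod {ε : ℝ} (hε : 0 < ε) :
    Integrable (fun p : E × E => Real.exp (-(ε * (‖p.1‖ ^ 2 + ‖p.2‖ ^ 2)))) := by
  refine ((integrable_exp_neg_mul_norm_sq E hε).mul_prod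
    (integrable_exp_neg_mul_norm_sq E hε)).congr (ae_of_all _ fun p => ?_)
  simp only [← Real.exp_add]
  congr 1
  ring

lemma integral_cexp_neg_norm_sq_add_inner {α : ℝ} (hα : 0 < α) :
    ∫ p : E × E, Complex.exp (-((α * (‖p.1‖ ^ 2 + ‖p.2‖ ^ 2) : ℝ) +
      2 * Complex.I * (⟪p.1, p.2⟫ : ℝ))) =
      (((Real.pi ^ 2 / (1 + α ^ 2)) ^ (finrank ℝ E / 2 : ℝ) : ℝ) : ℂ) := by
  have hint : Integrable (fun p : E × E => Complex.exp (-((α * (‖p.1‖ ^ 2 + ‖p.2‖ ^ 2) : ℝ) +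
      2 * Complex.I * (⟪p.1, p.2⟫ : ℝ)))) := by
    refine (integrable_exp_neg_mul_norm_sq_prod E hα).mono' ?_ (ae_of_all _ fun p => ?_)
    · refine Continuous.aestronglyMeasurable ?_
      fun_prop
    · rw [Complex.norm_exp]
      simp [-Complex.ofReal_pow]
  have hα' : 0 < ((α : ℂ)).re := by simpa using hα
  have hβ : 0 < α + 1 / α := by positivity
  have hβ' : 0 < (((α + 1 / α : ℝ) : ℂ)).re := by rw [Complex.ofReal_re]; exact hβ
  have hαC : (α : ℂ) ≠ 0 := by exact_mod_cast hα.ne'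
  rw [Measure.volume_eq_prod] at hint ⊢
  rw [integral_prod _ hint]
  have inner_int : ∀ x : E, ∫ y : E, Complex.exp (-((α * (‖x‖ ^ 2 + ‖y‖ ^ 2) : ℝ) +
      2 * Complex.I * (⟪x, y⟫ : ℝ))) =
      (Real.pi / α : ℂ) ^ (finrank ℝ E / 2 : ℂ) *
        Complex.exp (-((α + 1 / α : ℝ) : ℂ) * ‖x‖ ^ 2) := by
    intro x
    have h := GaussianFourier.integral_cexp_neg_mul_sq_norm_add (V := E) hα' (-(2 * Complex.I)) x
    have e : ∀ y : E, Complex.exp (-((α * (‖x‖ ^ 2 + ‖y‖ ^ 2) : ℝ) +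
      2 * Complex.I * (⟪x, y⟫ : ℝ))) = Complex.exp (-α * ‖x‖ ^ 2) *
        Complex.exp (-α * ‖y‖ ^ 2 + -(2 * Complex.I) * (⟪x, y⟫ : ℝ)) := by
      intro y
      rw [← Complex.exp_add]
      congr 1
      push_cast
      ring
    simp_rw [e]
    rw [integral_const_mul, h, mul_left_comm, ← Complex.exp_add]
    congr 2
    push_cast
    rw [neg_sq, mul_pow, Complex.I_sq]
    field_simp
    ring
  simp_rw [inner_int]
  rw [integral_const_mul, GaussianFourier.integral_cexp_neg_mul_sq_norm hβ']
  have e1 : (Real.pi / α : ℂ) ^ (finrank ℝ E / 2 : ℂ) =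
      (((Real.pi / α) ^ (finrank ℝ E / 2 : ℝ) : ℝ) : ℂ) := by
    rw [Complex.ofReal_cpow (by positivity)]
    push_cast
    rfl
  have e2 : (Real.pi / ((α + 1 / α : ℝ) : ℂ) : ℂ) ^ (finrank ℝ E / 2 : ℂ) =
      (((Real.pi / (α + 1 / α)) ^ (finrank ℝ E / 2 : ℝ) : ℝ) : ℂ) := by
    rw [Complex.ofReal_cpow (by positivity)]
    push_cast
    rfl
  rw [e1, e2, ← Complex.ofReal_mul, ← Real.mul_rpow (by positivity) (by positivity)]
  have e3 : Real.pi / α * (Real.pi / (α + 1 / α)) = Real.pi ^ 2 / (1 + α ^ 2) := by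
    field_simp
    ring
  rw [e3]

instance isAddHaarMeasure_volume_prod : (volume : Measure (E × E)).IsAddHaarMeasure :=
  inferInstanceAs ((volume : Measure E).prod (volume : Measure E)).IsAddHaarMeasure

lemma integral_cexp_neg_inv_mul_norm_sq_add_inner {α s : ℝ} (hα : 0 < α) (hs : 0 < s) :
    ∫ p : E × E, Complex.exp (-((s : ℂ)⁻¹ * ((α * (‖p.1‖ ^ 2 + ‖p.2‖ ^ 2) : ℝ) +
      2 * Complex.I * (⟪p.1, p.2⟫ : ℝ)))) =
      (s : ℂ) ^ finrank ℝ E *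
        (((Real.pi ^ 2 / (1 + α ^ 2)) ^ (finrank ℝ E / 2 : ℝ) : ℝ) : ℂ) := by
  rw [← integral_cexp_neg_norm_sq_add_inner E hα]
  have h := Measure.integral_comp_smul (volume : Measure (E × E))
    (fun p => Complex.exp (-((α * (‖p.1‖ ^ 2 + ‖p.2‖ ^ 2) : ℝ) +
      2 * Complex.I * (⟪p.1, p.2⟫ : ℝ)))) (√s)⁻¹
  have hsq : (√s)⁻¹ ^ 2 = s⁻¹ := by rw [inv_pow, Real.sq_sqrt hs.le]
  have e : ∀ p : E × E, Complex.exp (-((s : ℂ)⁻¹ * ((α * (‖p.1‖ ^ 2 + ‖p.2‖ ^ 2) : ℝ) +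
      2 * Complex.I * (⟪p.1, p.2⟫ : ℝ)))) =
      Complex.exp (-((α * (‖((√s)⁻¹ • p).1‖ ^ 2 + ‖((√s)⁻¹ • p).2‖ ^ 2) : ℝ) +
      2 * Complex.I * (⟪((√s)⁻¹ • p).1, ((√s)⁻¹ • p).2⟫ : ℝ))) := by
    intro p
    simp only [Prod.smul_fst, Prod.smul_snd, norm_smul, inner_smul_left, inner_smul_right, mul_pow,
      Real.norm_eq_abs, sq_abs, hsq, conj_trivial]
    rw [← mul_assoc (√s)⁻¹, ← sq, hsq]
    push_cast
    congr 1
    ring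
  simp_rw [e]
  rw [h, finrank_prod, ← two_mul, pow_mul, hsq, inv_pow, inv_inv, abs_of_pos (by positivity),
    Complex.real_smul]
  push_cast
  rfl

end Gaussian

section Contour

variable {E : Type*} [NormedAddCommGroup E] [InnerProductSpace ℝ E]

/-- The exponent `α (‖a‖² + ‖b‖²) + 2 i ⟪a, b⟫`, evaluated at `(a, b) = pairMap T s p` and divided
by `s`. It is polynomial in `s` and `s⁻¹`, so it makes sense for complex `s`. -/
noncomputable def contourExponent (T : E → E) (α : ℝ) (s : ℂ) (p : E × E) : ℂ :=
  s⁻¹ * ((α * (‖p.1‖ ^ 2 + ‖T p.1‖ ^ 2) : ℝ) + 2 * Complex.I * (⟪p.1, T p.1⟫ : ℝ)) +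
  s * ((α * (‖p.2‖ ^ 2 + ‖T p.2‖ ^ 2) : ℝ) - 2 * Complex.I * (⟪p.2, T p.2⟫ : ℝ)) +
  ((2 * α * (⟪p.1, p.2⟫ - ⟪T p.1, T p.2⟫) : ℝ) +
    2 * Complex.I * (⟪p.2, T p.1⟫ - ⟪p.1, T p.2⟫ : ℝ))

lemma contourExponent_ofReal (T : E → E) (α : ℝ) {s : ℝ} (hs : 0 < s) (p : E × E) :
    contourExponent T α s p = (s : ℂ)⁻¹ * ((α * (‖(pairMap T s p).1‖ ^ 2 +
      ‖(pairMap T s p).2‖ ^ 2) : ℝ) +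
      2 * Complex.I * (⟪(pairMap T s p).1, (pairMap T s p).2⟫ : ℝ)) := by
  have hs' : (s : ℂ) ≠ 0 := by exact_mod_cast hs.ne'
  simp only [contourExponent, pairMap, norm_add_sq_real, norm_sub_sq_real, inner_add_left,
    inner_sub_right, inner_smul_left, inner_smul_right, norm_smul, mul_pow, Real.norm_eq_abs,
    sq_abs, conj_trivial]
  push_cast
  field_simp
  ring

lemma re_contourExponent (T : E → E) (α : ℝ) (s : ℂ) (p : E × E) :
    (contourExponent T α s p).re =
      (s.re * (α * (‖p.1‖ ^ 2 + ‖T p.1‖ ^ 2)) + 2 * s.im * ⟪p.1, T p.1⟫) / ‖s‖ ^ 2 +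
      (s.re * (α * (‖p.2‖ ^ 2 + ‖T p.2‖ ^ 2)) + 2 * s.im * ⟪p.2, T p.2⟫) +
      2 * α * (⟪p.1, p.2⟫ - ⟪T p.1, T p.2⟫) := by
  simp only [contourExponent, Complex.add_re, Complex.mul_re, Complex.sub_re, Complex.inv_re,
    Complex.inv_im, Complex.ofReal_re, Complex.ofReal_im, Complex.add_im, Complex.mul_im,
    Complex.sub_im, Complex.I_re, Complex.I_im, Complex.re_ofNat, Complex.im_ofNat,
    Complex.sq_norm]
  ring

lemma abs_inner_sub_inner_le (T : E → E) (p : E × E) {r : ℝ} (hr : 0 < r) :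
    2 * |⟪p.1, p.2⟫ - ⟪T p.1, T p.2⟫| ≤
      (‖p.1‖ ^ 2 + ‖T p.1‖ ^ 2) / r + r * (‖p.2‖ ^ 2 + ‖T p.2‖ ^ 2) := by
  have h1 := abs_real_inner_le_norm p.1 p.2
  have h2 := abs_real_inner_le_norm (T p.1) (T p.2)
  have amgm : ∀ x y : ℝ, 2 * (x * y) ≤ x ^ 2 / r + r * y ^ 2 := by
    intro x y
    have e : x ^ 2 / r + r * y ^ 2 - 2 * (x * y) = (x - r * y) ^ 2 / r := by
      field_simp
      ring
    have : 0 ≤ (x - r * y) ^ 2 / r := by positivity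
    linarith
  have h3 := amgm ‖p.1‖ ‖p.2‖
  have h4 := amgm ‖T p.1‖ ‖T p.2‖
  have h5 := abs_sub ⟪p.1, p.2⟫ ⟪T p.1, T p.2⟫
  rw [add_div]
  linarith

lemma le_re_contourExponent_of_im_pos {T : E → E} {α : ℝ} (hα : 0 < α)
    (hT : ∀ x, α * (‖x‖ ^ 2 + ‖T x‖ ^ 2) ≤ ⟪x, T x⟫) {s : ℂ} (hre : 0 ≤ s.re) (him : 0 < s.im)
    (p : E × E) :
    s.im * (⟪p.1, T p.1⟫ / ‖s‖ ^ 2 + ⟪p.2, T p.2⟫) ≤ (contourExponent T α s p).re := by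
  have hs : 0 < ‖s‖ := norm_pos_iff.2 fun h => by simp [h] at him
  have hsle : ‖s‖ ≤ s.re + s.im := by
    have := Complex.norm_le_abs_re_add_abs_im s
    rwa [abs_of_nonneg hre, abs_of_pos him] at this
  have h1 := abs_inner_sub_inner_le T p hs
  have h2 := neg_le_of_abs_le (le_refl |⟪p.1, p.2⟫ - ⟪T p.1, T p.2⟫|)
  have a1 := hT p.1
  have a2 := hT p.2
  rw [re_contourExponent]
  set P := ‖p.1‖ ^ 2 + ‖T p.1‖ ^ 2
  set P' := ‖p.2‖ ^ 2 + ‖T p.2‖ ^ 2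
  set u := ⟪p.1, T p.1⟫
  set u' := ⟪p.2, T p.2⟫
  set c := ⟪p.1, p.2⟫ - ⟪T p.1, T p.2⟫
  have hP : 0 ≤ P := by positivity
  have hP' : 0 ≤ P' := by positivity
  have h3 : -(α * (P / ‖s‖ + ‖s‖ * P')) ≤ 2 * α * c := by nlinarith
  have h4 : P / ‖s‖ = ‖s‖ * P / ‖s‖ ^ 2 := by field_simp
  have h5 : ∀ Q v : ℝ, 0 ≤ Q → α * Q ≤ v →
      s.im * v ≤ s.re * (α * Q) + 2 * s.im * v - α * (‖s‖ * Q) := by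
    intro Q v hQ hv
    have : α * Q * ‖s‖ ≤ α * Q * (s.re + s.im) := by gcongr
    nlinarith
  have h6 : s.im * u / ‖s‖ ^ 2 ≤
      (s.re * (α * P) + 2 * s.im * u - α * (‖s‖ * P)) / ‖s‖ ^ 2 := by
    have := h5 P u hP a1
    gcongr
  have h7 := h5 P' u' hP' a2
  rw [sub_div] at h6
  rw [h4] at h3
  have h8 : α * (‖s‖ * P / ‖s‖ ^ 2 + ‖s‖ * P') = α * (‖s‖ * P) / ‖s‖ ^ 2 + α * (‖s‖ * P') := by
    ring
  have h9 : s.im * (u / ‖s‖ ^ 2 + u') = s.im * u / ‖s‖ ^ 2 + s.im * u' := by ring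
  linarith

lemma le_re_contourExponent_ofReal {T : E → E} {α : ℝ} (hα : 0 < α)
    (hT : ∀ x, α * (‖x‖ ^ 2 + ‖T x‖ ^ 2) ≤ ⟪x, T x⟫) {s : ℝ} (hs : 0 < s) (p : E × E) :
    2 * α ^ 2 / s * (⟪p.1, T p.1⟫ + s ^ 2 * ⟪p.2, T p.2⟫) ≤ (contourExponent T α s p).re := by
  rw [re_contourExponent]
  have a1 := hT p.1
  have a2 := hT p.2
  have h0 : 0 ≤ ‖(p.1 + s • p.2) - α • (T p.1 + s • T p.2)‖ ^ 2 := by positivity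
  have h1 : 0 ≤ ‖(T p.1 - s • T p.2) - α • (p.1 - s • p.2)‖ ^ 2 := by positivity
  have h5 : 0 ≤ ‖p.1 + s • p.2‖ ^ 2 + ‖T p.1 - s • T p.2‖ ^ 2 := by positivity
  simp only [norm_add_sq_real, norm_sub_sq_real, norm_smul, inner_smul_left, inner_smul_right,
    inner_add_left, inner_add_right, inner_sub_left, inner_sub_right, mul_pow, conj_trivial,
    Real.norm_eq_abs, sq_abs, real_inner_comm p.1 (T p.1), real_inner_comm p.1 (T p.2),
    real_inner_comm p.2 (T p.1), real_inner_comm p.2 (T p.2)] at h0 h1 h5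
  simp only [Complex.ofReal_re, Complex.ofReal_im, Complex.norm_real, Real.norm_eq_abs, sq_abs]
  rw [← sub_nonneg]
  have h2 : 0 ≤ s ^ 2 * (⟪p.2, T p.2⟫ - α * (‖p.2‖ ^ 2 + ‖T p.2‖ ^ 2)) :=
    mul_nonneg (by positivity) (by linarith)
  have key : 0 ≤ α * (‖p.1‖ ^ 2 + ‖T p.1‖ ^ 2 + s ^ 2 * (‖p.2‖ ^ 2 + ‖T p.2‖ ^ 2) +
      2 * s * (⟪p.1, p.2⟫ - ⟪T p.1, T p.2⟫)) -
        2 * α ^ 2 * (⟪p.1, T p.1⟫ + s ^ 2 * ⟪p.2, T p.2⟫) := by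
    have h3 : 0 ≤ α * (⟪p.1, T p.1⟫ - α * (‖p.1‖ ^ 2 + ‖T p.1‖ ^ 2)) :=
      mul_nonneg hα.le (by linarith)
    have h4 := mul_nonneg hα.le h2
    linarith [mul_nonneg hα.le h0, mul_nonneg hα.le h1, mul_nonneg (pow_nonneg hα.le 3) h5,
      mul_nonneg hα.le h3, mul_nonneg hα.le h4]
  refine (div_nonneg key hs.le).trans_eq ?_
  field_simp
  ring

lemma exists_coercive_contourExponent {T : E → E} {α m : ℝ} (hα : 0 < α) (hm : 0 < m)
    (hT : ∀ x, α * (‖x‖ ^ 2 + ‖T x‖ ^ 2) ≤ ⟪x, T x⟫) (hTm : ∀ x, m * ‖x‖ ^ 2 ≤ ⟪x, T x⟫)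
    {s : ℂ} (hs : s ≠ 0) (hre : 0 ≤ s.re) (him : 0 ≤ s.im) :
    ∃ ε > 0, ∀ p : E × E, ε * (‖p.1‖ ^ 2 + ‖p.2‖ ^ 2) ≤ (contourExponent T α s p).re := by
  have hcomb : ∀ (c d : ℝ), 0 < c → 0 < d → ∃ ε > 0, ∀ p : E × E,
      ε * (‖p.1‖ ^ 2 + ‖p.2‖ ^ 2) ≤ c * ⟪p.1, T p.1⟫ + d * ⟪p.2, T p.2⟫ := by
    intro c d hc hd
    refine ⟨min (c * m) (d * m), by positivity, fun p => ?_⟩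
    have h1 : min (c * m) (d * m) * ‖p.1‖ ^ 2 ≤ c * m * ‖p.1‖ ^ 2 := by
      gcongr
      exact min_le_left _ _
    have h2 : min (c * m) (d * m) * ‖p.2‖ ^ 2 ≤ d * m * ‖p.2‖ ^ 2 := by
      gcongr; exact min_le_right _ _
    have h3 := mul_le_mul_of_nonneg_left (hTm p.1) hc.le
    have h4 := mul_le_mul_of_nonneg_left (hTm p.2) hd.le
    linarith
  have hn : 0 < ‖s‖ := norm_pos_iff.2 hs
  rcases him.lt_or_eq with h | h
  · obtain ⟨ε, hε, H⟩ := hcomb (s.im / ‖s‖ ^ 2) s.im (by positivity) h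
    refine ⟨ε, hε, fun p => (H p).trans ?_⟩
    refine le_trans (le_of_eq ?_) (le_re_contourExponent_of_im_pos hα hT hre h p)
    ring
  · have e : s = (s.re : ℂ) := Complex.ext (by simp) (by simp [← h])
    have hpos : 0 < s.re := by
      refine lt_of_le_of_ne hre fun h0 => hs ?_
      rw [e, ← h0, Complex.ofReal_zero]
    obtain ⟨ε, hε, H⟩ := hcomb (2 * α ^ 2 / s.re) (2 * α ^ 2 / s.re * s.re ^ 2)
      (by positivity) (by positivity)
    refine ⟨ε, hε, fun p => (H p).trans ?_⟩
    rw [e]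
    refine le_trans (le_of_eq ?_) (le_re_contourExponent_ofReal hα hT hpos p)
    simp only [Complex.ofReal_re]
    ring

end Contour

section ContourIntegral

variable {E : Type*} [NormedAddCommGroup E] [InnerProductSpace ℝ E] [FiniteDimensional ℝ E]
  [MeasurableSpace E] [BorelSpace E] {T : E → E} {κ k : ℝ≥0} {α : ℝ}

/-- The Jacobian of `pairMap T 1`. -/
noncomputable def pairWeight (T : E → E) (p : E × E) : ℝ :=
  |(pairDeriv (fderiv ℝ T p.1) (fderiv ℝ T p.2) 1).det|

lemma measurable_pairWeight (T : E → E) : Measurable (pairWeight T) := by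
  have h1 : Continuous fun H : (E →L[ℝ] E) × (E →L[ℝ] E) => pairDeriv H.1 H.2 1 := by
    refine (ContinuousLinearMap.prodₗᵢ ℝ (E := E × E) (F := E) (G := E)).continuous.comp
      (Continuous.prodMk continuous_const ?_)
    fun_prop
  have h2 : Continuous fun A : E × E →L[ℝ] E × E => |A.det| :=
    continuous_abs.comp ContinuousLinearMap.continuous_det
  have h3 : Continuous fun H : (E →L[ℝ] E) × (E →L[ℝ] E) => |(pairDeriv H.1 H.2 1).det| :=
    h2.comp h1
  have h4 := measurable_fderiv ℝ T
  have h5 : Measurable fun p : E × E => (fderiv ℝ T p.1, fderiv ℝ T p.2) :=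
    (h4.comp measurable_fst).prodMk (h4.comp measurable_snd)
  have : SecondCountableTopology (E →L[ℝ] E) := secondCountable_of_proper
  have h6 := h3.measurable
  have h7 := h6.comp h5
  have e : pairWeight T = (fun H : (E →L[ℝ] E) × (E →L[ℝ] E) => |(pairDeriv H.1 H.2 1).det|) ∘
      fun p : E × E => (fderiv ℝ T p.1, fderiv ℝ T p.2) := rfl
  rw [e]
  exact h7

omit [MeasurableSpace E] [BorelSpace E] in
lemma exists_pairWeight_le {C : ℝ≥0} (hT : LipschitzWith C T) :
    ∃ M : ℝ, ∀ p, pairWeight T p ≤ M := by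
  obtain ⟨M, hM⟩ := exists_abs_det_le_of_norm_le (V := E × E) (2 + 2 * C)
  exact ⟨M, fun p => hM _ (norm_pairDeriv_one_le _ _ (norm_fderiv_le_of_lipschitz ℝ hT)
    (norm_fderiv_le_of_lipschitz ℝ hT))⟩

lemma integrable_exp_mul_pairWeight {C : ℝ≥0} (hT : LipschitzWith C T) {ε : ℝ} (hε : 0 < ε) :
    Integrable (fun p : E × E =>
      Real.exp (-(ε * (‖p.1‖ ^ 2 + ‖p.2‖ ^ 2))) * pairWeight T p) := by
  obtain ⟨M, hM⟩ := exists_pairWeight_le hT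
  refine ((integrable_exp_neg_mul_norm_sq_prod E hε).mul_const M).mono' ?_
    (ae_of_all _ fun p => ?_)
  · have := measurable_pairWeight T
    exact Measurable.aestronglyMeasurable (by fun_prop)
  · have : 0 ≤ pairWeight T p := abs_nonneg _
    rw [Real.norm_of_nonneg (by positivity)]
    gcongr
    exact hM p

lemma ae_hasFDerivAt_pairMap {C : ℝ≥0} (hT : LipschitzWith C T) (s : ℝ) :
    ∀ᵐ p : E × E, HasFDerivAt (pairMap T s)
      (pairDeriv (fderiv ℝ T p.1) (fderiv ℝ T p.2) s) p := by
  have h : ∀ᵐ x : E, DifferentiableAt ℝ T x := hT.ae_differentiableAt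
  have h1 : ∀ᵐ p : E × E, DifferentiableAt ℝ T p.1 := Measure.quasiMeasurePreserving_fst.ae h
  have h2 : ∀ᵐ p : E × E, DifferentiableAt ℝ T p.2 := Measure.quasiMeasurePreserving_snd.ae h
  filter_upwards [h1, h2] with p hp hp'
  exact hasFDerivAt_pairMap hp.hasFDerivAt hp'.hasFDerivAt s

lemma integral_contourExponent_ofReal (hT : LipschitzWith k (fun x => T x - (κ : ℝ) • x))
    (hk : k < κ) (hα : 0 < α) {s : ℝ} (hs : 0 < s) :
    ∫ p : E × E, Complex.exp (-contourExponent T α s p) * (pairWeight T p : ℂ) =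
      (((Real.pi ^ 2 / (1 + α ^ 2)) ^ (finrank ℝ E / 2 : ℝ) : ℝ) : ℂ) := by
  have hL := lipschitzWith_of_sub_smul hT
  have h := (hL.pairMap s).integral_abs_det_smul_comp volume (pairMap_bijective hT hk hs)
    (ae_hasFDerivAt_pairMap hL s)
    (fun p : E × E => Complex.exp (-((s : ℂ)⁻¹ * ((α * (‖p.1‖ ^ 2 + ‖p.2‖ ^ 2) : ℝ) +
      2 * Complex.I * (⟪p.1, p.2⟫ : ℝ)))))
  rw [integral_cexp_neg_inv_mul_norm_sq_add_inner E hα hs] at h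
  have e : ∀ p : E × E, |(pairDeriv (fderiv ℝ T p.1) (fderiv ℝ T p.2) s).det| •
      Complex.exp (-((s : ℂ)⁻¹ * ((α * (‖(pairMap T s p).1‖ ^ 2 +
        ‖(pairMap T s p).2‖ ^ 2) : ℝ) +
        2 * Complex.I * (⟪(pairMap T s p).1, (pairMap T s p).2⟫ : ℝ)))) =
      (s : ℂ) ^ finrank ℝ E *
        (Complex.exp (-contourExponent T α s p) * (pairWeight T p : ℂ)) := by
    intro p
    rw [← contourExponent_ofReal T α hs, det_pairDeriv, abs_mul, abs_of_pos (pow_pos hs _),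
      Complex.real_smul, pairWeight]
    push_cast
    ring
  simp_rw [e] at h
  rw [integral_const_mul] at h
  exact mul_left_cancel₀ (pow_ne_zero _ (by exact_mod_cast hs.ne')) h

lemma analyticAt_integral_contourExponent {C : ℝ≥0} (hL : LipschitzWith C T) (h0 : T 0 = 0)
    {m : ℝ} (hα : 0 < α) (hm : 0 < m)
    (hT : ∀ x, α * (‖x‖ ^ 2 + ‖T x‖ ^ 2) ≤ ⟪x, T x⟫) (hTm : ∀ x, m * ‖x‖ ^ 2 ≤ ⟪x, T x⟫)
    {s : ℂ} (hs : s ≠ 0) (hre : 0 ≤ s.re) (him : 0 ≤ s.im) :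
    AnalyticAt ℂ (fun s => ∫ p : E × E,
      Complex.exp (-contourExponent T α s p) * (pairWeight T p : ℂ)) s := by
  obtain ⟨ε, hε, hco⟩ := exists_coercive_contourExponent hα hm hT hTm hs hre him
  have hmeas : Measurable T := hL.continuous.measurable
  have hTC : ∀ x, ‖T x‖ ≤ C * ‖x‖ := fun x => by simpa [h0] using hL.norm_sub_le x 0
  have hT2 : ∀ x, ‖T x‖ ^ 2 ≤ (C * ‖x‖) ^ 2 := fun x => by gcongr; exact hTC x
  have hin : ∀ x, |⟪x, T x⟫| ≤ C * ‖x‖ ^ 2 := fun x => by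
    refine (abs_real_inner_le_norm _ _).trans ?_
    nlinarith [hTC x, norm_nonneg x]
  have hb : ∀ x, α * (‖x‖ ^ 2 + ‖T x‖ ^ 2) + 2 * |⟪x, T x⟫| ≤
      (α * (1 + C ^ 2) + 2 * C) * ‖x‖ ^ 2 := fun x => by
    have := mul_le_mul_of_nonneg_left (hT2 x) hα.le
    linarith [hin x]
  have hn : ∀ x, ‖((α * (‖x‖ ^ 2 + ‖T x‖ ^ 2) : ℝ) : ℂ)‖ = α * (‖x‖ ^ 2 + ‖T x‖ ^ 2) := fun x => by
    rw [Complex.norm_real, Real.norm_of_nonneg (by positivity)]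
  have hn' : ∀ x, ‖2 * Complex.I * (⟪x, T x⟫ : ℝ)‖ = 2 * |⟪x, T x⟫| := fun x => by
    simp
  have hCα : 0 ≤ α * (1 + C ^ 2) + 2 * (C : ℝ) := by positivity
  refine analyticAt_integral_cexp (R := fun p : E × E => ‖p.1‖ ^ 2 + ‖p.2‖ ^ 2)
    (C := α * (1 + C ^ 2) + 2 * C) ?_ ?_ ?_
    (measurable_pairWeight T) (fun p => by positivity) (fun p => ?_) (fun p => ?_)
    (fun ε hε => integrable_exp_mul_pairWeight hL hε) hs hε hco
  · fun_prop
  · fun_prop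
  · fun_prop
  · refine (norm_add_le _ _).trans ?_
    rw [hn, hn']
    refine (hb p.1).trans ?_
    gcongr
    exact le_add_of_nonneg_right (by positivity)
  · refine (norm_sub_le _ _).trans ?_
    rw [hn, hn']
    refine (hb p.2).trans ?_
    gcongr
    exact le_add_of_nonneg_left (by positivity)

lemma integral_contourExponent_I (hT : LipschitzWith k (fun x => T x - (κ : ℝ) • x))
    (hk : k < κ) (h0 : T 0 = 0) (hα : 0 < α)
    (hTα : ∀ x, α * (‖x‖ ^ 2 + ‖T x‖ ^ 2) ≤ ⟪x, T x⟫) :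
    ∫ p : E × E, Complex.exp (-contourExponent T α Complex.I p) * (pairWeight T p : ℂ) =
      (((Real.pi ^ 2 / (1 + α ^ 2)) ^ (finrank ℝ E / 2 : ℝ) : ℝ) : ℂ) := by
  have hm : (0 : ℝ) < κ - k := sub_pos.2 hk
  have hTm : ∀ x, (κ - k : ℝ) * ‖x‖ ^ 2 ≤ ⟪x, T x⟫ := fun x => by
    simpa [h0] using inner_sub_ge_of_sub_smul hT x 0
  have hf : AnalyticOnNhd ℂ (fun s => ∫ p : E × E,
      Complex.exp (-contourExponent T α s p) * (pairWeight T p : ℂ))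
      {s | s ≠ 0 ∧ 0 ≤ s.re ∧ 0 ≤ s.im} := fun s hs =>
    analyticAt_integral_contourExponent (lipschitzWith_of_sub_smul hT) h0 hα hm hTα hTm
      hs.1 hs.2.1 hs.2.2
  have hseg : segment ℝ 1 Complex.I ⊆ {s | s ≠ 0 ∧ 0 ≤ s.re ∧ 0 ≤ s.im} := by
    rintro s ⟨a, b, ha, hb, hab, rfl⟩
    refine ⟨fun h => ?_, by simpa using ha, by simpa using hb⟩
    have h1 := congrArg Complex.re h
    have h2 := congrArg Complex.im h
    simp at h1 h2
    linarith
  refine (hf.mono hseg).eqOn_of_preconnected_of_frequently_eq (z₀ := 1)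
    (g := fun _ => (((Real.pi ^ 2 / (1 + α ^ 2)) ^ (finrank ℝ E / 2 : ℝ) : ℝ) : ℂ))
    analyticOnNhd_const (convex_segment _ _).isPreconnected (left_mem_segment _ _ _) ?_
    (right_mem_segment ℝ _ _)
  have htend : Tendsto (fun t : ℝ => (t : ℂ)) (𝓝[>] 1) (𝓝[≠] 1) := by
    refine tendsto_nhdsWithin_iff.2 ⟨?_, ?_⟩
    · have : Tendsto (fun t : ℝ => (t : ℂ)) (𝓝 1) (𝓝 ((1 : ℝ) : ℂ)) :=
        Complex.continuous_ofReal.tendsto 1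
      simpa using this.mono_left nhdsWithin_le_nhds
    · filter_upwards [self_mem_nhdsWithin] with t ht
      have : t ≠ 1 := ne_of_gt ht
      simpa using this
  refine htend.frequently (Eventually.frequently ?_)
  filter_upwards [self_mem_nhdsWithin] with t ht
  exact integral_contourExponent_ofReal hT hk hα (zero_lt_one.trans ht)

end ContourIntegral

section PiPow

variable {E : Type*} [NormedAddCommGroup E] [InnerProductSpace ℝ E] [FiniteDimensional ℝ E]
  [MeasurableSpace E] [BorelSpace E] {T : E → E} {κ k : ℝ≥0}

/-- If `2⟪x, T x⟫ + 2⟪x', T x'⟫` dominates `ψ (x + x', T x - T x')` with a quadratic margin, then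
the integral of `exp (-ψ)` is at least `π ^ n`. -/
lemma ofReal_pi_pow_le_lintegral_exp_neg (hT : LipschitzWith k (fun x => T x - (κ : ℝ) • x))
    (hk : k < κ) (h0 : T 0 = 0) {ψ : E × E → ℝ} {ε : ℝ} (hε : 0 < ε)
    (hψ : ∀ p : E × E, ψ (pairMap T 1 p) + ε * (‖p.1‖ ^ 2 + ‖p.2‖ ^ 2) ≤
      2 * ⟪p.1, T p.1⟫ + 2 * ⟪p.2, T p.2⟫) :
    ENNReal.ofReal (Real.pi ^ finrank ℝ E) ≤ ∫⁻ p, ENNReal.ofReal (Real.exp (-ψ p)) := by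
  have hL := lipschitzWith_of_sub_smul hT
  set C : ℝ≥0 := k + κ with hC
  have hm : (0 : ℝ) < κ - k := sub_pos.2 hk
  have hTm : ∀ x, (κ - k : ℝ) * ‖x‖ ^ 2 ≤ ⟪x, T x⟫ := fun x => by
    simpa [h0] using inner_sub_ge_of_sub_smul hT x 0
  have hP : ∀ x, ‖x‖ ^ 2 + ‖T x‖ ^ 2 ≤ (1 + C ^ 2) * ‖x‖ ^ 2 := fun x => by
    have h1 : ‖T x‖ ≤ C * ‖x‖ := by simpa [h0] using hL.norm_sub_le x 0
    have h2 : ‖T x‖ ^ 2 ≤ (C * ‖x‖) ^ 2 := by gcongr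
    linarith
  have hα₀ : 0 < min ε (κ - k) / (1 + (C : ℝ) ^ 2) := by
    have := lt_min hε hm
    positivity
  have key : ∀ α : ℝ, 0 < α → α ≤ min ε (κ - k) / (1 + (C : ℝ) ^ 2) →
      ENNReal.ofReal ((Real.pi ^ 2 / (1 + α ^ 2)) ^ (finrank ℝ E / 2 : ℝ)) ≤
        ∫⁻ p, ENNReal.ofReal (Real.exp (-ψ p)) := by
    intro α hα hαle
    rw [le_div_iff₀ (by positivity)] at hαle
    have hαP : ∀ x, α * (‖x‖ ^ 2 + ‖T x‖ ^ 2) ≤ min ε (κ - k) * ‖x‖ ^ 2 := fun x => by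
      refine (mul_le_mul_of_nonneg_left (hP x) hα.le).trans ?_
      rw [← mul_assoc]
      gcongr
    have hTα : ∀ x, α * (‖x‖ ^ 2 + ‖T x‖ ^ 2) ≤ ⟪x, T x⟫ := fun x => by
      refine (hαP x).trans (le_trans ?_ (hTm x))
      gcongr
      exact min_le_right _ _
    have hαε : ∀ x, α * (‖x‖ ^ 2 + ‖T x‖ ^ 2) ≤ ε * ‖x‖ ^ 2 := fun x => by
      refine (hαP x).trans ?_
      gcongr
      exact min_le_left _ _
    have hre : ∀ p : E × E, ψ (pairMap T 1 p) ≤ (contourExponent T α Complex.I p).re := by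
      intro p
      have h1 := abs_inner_sub_inner_le T p one_pos
      have h2 := neg_le_of_abs_le (le_refl |⟪p.1, p.2⟫ - ⟪T p.1, T p.2⟫|)
      rw [re_contourExponent]
      simp only [Complex.I_re, Complex.I_im, Complex.norm_I]
      have h3 := mul_le_mul_of_nonneg_left h1 hα.le
      have h4 := mul_le_mul_of_nonneg_left h2 hα.le
      linarith [hψ p, hαε p.1, hαε p.2]
    have hI := integral_contourExponent_I hT hk h0 hα hTα
    have hnn : 0 ≤ (Real.pi ^ 2 / (1 + α ^ 2)) ^ (finrank ℝ E / 2 : ℝ) := by positivity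
    rw [← (hL.pairMap 1).lintegral_abs_det_mul_comp volume (pairMap_bijective hT hk one_pos)
      (ae_hasFDerivAt_pairMap hL 1), ← Real.norm_of_nonneg hnn, ← Complex.norm_real, ← hI,
      ofReal_norm]
    refine (enorm_integral_le_lintegral_enorm _).trans (lintegral_mono fun p => ?_)
    have hw : ‖pairWeight T p‖ = |(pairDeriv (fderiv ℝ T p.1) (fderiv ℝ T p.2) 1).det| :=
      Real.norm_of_nonneg (abs_nonneg _)
    rw [enorm_mul, mul_comm, ← ofReal_norm, ← ofReal_norm, Complex.norm_real, Complex.norm_exp, hw,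
      Complex.neg_re]
    gcongr
    exact hre p
  have hlim : Tendsto (fun α : ℝ => ENNReal.ofReal
      ((Real.pi ^ 2 / (1 + α ^ 2)) ^ (finrank ℝ E / 2 : ℝ))) (𝓝[>] 0)
      (𝓝 (ENNReal.ofReal (Real.pi ^ finrank ℝ E))) := by
    have hc : Continuous fun α : ℝ => (Real.pi ^ 2 / (1 + α ^ 2)) ^ (finrank ℝ E / 2 : ℝ) := by
      refine (Continuous.div continuous_const (by fun_prop) fun α => ?_).rpow_const fun α => ?_
      · positivity
      · exact Or.inr (by positivity)
    have h1 := hc.tendsto 0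
    have e : (Real.pi ^ 2 / (1 + (0 : ℝ) ^ 2)) ^ (finrank ℝ E / 2 : ℝ) =
        Real.pi ^ finrank ℝ E := by
      rw [zero_pow two_ne_zero, add_zero, div_one, ← Real.rpow_natCast Real.pi 2,
        ← Real.rpow_mul Real.pi_pos.le, ← Real.rpow_natCast]
      congr 1
      push_cast
      ring
    rw [e] at h1
    exact ENNReal.tendsto_ofReal (h1.mono_left nhdsWithin_le_nhds)
  refine le_of_tendsto hlim ?_
  filter_upwards [Ioc_mem_nhdsGT hα₀] with α hα
  exact key α hα.1 hα.2

end PiPow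

section Support

variable {E : Type*} [NormedAddCommGroup E] [InnerProductSpace ℝ E]

/-- The support function `x ↦ sup_{u ∈ C} ⟪x, u⟫` of a set `C`. -/
noncomputable def supportFn (C : Set E) (x : E) : ℝ :=
  sSup ((fun u => ⟪x, u⟫) '' C)

variable {C : Set E} {R r : ℝ}

lemma inner_le_supportFn (hR : ∀ u ∈ C, ‖u‖ ≤ R) (x : E) {u : E} (hu : u ∈ C) :
    ⟪x, u⟫ ≤ supportFn C x := by
  refine le_csSup ⟨‖x‖ * R, ?_⟩ (mem_image_of_mem _ hu)
  rintro _ ⟨v, hv, rfl⟩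
  exact (real_inner_le_norm _ _).trans (by gcongr; exact hR v hv)

lemma supportFn_le (hne : C.Nonempty) {x : E} {M : ℝ} (h : ∀ u ∈ C, ⟪x, u⟫ ≤ M) :
    supportFn C x ≤ M := by
  refine csSup_le (hne.image _) ?_
  rintro _ ⟨v, hv, rfl⟩
  exact h v hv

lemma supportFn_add_le (hne : C.Nonempty) (hR : ∀ u ∈ C, ‖u‖ ≤ R) (x y : E) :
    supportFn C (x + y) ≤ supportFn C x + supportFn C y :=
  supportFn_le hne fun u hu => by
    rw [inner_add_left]
    exact add_le_add (inner_le_supportFn hR x hu) (inner_le_supportFn hR y hu)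

lemma supportFn_smul_le (hne : C.Nonempty) (hR : ∀ u ∈ C, ‖u‖ ≤ R) (hsymm : ∀ u ∈ C, -u ∈ C)
    (c : ℝ) (x : E) : supportFn C (c • x) ≤ |c| * supportFn C x :=
  supportFn_le hne fun u hu => by
    rw [inner_smul_left, conj_trivial]
    rcases abs_cases c with ⟨h, -⟩ | ⟨h, hc⟩
    · rw [h]
      exact mul_le_mul_of_nonneg_left (inner_le_supportFn hR x hu) (h ▸ abs_nonneg c)
    · have := inner_le_supportFn hR x (hsymm u hu)
      rw [inner_neg_right] at this
      rw [h]
      nlinarith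

lemma supportFn_zero (hne : C.Nonempty) : supportFn C 0 = 0 := by
  obtain ⟨u, hu⟩ := hne
  have : (fun u => ⟪(0 : E), u⟫) '' C = {0} := by
    simp only [inner_zero_left]
    exact Nonempty.image_const ⟨u, hu⟩ 0
  rw [supportFn, this, csSup_singleton]

lemma supportFn_neg (hne : C.Nonempty) (hR : ∀ u ∈ C, ‖u‖ ≤ R) (hsymm : ∀ u ∈ C, -u ∈ C)
    (x : E) : supportFn C (-x) = supportFn C x := by
  have h : ∀ y : E, supportFn C (-y) ≤ supportFn C y := fun y => by
    simpa using supportFn_smul_le hne hR hsymm (-1) y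
  exact le_antisymm (h x) (by simpa using h (-x))

lemma mul_norm_le_supportFn (hR : ∀ u ∈ C, ‖u‖ ≤ R) (hr : 0 ≤ r)
    (hrC : Metric.closedBall 0 r ⊆ C) (x : E) : r * ‖x‖ ≤ supportFn C x := by
  have h := inner_le_supportFn hR x (u := (r * ‖x‖⁻¹) • x) (hrC ?_)
  · rw [inner_smul_right, real_inner_self_eq_norm_sq] at h
    rcases eq_or_ne ‖x‖ 0 with h0 | h0
    · simpa [h0] using h
    · convert h using 1
      field_simp
  · rw [mem_closedBall_zero_iff, norm_smul, norm_mul, Real.norm_of_nonneg hr, norm_inv, norm_norm]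
    rcases eq_or_ne ‖x‖ 0 with h0 | h0
    · simpa [h0] using hr
    · rw [inv_mul_cancel_right₀ h0]

lemma continuous_supportFn (hne : C.Nonempty) (hR : ∀ u ∈ C, ‖u‖ ≤ R) :
    Continuous (supportFn C) := by
  obtain ⟨u₀, hu₀⟩ := hne
  have hR0 : 0 ≤ R := (norm_nonneg _).trans (hR u₀ hu₀)
  refine (LipschitzWith.of_le_add_mul R.toNNReal fun x y =>
    supportFn_le ⟨u₀, hu₀⟩ fun u hu => ?_).continuous
  have h1 := inner_le_supportFn hR y hu
  have h2 : ⟪x - y, u⟫ ≤ ‖x - y‖ * R := (real_inner_le_norm _ _).trans (by gcongr; exact hR u hu)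
  rw [inner_sub_left] at h2
  rw [dist_eq_norm, Real.coe_toNNReal _ hR0]
  linarith

/-- A continuous strongly monotone perturbation of the subgradient of the support function. -/
lemma exists_monotone_approx_supportFn [CompleteSpace E] (hC : IsClosed C) (hconv : Convex ℝ C)
    (h0 : (0 : E) ∈ C) (hR : ∀ u ∈ C, ‖u‖ ≤ R) {l ε : ℝ≥0} (hl : 0 < l) :
    ∃ P : E → E, P 0 = 0 ∧ (∀ x, P x ∈ C) ∧
      LipschitzWith (2 * l)⁻¹
        (fun x => P x + (ε : ℝ) • x - (((2 * l)⁻¹ + ε : ℝ≥0) : ℝ) • x) ∧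
      ∀ x, supportFn C x - l * R ^ 2 ≤ ⟪x, P x⟫ := by
  have hR0 : 0 ≤ R := (norm_nonneg _).trans (hR 0 h0)
  have hproj : ∀ y : E, ∃ v ∈ C, ∀ w ∈ C, ⟪y - v, w - v⟫ ≤ 0 := by
    intro y
    obtain ⟨v, hv, h⟩ := exists_norm_eq_iInf_of_complete_convex ⟨0, h0⟩ hC.isComplete hconv y
    exact ⟨v, hv, (norm_eq_iInf_iff_real_inner_le_zero hconv hv).1 h⟩
  choose Q hQ hQ' using hproj
  have hfirm : LipschitzWith 2⁻¹ (fun y => Q y - (2⁻¹ : ℝ) • y) := by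
    refine LipschitzWith.of_dist_le_mul fun y z => ?_
    have h1 := hQ' y (Q z) (hQ z)
    have h2 := hQ' z (Q y) (hQ y)
    have e : Q y - (2⁻¹ : ℝ) • y - (Q z - (2⁻¹ : ℝ) • z) = (Q y - Q z) - (2⁻¹ : ℝ) • (y - z) := by
      module
    rw [dist_eq_norm, dist_eq_norm, e]
    refine abs_le_of_sq_le_sq' ?_ (by positivity) |>.2
    have h3 : ⟪y - Q y, Q z - Q y⟫ + ⟪z - Q z, Q y - Q z⟫ =
        ‖Q y - Q z‖ ^ 2 - ⟪Q y - Q z, y - z⟫ := by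
      rw [← real_inner_self_eq_norm_sq]
      simp only [inner_sub_left, inner_sub_right, real_inner_comm]
      ring
    rw [norm_sub_sq_real, inner_smul_right, norm_smul, mul_pow, mul_pow]
    norm_num
    linarith
  refine ⟨fun x => Q ((l : ℝ)⁻¹ • x), ?_, fun x => hQ _, ?_, fun x => ?_⟩
  · have := hQ' 0 0 h0
    simp only [zero_sub, inner_neg_neg, real_inner_self_eq_norm_sq] at this
    have : ‖Q 0‖ = 0 := pow_eq_zero_iff two_ne_zero |>.1 (le_antisymm this (by positivity))
    simpa using this
  · have h := hfirm.comp (lipschitzWith_smul (β := E) (l : ℝ)⁻¹)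
    have e : (2⁻¹ * ‖(l : ℝ)⁻¹‖₊ : ℝ≥0) = (2 * l)⁻¹ := by
      ext
      simp [mul_comm]
    rw [e] at h
    refine (congrArg (LipschitzWith _) (funext fun x => ?_)).mpr h
    simp only [Function.comp_apply, smul_smul, add_smul, NNReal.coe_add, NNReal.coe_inv,
      NNReal.coe_mul, NNReal.coe_ofNat, mul_inv]
    abel
  · rw [sub_le_iff_le_add]
    refine supportFn_le ⟨0, h0⟩ fun v hv => ?_
    have h1 := hQ' ((l : ℝ)⁻¹ • x) v hv
    set u := Q ((l : ℝ)⁻¹ • x)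
    have h2 : ⟪u, v⟫ ≤ R ^ 2 := by
      refine (real_inner_le_norm _ _).trans ?_
      rw [sq]
      exact mul_le_mul (hR _ (hQ _)) (hR _ hv) (norm_nonneg _) hR0
    rw [inner_sub_left, inner_smul_left, inner_sub_right, inner_sub_right, conj_trivial,
      real_inner_self_eq_norm_sq] at h1
    have hl' : (0 : ℝ) < l := hl
    have h3 := mul_nonpos_of_nonneg_of_nonpos hl'.le h1
    have h4 : (l : ℝ) * ((l : ℝ)⁻¹ * (⟪x, v⟫ - ⟪x, u⟫) - (⟪u, v⟫ - ‖u‖ ^ 2)) =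
      ⟪x, v⟫ - ⟪x, u⟫ - l * ⟪u, v⟫ + l * ‖u‖ ^ 2 := by
      field_simp
      ring
    rw [h4] at h3
    have h5 : 0 ≤ l * ‖u‖ ^ 2 := by positivity
    nlinarith

end Support

section VolumeProduct

variable {E : Type*} [NormedAddCommGroup E] [InnerProductSpace ℝ E] [FiniteDimensional ℝ E]
  [MeasurableSpace E] [BorelSpace E] {C : Set E} {R r : ℝ}

lemma integrable_exp_neg_mul_norm (E : Type*) [NormedAddCommGroup E] [InnerProductSpace ℝ E]
    [FiniteDimensional ℝ E] [MeasurableSpace E] [BorelSpace E] {c : ℝ} (hc : 0 < c) :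
    Integrable (fun x : E => Real.exp (-(c * ‖x‖))) := by
  set k := finrank ℝ E + 1 with hk
  have h := (integrable_one_add_norm (E := E) (μ := volume) (r := k)
    (by rw [hk]; push_cast; linarith)).const_mul (Real.exp c * k.factorial * (c ^ k)⁻¹)
  refine h.mono' (by fun_prop) (ae_of_all _ fun x => ?_)
  have hx := norm_nonneg x
  have h1 := Real.pow_div_factorial_le_exp (c * (1 + ‖x‖)) (by positivity) k
  rw [Real.norm_of_nonneg (Real.exp_pos _).le, Real.rpow_neg (by positivity), Real.rpow_natCast]
  have e : Real.exp (-(c * ‖x‖)) = Real.exp c * (Real.exp (c * (1 + ‖x‖)))⁻¹ := by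
    rw [← Real.exp_neg, ← Real.exp_add]
    congr 1
    ring
  have h2 : (Real.exp (c * (1 + ‖x‖)))⁻¹ ≤ ((c * (1 + ‖x‖)) ^ k / k.factorial)⁻¹ :=
    inv_anti₀ (by positivity) h1
  calc _ ≤ Real.exp c * ((c * (1 + ‖x‖)) ^ k / k.factorial)⁻¹ := by rw [e]; gcongr
    _ = _ := by
      rw [inv_div, mul_pow]
      field_simp

lemma lintegral_exp_neg_mul_supportFn (hne : C.Nonempty) (hR : ∀ u ∈ C, ‖u‖ ≤ R)
    (hsymm : ∀ u ∈ C, -u ∈ C) (hr : 0 < r) (hrC : Metric.closedBall 0 r ⊆ C) {τ : ℝ}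
    (hτ : 0 < τ) :
    ∫⁻ x, ENNReal.ofReal (Real.exp (-(τ * supportFn C x))) =
      ENNReal.ofReal ((finrank ℝ E).factorial * (τ ^ finrank ℝ E)⁻¹) *
        volume {x | supportFn C x < 1} := by
  have hcont := continuous_supportFn hne hR
  have hN : ∀ x, r * ‖x‖ ≤ supportFn C x := mul_norm_le_supportFn hR hr.le hrC
  have hint : Integrable fun x => Real.exp (-(τ * supportFn C x)) := by
    refine (integrable_exp_neg_mul_norm E (mul_pos hτ hr)).mono'
      (Continuous.aestronglyMeasurable (by fun_prop)) (ae_of_all _ fun x => ?_)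
    rw [Real.norm_of_nonneg (Real.exp_pos _).le, mul_assoc]
    gcongr
    exact hN x
  have h := measure_lt_one_eq_integral_div_gamma (volume : Measure E)
    (g := fun x => τ * supportFn C x) (by rw [supportFn_zero hne, mul_zero])
    (fun x => by rw [supportFn_neg hne hR hsymm])
    (fun x y => by rw [← mul_add]; gcongr; exact supportFn_add_le hne hR x y)
    (fun {x} hx => by
      have h1 : supportFn C x = 0 := (mul_eq_zero.1 hx).resolve_left hτ.ne'
      have h2 := hN x
      rw [h1] at h2
      exact norm_le_zero_iff.1 (nonpos_of_mul_nonpos_right h2 hr))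
    (fun c x => by
      have := supportFn_smul_le hne hR hsymm c x
      rw [mul_left_comm]
      gcongr) one_pos
  simp only [Real.rpow_one, div_one, Real.Gamma_nat_eq_factorial] at h
  have hpre : {x | τ * supportFn C x < 1} = (τ • ·) ⁻¹' {x | supportFn C x < 1} := by
    ext x
    have h1 := supportFn_smul_le hne hR hsymm τ x
    have h2 := supportFn_smul_le hne hR hsymm τ⁻¹ (τ • x)
    rw [smul_smul, inv_mul_cancel₀ hτ.ne', one_smul, abs_of_pos (inv_pos.2 hτ),
      le_inv_mul_iff₀ hτ] at h2
    rw [abs_of_pos hτ] at h1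
    simp only [mem_ofPred_eq, mem_preimage, le_antisymm h1 h2]
  rw [hpre, Measure.addHaar_preimage_smul _ hτ.ne', abs_of_pos (by positivity)] at h
  have hfac : (0 : ℝ) < (finrank ℝ E).factorial := by positivity
  rw [ENNReal.ofReal_mul hfac.le, mul_assoc, h, ← ENNReal.ofReal_mul hfac.le,
    mul_div_cancel₀ _ hfac.ne', ofReal_integral_eq_lintegral_ofReal hint
      (ae_of_all _ fun x => (Real.exp_pos _).le)]

lemma tendsto_lintegral_exp_neg_mul_infDist {D : Set E} (hD : IsClosed D) (hne : D.Nonempty)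
    (hR : ∀ u ∈ D, ‖u‖ ≤ R) :
    Tendsto (fun t : ℝ => ∫⁻ b, ENNReal.ofReal (Real.exp (-(t * Metric.infDist b D)))) atTop
      (𝓝 (volume D)) := by
  rw [← lintegral_indicator_one hD.measurableSet]
  refine tendsto_lintegral_filter_of_dominated_convergence
    (fun b => ENNReal.ofReal (Real.exp R * Real.exp (-(1 * ‖b‖)))) ?_ ?_ ?_ ?_
  · exact Eventually.of_forall fun t => by fun_prop
  · filter_upwards [eventually_ge_atTop 1] with t ht
    refine ae_of_all _ fun b => ENNReal.ofReal_le_ofReal ?_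
    rw [← Real.exp_add]
    have h1 : ‖b‖ - R ≤ Metric.infDist b D := by
      refine (Metric.le_infDist hne).2 fun u hu => ?_
      have h2 := norm_sub_norm_le b u
      rw [dist_eq_norm]
      linarith [hR u hu]
    have h2 : Metric.infDist b D ≤ t * Metric.infDist b D :=
      le_mul_of_one_le_left Metric.infDist_nonneg ht
    gcongr
    linarith
  · exact ((integrable_exp_neg_mul_norm E one_pos).const_mul _).lintegral_lt_top.ne
  · refine ae_of_all _ fun b => ?_
    by_cases hb : b ∈ D
    · simp [hb, (hD.mem_iff_infDist_zero hne).1 hb]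
    · have hpos := (hD.notMem_iff_infDist_pos hne).1 hb
      rw [indicator_of_notMem hb, ← ENNReal.ofReal_zero]
      refine ENNReal.tendsto_ofReal (Real.tendsto_exp_neg_atTop_nhds_zero.comp ?_)
      exact tendsto_id.atTop_mul_const hpos

lemma ofReal_pi_pow_le_mul_lintegral (hC : IsClosed C) (hconv : Convex ℝ C)
    (hR : ∀ u ∈ C, ‖u‖ ≤ R) (hsymm : ∀ u ∈ C, -u ∈ C) (hr : 0 < r)
    (hrC : Metric.closedBall 0 r ⊆ C) {l : ℝ≥0} (hl : 0 < l) {η t : ℝ} (hη : 0 < η) (hη1 : η < 1)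
    (ht : 0 < t) :
    ENNReal.ofReal (Real.pi ^ finrank ℝ E) ≤
      ENNReal.ofReal (Real.exp (4 * (l * R ^ 2))) *
        ((∫⁻ x, ENNReal.ofReal (Real.exp (-(2 * (1 - η) * supportFn C x)))) *
          ∫⁻ b, ENNReal.ofReal (Real.exp (-(t * Metric.infDist b ((2 : ℝ) • C))))) := by
  have h0 : (0 : E) ∈ C := hrC (by simpa using hr.le)
  have hne : C.Nonempty := ⟨0, h0⟩
  obtain ⟨ε, hε⟩ : ∃ ε : ℝ≥0, (ε : ℝ) = 2 * η * r / t :=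
    ⟨Real.toNNReal _, Real.coe_toNNReal _ (by positivity)⟩
  have hε0 : (0 : ℝ) < ε := by rw [hε]; positivity
  obtain ⟨P, hP0, hPC, hPL, hP⟩ := exists_monotone_approx_supportFn hC hconv h0 hR (ε := ε) hl
  have hN : ∀ x, r * ‖x‖ ≤ supportFn C x := mul_norm_le_supportFn hR hr.le hrC
  have hcont := continuous_supportFn hne hR
  refine (ofReal_pi_pow_le_lintegral_exp_neg (T := fun x => P x + (ε : ℝ) • x) hPL
    (lt_add_of_pos_right _ hε0) (by simp [hP0]) (ε := 2 * ε)
    (ψ := fun p => 2 * (1 - η) * supportFn C p.1 + t * Metric.infDist p.2 ((2 : ℝ) • C) -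
      4 * (l * R ^ 2)) (by positivity) ?_).trans (le_of_eq ?_)
  · rintro ⟨x, x'⟩
    simp only [pairMap, one_smul, inner_add_right, inner_smul_right, real_inner_self_eq_norm_sq]
    have h1 := supportFn_add_le hne hR x x'
    have h2 : Metric.infDist (P x + (ε : ℝ) • x - (P x' + (ε : ℝ) • x')) ((2 : ℝ) • C) ≤
        ε * (‖x‖ + ‖x'‖) := by
      have hmem : P x - P x' ∈ (2 : ℝ) • C := by
        refine ⟨(2⁻¹ : ℝ) • P x + (2⁻¹ : ℝ) • (-P x'), hconv (hPC x) (hsymm _ (hPC x'))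
          (by norm_num) (by norm_num) (by norm_num), ?_⟩
        change (2 : ℝ) • ((2⁻¹ : ℝ) • P x + (2⁻¹ : ℝ) • (-P x')) = _
        module
      refine (Metric.infDist_le_dist_of_mem hmem).trans ?_
      have e : P x + (ε : ℝ) • x - (P x' + (ε : ℝ) • x') - (P x - P x') = (ε : ℝ) • (x - x') := by
        module
      rw [dist_eq_norm, e, norm_smul, Real.norm_of_nonneg hε0.le]
      gcongr
      exact norm_sub_le _ _
    have h3 : t * Metric.infDist (P x + (ε : ℝ) • x - (P x' + (ε : ℝ) • x')) ((2 : ℝ) • C) ≤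
        2 * η * (supportFn C x + supportFn C x') := by
      calc _ ≤ t * (ε * (‖x‖ + ‖x'‖)) := by gcongr
        _ = 2 * η * (r * ‖x‖ + r * ‖x'‖) := by rw [hε]; field_simp
        _ ≤ _ := by gcongr <;> exact hN _
    have h4 : 2 * (1 - η) * supportFn C (x + x') ≤
        2 * (1 - η) * (supportFn C x + supportFn C x') := by
      have : 0 ≤ 1 - η := by linarith
      gcongr
    linarith [hP x, hP x']
  · have hA : AEMeasurable (fun x => ENNReal.ofReal (Real.exp (-(2 * (1 - η) * supportFn C x)))) :=
      Measurable.aemeasurable (by fun_prop)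
    have hB : AEMeasurable fun b : E =>
        ENNReal.ofReal (Real.exp (-(t * Metric.infDist b ((2 : ℝ) • C)))) :=
      Measurable.aemeasurable (by fun_prop)
    rw [← lintegral_prod_mul hA hB, ← lintegral_const_mul' _ _ ENNReal.ofReal_ne_top,
      ← Measure.volume_eq_prod]
    refine lintegral_congr fun p => ?_
    rw [← ENNReal.ofReal_mul (Real.exp_pos _).le, ← ENNReal.ofReal_mul (Real.exp_pos _).le,
      ← Real.exp_add, ← Real.exp_add]
    congr 2
    ring

/-- A lower bound for the product of the volumes of a symmetric convex body and its polar. -/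
theorem ofReal_pi_pow_le_factorial_mul_volume_mul_volume (hC : IsClosed C) (hconv : Convex ℝ C)
    (hR : ∀ u ∈ C, ‖u‖ ≤ R) (hsymm : ∀ u ∈ C, -u ∈ C) (hr : 0 < r)
    (hrC : Metric.closedBall 0 r ⊆ C) :
    ENNReal.ofReal (Real.pi ^ finrank ℝ E) ≤
      (finrank ℝ E).factorial * volume {x | supportFn C x < 1} * volume C := by
  have h0 : (0 : E) ∈ C := hrC (by simpa using hr.le)
  have hne : C.Nonempty := ⟨0, h0⟩
  have hCpos : volume C ≠ 0 :=
    ((Metric.measure_closedBall_pos volume 0 hr).trans_le (measure_mono hrC)).ne'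
  have h2C : volume ((2 : ℝ) • C) = ENNReal.ofReal (2 ^ finrank ℝ E) * volume C := by
    rw [Measure.addHaar_smul, abs_of_pos (by positivity)]
  have h2Cpos : volume ((2 : ℝ) • C) ≠ 0 := by
    rw [h2C]
    exact mul_ne_zero (by simp) hCpos
  have step1 : ∀ η t : ℝ, 0 < η → η < 1 → 0 < t → ENNReal.ofReal (Real.pi ^ finrank ℝ E) ≤
      (∫⁻ x, ENNReal.ofReal (Real.exp (-(2 * (1 - η) * supportFn C x)))) *
        ∫⁻ b, ENNReal.ofReal (Real.exp (-(t * Metric.infDist b ((2 : ℝ) • C)))) := by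
    intro η t hη hη1 ht
    have hlim : Tendsto (fun l : ℝ≥0 => ENNReal.ofReal (Real.exp (4 * (l * R ^ 2)))) (𝓝[>] 0)
        (𝓝 1) := by
      have hc : Continuous fun l : ℝ≥0 => ENNReal.ofReal (Real.exp (4 * (l * R ^ 2))) := by
        exact ENNReal.continuous_ofReal.comp (by fun_prop)
      simpa using (hc.tendsto 0).mono_left nhdsWithin_le_nhds
    have h := ENNReal.Tendsto.mul_const (b :=
      (∫⁻ x, ENNReal.ofReal (Real.exp (-(2 * (1 - η) * supportFn C x)))) *
        ∫⁻ b, ENNReal.ofReal (Real.exp (-(t * Metric.infDist b ((2 : ℝ) • C)))))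
      hlim (Or.inl one_ne_zero)
    rw [one_mul] at h
    refine ge_of_tendsto h ?_
    filter_upwards [self_mem_nhdsWithin] with l hl
    exact ofReal_pi_pow_le_mul_lintegral hC hconv hR hsymm hr hrC hl hη hη1 ht
  have step2 : ∀ η : ℝ, 0 < η → η < 1 → ENNReal.ofReal (Real.pi ^ finrank ℝ E) ≤
      (∫⁻ x, ENNReal.ofReal (Real.exp (-(2 * (1 - η) * supportFn C x)))) *
        volume ((2 : ℝ) • C) := by
    intro η hη hη1
    have hb : ∀ u ∈ (2 : ℝ) • C, ‖u‖ ≤ 2 * R := by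
      rintro _ ⟨u, hu, rfl⟩
      change ‖(2 : ℝ) • u‖ ≤ _
      rw [norm_smul, Real.norm_ofNat]
      gcongr
      exact hR u hu
    refine ge_of_tendsto (ENNReal.Tendsto.const_mul (tendsto_lintegral_exp_neg_mul_infDist
      (hC.smul₀ (2 : ℝ)) hne.smul_set hb) (Or.inl h2Cpos)) ?_
    filter_upwards [eventually_gt_atTop 0] with t ht
    exact step1 η t hη hη1 ht
  have hlim : Tendsto (fun η : ℝ => ENNReal.ofReal ((finrank ℝ E).factorial *
      ((2 * (1 - η)) ^ finrank ℝ E)⁻¹)) (𝓝[>] 0)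
      (𝓝 (ENNReal.ofReal ((finrank ℝ E).factorial * (2 ^ finrank ℝ E)⁻¹))) := by
    refine ENNReal.tendsto_ofReal (Tendsto.const_mul _ (Tendsto.inv₀ ?_ (by positivity)))
    have hc : Continuous fun η : ℝ => (2 * (1 - η)) ^ finrank ℝ E := by fun_prop
    simpa using (hc.tendsto 0).mono_left nhdsWithin_le_nhds
  have h := ENNReal.Tendsto.mul_const (b := volume {x | supportFn C x < 1} *
    volume ((2 : ℝ) • C)) hlim (Or.inl (by
      rw [Ne, ENNReal.ofReal_eq_zero, not_le]
      positivity))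
  refine (ge_of_tendsto h ?_).trans (le_of_eq ?_)
  · filter_upwards [Ioo_mem_nhdsGT one_pos] with η hη
    have h1 := step2 η hη.1 hη.2
    rwa [lintegral_exp_neg_mul_supportFn hne hR hsymm hr hrC
      (by linarith [hη.2] : 0 < 2 * (1 - η)), mul_assoc] at h1
  · rw [h2C, ENNReal.ofReal_mul (by positivity), ENNReal.ofReal_inv_of_pos (by positivity),
      ENNReal.ofReal_natCast]
    have hz : ENNReal.ofReal (2 ^ finrank ℝ E) ≠ 0 := by simp
    calc _ = (finrank ℝ E).factorial * volume {x | supportFn C x < 1} * volume C *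
          ((ENNReal.ofReal (2 ^ finrank ℝ E))⁻¹ * ENNReal.ofReal (2 ^ finrank ℝ E)) := by ring
      _ = _ := by rw [ENNReal.inv_mul_cancel hz ENNReal.ofReal_ne_top, mul_one]

end VolumeProduct

section DifferenceBody

variable {E : Type*} [NormedAddCommGroup E] [InnerProductSpace ℝ E] {K : Set E}

lemma half_sub_mem_half_smul_sub {x y : E} (hx : x ∈ K) (hy : y ∈ K) :
    (2⁻¹ : ℝ) • (x - y) ∈ (2⁻¹ : ℝ) • (K - K) :=
  smul_mem_smul_set (sub_mem_sub hx hy)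

lemma neg_mem_half_smul_sub {u : E} (hu : u ∈ (2⁻¹ : ℝ) • (K - K)) :
    -u ∈ (2⁻¹ : ℝ) • (K - K) := by
  obtain ⟨_, ⟨x, hx, y, hy, rfl⟩, rfl⟩ := hu
  refine ⟨y - x, sub_mem_sub hy hx, ?_⟩
  change (2⁻¹ : ℝ) • (y - x) = -((2⁻¹ : ℝ) • (x - y))
  module

lemma closedBall_subset_half_smul_sub {x₀ : E} {r : ℝ} (h : Metric.closedBall x₀ r ⊆ K) :
    Metric.closedBall 0 r ⊆ (2⁻¹ : ℝ) • (K - K) := by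
  intro v hv
  rw [mem_closedBall_zero_iff] at hv
  have h1 : x₀ + v ∈ K := h (by simpa using hv)
  have h2 : x₀ - v ∈ K := h (by simpa [dist_eq_norm] using hv)
  have e : v = (2⁻¹ : ℝ) • ((x₀ + v) - (x₀ - v)) := by module
  rw [e]
  exact half_sub_mem_half_smul_sub h1 h2

variable [FiniteDimensional ℝ E] [MeasurableSpace E] [BorelSpace E]

/-- A weak form of the Rogers–Shephard inequality. -/
lemma volume_half_smul_sub_le (hK : IsCompact K) (hconv : Convex ℝ K) (h0 : volume K ≠ 0) :
    volume ((2⁻¹ : ℝ) • (K - K)) ≤ 2 ^ finrank ℝ E * volume K := by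
  have hKm := hK.measurableSet
  have hconst : ENNReal.ofReal |(2⁻¹ : ℝ) ^ finrank ℝ E| = (2 ^ finrank ℝ E)⁻¹ := by
    rw [abs_of_pos (by positivity), inv_pow, ENNReal.ofReal_inv_of_pos (by positivity),
      ENNReal.ofReal_pow zero_le_two, ENNReal.ofReal_ofNat]
  have hind : Measurable (K.indicator (1 : E → ℝ≥0∞)) := measurable_one.indicator hKm
  have hsq : ∫⁻ z, ∫⁻ x, K.indicator (1 : E → ℝ≥0∞) x * K.indicator (1 : E → ℝ≥0∞) (x - z) =
      volume K * volume K := by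
    rw [lintegral_lintegral_swap (Measurable.aemeasurable (by fun_prop))]
    calc _ = ∫⁻ x, K.indicator (1 : E → ℝ≥0∞) x * volume K := by
          refine lintegral_congr fun x => ?_
          rw [lintegral_const_mul _ (by fun_prop), lintegral_sub_left_eq_self,
            lintegral_indicator_one hKm]
      _ = _ := by rw [lintegral_mul_const _ hind, lintegral_indicator_one hKm]
  have hlow : ∀ z ∈ (2⁻¹ : ℝ) • (K - K), (2 ^ finrank ℝ E)⁻¹ * volume K ≤
      ∫⁻ x, K.indicator (1 : E → ℝ≥0∞) x * K.indicator (1 : E → ℝ≥0∞) (x - z) := by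
    rintro _ ⟨_, ⟨a, ha, b, hb, rfl⟩, rfl⟩
    rw [← hconst, ← Measure.addHaar_image_homothety volume a]
    have hm : MeasurableSet (AffineMap.homothety a (2⁻¹ : ℝ) '' K) :=
      (hK.image (AffineMap.homothety_continuous a (2⁻¹ : ℝ))).measurableSet
    rw [← lintegral_indicator_one hm]
    refine lintegral_mono fun x => ?_
    by_cases hx : x ∈ AffineMap.homothety a (2⁻¹ : ℝ) '' K
    swap
    · simp [indicator_of_notMem hx]
    rw [indicator_of_mem hx]
    obtain ⟨c, hc, rfl⟩ := hx
    have mid : ∀ {p q : E}, p ∈ K → q ∈ K → (2⁻¹ : ℝ) • p + (2⁻¹ : ℝ) • q ∈ K := fun hp hq =>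
      hconv hp hq (by norm_num) (by norm_num) (by norm_num)
    have e1 : AffineMap.homothety a (2⁻¹ : ℝ) c = (2⁻¹ : ℝ) • a + (2⁻¹ : ℝ) • c := by
      rw [AffineMap.homothety_apply, vsub_eq_sub, vadd_eq_add]
      module
    have e2 : AffineMap.homothety a (2⁻¹ : ℝ) c - (2⁻¹ : ℝ) • (a - b) =
        (2⁻¹ : ℝ) • b + (2⁻¹ : ℝ) • c := by
      rw [e1]
      module
    have m1 : AffineMap.homothety a (2⁻¹ : ℝ) c ∈ K := e1 ▸ mid ha hc
    have m2 : AffineMap.homothety a (2⁻¹ : ℝ) c - (2⁻¹ : ℝ) • (a - b) ∈ K := e2 ▸ mid hb hc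
    simp only [indicator_of_mem m1]
    change _ ≤ 1 * K.indicator 1 (AffineMap.homothety a (2⁻¹ : ℝ) c - (2⁻¹ : ℝ) • (a - b))
    rw [indicator_of_mem m2]
    simp
  have h1 : (2 ^ finrank ℝ E)⁻¹ * volume K * volume ((2⁻¹ : ℝ) • (K - K)) ≤
      volume K * volume K := by
    rw [← hsq, ← setLIntegral_const]
    refine (setLIntegral_mono' ?_ hlow).trans (setLIntegral_le_lintegral _ _)
    rw [sub_eq_add_neg]
    exact ((hK.add hK.neg).smul _).measurableSet
  have h2 : (2 ^ finrank ℝ E)⁻¹ * volume ((2⁻¹ : ℝ) • (K - K)) ≤ volume K := by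
    rw [mul_right_comm] at h1
    exact (ENNReal.mul_le_mul_iff_left h0 hK.measure_ne_top).1 h1
  rwa [mul_comm, ← div_eq_mul_inv, ENNReal.div_le_iff (by positivity) (by finiteness),
    mul_comm] at h2

lemma ofReal_pi_div_four_pow_div_factorial_le_volume (hK : IsCompact K) (hconv : Convex ℝ K)
    (hint : (interior K).Nonempty)
    (hD : volume {x | supportFn ((2⁻¹ : ℝ) • (K - K)) x < 1} ≤ 2 ^ finrank ℝ E) :
    ENNReal.ofReal ((Real.pi / 4) ^ finrank ℝ E / (finrank ℝ E).factorial) ≤ volume K := by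
  obtain ⟨x₀, hx₀⟩ := hint
  obtain ⟨r, hr, hrK⟩ := Metric.nhds_basis_closedBall.mem_iff.1 (mem_interior_iff_mem_nhds.1 hx₀)
  have hcomp : IsCompact ((2⁻¹ : ℝ) • (K - K)) := by
    rw [sub_eq_add_neg]
    exact (hK.add hK.neg).smul _
  obtain ⟨R, hR⟩ := hcomp.isBounded.exists_norm_le
  have h0 : volume K ≠ 0 :=
    ((Metric.measure_closedBall_pos volume x₀ hr).trans_le (measure_mono hrK)).ne'
  have h1 := ofReal_pi_pow_le_factorial_mul_volume_mul_volume hcomp.isClosed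
    ((hconv.sub hconv).smul _) hR (fun u hu => neg_mem_half_smul_sub hu) hr
    (closedBall_subset_half_smul_sub hrK)
  have h2 : ENNReal.ofReal (Real.pi ^ finrank ℝ E) ≤
      (finrank ℝ E).factorial * 2 ^ finrank ℝ E * (2 ^ finrank ℝ E * volume K) := by
    refine h1.trans ?_
    gcongr
    exact volume_half_smul_sub_le hK hconv h0
  have h3 : Real.pi ^ finrank ℝ E ≤
      (finrank ℝ E).factorial * 2 ^ finrank ℝ E * (2 ^ finrank ℝ E * (volume K).toReal) := by
    have hfin : (finrank ℝ E).factorial * 2 ^ finrank ℝ E * (2 ^ finrank ℝ E * volume K) ≠ ∞ := by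
      have := hK.measure_ne_top (μ := volume)
      finiteness
    have := (ENNReal.ofReal_le_iff_le_toReal hfin).1 h2
    simpa using this
  refine ENNReal.ofReal_le_of_le_toReal ?_
  rw [div_le_iff₀ (by positivity), div_pow, div_le_iff₀ (by positivity)]
  have e : (4 : ℝ) ^ finrank ℝ E = 2 ^ finrank ℝ E * 2 ^ finrank ℝ E := by
    rw [← mul_pow]
    norm_num
  rw [e]
  linarith

end DifferenceBody

section Lattice

lemma volume_le_two_pow_of_forall_int_notMem {n : ℕ} {s : Set (Fin n → ℝ)}
    (hsymm : ∀ x ∈ s, -x ∈ s) (hconv : Convex ℝ s)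
    (h : ∀ m : Fin n → ℤ, m ≠ 0 → (fun i => (m i : ℝ)) ∉ s) : volume s ≤ 2 ^ n := by
  by_contra! hlt
  set b := Pi.basisFun ℝ (Fin n)
  have hvol : volume (ZSpan.fundamentalDomain b) = 1 := by
    have e : Matrix.of b = 1 := by
      ext i j
      simp [b, Matrix.one_apply, Pi.single_apply, eq_comm]
    rw [ZSpan.volume_fundamentalDomain, e]
    simp
  have : Countable (Submodule.span ℤ (range b)).toAddSubgroup :=
    inferInstanceAs (Countable (Submodule.span ℤ (range b)))
  obtain ⟨⟨x, hx⟩, hx0, hxs⟩ := exists_ne_zero_mem_lattice_of_measure_mul_two_pow_lt_measure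
    (L := (Submodule.span ℤ (range b)).toAddSubgroup)
    (ZSpan.isAddFundamentalDomain b volume) hsymm hconv (by simpa [hvol] using hlt)
  have hx' := (b.mem_span_iff_repr_mem ℤ x).1 hx
  choose m hm using hx'
  have e : (fun i => (m i : ℝ)) = x := by
    ext i
    simpa [b] using hm i
  refine h m (fun h0 => hx0 ?_) (e ▸ hxs)
  ext i
  simp [← e, h0]

end Lattice

/-- A convex body in `ℝⁿ` that intersects every integer hyperplane
`m₁x₁ + ⋯ + mₙxₙ = 1` has volume at least `(π/8)ⁿ (n+1)/n!`. -/
theorem stmt_1 (n : ℕ) (K : Set (Fin n → ℝ))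
    (hK_compact : IsCompact K) (hK_convex : Convex ℝ K)
    (hK_int : (interior K).Nonempty)
    (hK_unavoidable : ∀ m : Fin n → ℤ, m ≠ 0 →
      ∃ x ∈ K, ∑ i, (m i : ℝ) * x i = 1) :
    ENNReal.ofReal ((Real.pi / 8) ^ n * (n + 1) / n.factorial) ≤ volume K := by
  let e := EuclideanSpace.equiv (Fin n) ℝ
  set K' : Set (EuclideanSpace ℝ (Fin n)) := e.symm '' K with hK'
  have hcomp : IsCompact K' := hK_compact.image e.symm.continuous
  have hconv : Convex ℝ K' := hK_convex.linear_image e.symm.toLinearEquiv.toLinearMap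
  have hint : (interior K').Nonempty := by
    have := e.symm.toHomeomorph.image_interior K
    exact (this ▸ hK_int.image e.symm.toHomeomorph : (interior (e.symm.toHomeomorph '' K)).Nonempty)
  have hvol : volume K' = volume K := by
    have h : K' = WithLp.ofLp ⁻¹' K := e.symm.image_eq_preimage_symm K
    rw [h]
    exact (PiLp.volume_preserving_ofLp (Fin n)).measure_preimage
      hK_compact.measurableSet.nullMeasurableSet
  set C := (2⁻¹ : ℝ) • (K' - K') with hC
  have hCcomp : IsCompact C := by
    rw [hC, sub_eq_add_neg]
    exact (hcomp.add hcomp.neg).smul _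
  obtain ⟨R, hR⟩ := hCcomp.isBounded.exists_norm_le
  have hne : C.Nonempty := by
    have : K'.Nonempty := hint.mono interior_subset
    exact (this.sub this).smul_set
  have hsymm : ∀ u ∈ C, -u ∈ C := fun u hu => neg_mem_half_smul_sub hu
  have hDconv : Convex ℝ {x | supportFn C x < 1} := by
    intro x hx y hy a b ha hb hab
    have h1 := supportFn_add_le hne hR (a • x) (b • y)
    have h2 := supportFn_smul_le hne hR hsymm a x
    have h3 := supportFn_smul_le hne hR hsymm b y
    rw [abs_of_nonneg ha] at h2
    rw [abs_of_nonneg hb] at h3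
    have h4 : a * supportFn C x + b * supportFn C y < 1 :=
      convex_Iio (1 : ℝ) hx hy ha hb hab
    exact h1.trans_lt ((add_le_add h2 h3).trans_lt h4)
  have hD : volume {x | supportFn C x < 1} ≤ 2 ^ n := by
    have hm : MeasurableSet {x | supportFn C x < 1} :=
      (isOpen_lt (continuous_supportFn hne hR) continuous_const).measurableSet
    rw [← (PiLp.volume_preserving_toLp (Fin n)).measure_preimage hm.nullMeasurableSet]
    refine volume_le_two_pow_of_forall_int_notMem (fun x hx => ?_)
      (hDconv.linear_preimage e.symm.toLinearEquiv.toLinearMap) fun m hm0 hmem => ?_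
    · have := supportFn_neg hne hR hsymm (WithLp.toLp 2 x)
      exact this.trans_lt hx
    · obtain ⟨x, hx, hx1⟩ := hK_unavoidable m hm0
      obtain ⟨y, hy, hy1⟩ := hK_unavoidable (-m) (neg_ne_zero.2 hm0)
      have hu := half_sub_mem_half_smul_sub (mem_image_of_mem e.symm hx)
        (mem_image_of_mem e.symm hy)
      have h1 := inner_le_supportFn hR (WithLp.toLp 2 fun i => (m i : ℝ)) hu
      have hin : ∀ z, ⟪WithLp.toLp 2 fun i => (m i : ℝ), e.symm z⟫ = ∑ i, (m i : ℝ) * z i := by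
        intro z
        simp [e, PiLp.inner_apply, mul_comm]
      rw [inner_smul_right, inner_sub_right, hin, hin, hx1] at h1
      have h2 : ∑ i, (m i : ℝ) * y i = -1 := by
        rw [← hy1]
        simp
      rw [h2] at h1
      norm_num at h1
      exact absurd hmem (not_lt.2 h1)
  have hfr : finrank ℝ (EuclideanSpace ℝ (Fin n)) = n := finrank_euclideanSpace_fin
  have hmain := ofReal_pi_div_four_pow_div_factorial_le_volume hcomp hconv hint (by rwa [hfr])
  rw [hfr, hvol] at hmain
  refine le_trans (ENNReal.ofReal_le_ofReal ?_) hmain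
  have h1 : (n + 1 : ℝ) ≤ 2 ^ n := by exact_mod_cast Nat.lt_two_pow_self
  have h2 : (Real.pi / 4) ^ n = (Real.pi / 8) ^ n * 2 ^ n := by
    rw [← mul_pow]
    congr 1
    ring
  rw [h2]
  gcongr
end

section
/- Among all unavoidable convex bodies in ℝⁿ there exists one of minimal volume: there is an unavoidable convex body K₀ ⊂ ℝⁿ such that |K₀| ≤ |K| for every unavoidable convex body K ⊂ ℝⁿ. -/
open MeasureTheory
open scoped Matrix

namespace Matrix

/-- The Gram matrix `Uᵀ S U` of the quadratic form `S` in the integral coordinates `U`. -/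
noncomputable def intCongr {ι : Type*} [Fintype ι] (S : Matrix ι ι ℝ) (U : Matrix ι ι ℤ) :
    Matrix ι ι ℝ :=
  (U.map (Int.cast : ℤ → ℝ))ᵀ * S * U.map (Int.cast : ℤ → ℝ)

variable {ι κ : Type*} [Fintype ι] [Fintype κ]

lemma intCongr_mul (S : Matrix ι ι ℝ) (U W : Matrix ι ι ℤ) :
    S.intCongr (U * W) = (S.intCongr U).intCongr W := by
  have h : (U * W).map (Int.cast : ℤ → ℝ) = U.map Int.cast * W.map Int.cast :=
    Matrix.map_mul (f := Int.castRingHom ℝ)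
  simp only [intCongr, h, transpose_mul, Matrix.mul_assoc]

lemma IsSymm.intCongr {S : Matrix ι ι ℝ} (hS : S.IsSymm) (U : Matrix ι ι ℤ) :
    (S.intCongr U).IsSymm := by
  simp [IsSymm, Matrix.intCongr, hS.eq, Matrix.mul_assoc]

lemma intCongr_submatrix (S : Matrix ι ι ℝ) (e : κ ≃ ι) (W : Matrix κ κ ℤ) :
    (S.submatrix e e).intCongr W =
      (S.intCongr (W.submatrix e.symm e.symm)).submatrix e e := by
  have h : (W.map (Int.cast : ℤ → ℝ)) =
      ((W.submatrix e.symm e.symm).map (Int.cast : ℤ → ℝ)).submatrix e e := by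
    ext i j; simp
  rw [intCongr, h, transpose_submatrix, submatrix_mul_equiv, submatrix_mul_equiv, intCongr]

variable [DecidableEq ι] [DecidableEq κ]

lemma det_intCongr (S : Matrix ι ι ℝ) {U : Matrix ι ι ℤ} (hU : IsUnit U.det) :
    (S.intCongr U).det = S.det := by
  have h : (U.map (Int.cast : ℤ → ℝ)).det = (U.det : ℝ) :=
    ((Int.castRingHom ℝ).map_det U).symm
  rw [intCongr, det_mul, det_mul, det_transpose, h]
  rcases Int.isUnit_iff.1 hU with h | h <;> simp [h]

/-- Completing the square with respect to the first variable. -/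
lemma exists_complete_square {S : Matrix (Unit ⊕ ι) (Unit ⊕ ι) ℝ} (hS : S.IsSymm) {a : ℝ}
    (ha : S (.inl ()) (.inl ()) = a) (ha0 : a ≠ 0) :
    ∃ (β : ι → ℝ) (T : Matrix ι ι ℝ), T.IsSymm ∧ S.det = a * T.det ∧
      ∀ (r : ι → ℤ) (U : Matrix ι ι ℤ),
        S.intCongr (fromBlocks 1 (of fun _ => r) 0 U) (.inl ()) (.inl ()) = a ∧
        ∀ i, S.intCongr (fromBlocks 1 (of fun _ => r) 0 U) (.inr i) (.inr i) =
          a * (r i + ∑ j, β j * U j i) ^ 2 + T.intCongr U i i := by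
  let β : ι → ℝ := fun j => S (.inl ()) (.inr j) / a
  let T : Matrix ι ι ℝ := of fun j k => S (.inr j) (.inr k) - a * β j * β k
  let L : Matrix (Unit ⊕ ι) (Unit ⊕ ι) ℝ := fromBlocks 1 (of fun _ => β) 0 1
  let A : Matrix Unit Unit ℝ := of fun _ _ => a
  have hSL : S = Lᵀ * fromBlocks A 0 0 T * L := by
    simp only [L, fromBlocks_transpose, fromBlocks_multiply]
    ext (i | i) (j | j)
    · simp [A, ha]
    · simp [A, β, mul_div_cancel₀ _ ha0, Matrix.mul_apply]
    · simp [A, β, Matrix.mul_apply, div_mul_cancel₀ _ ha0]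
      exact hS.apply _ _
    · simp [A, T, Matrix.mul_apply]
      ring
  refine ⟨β, T, ?_, ?_, fun r U => ?_⟩
  · ext i j
    simp only [T, transpose_apply, of_apply]
    rw [hS.apply]; ring
  · rw [hSL]
    simp [L, A, det_fromBlocks_zero₂₁]
  · have hM : S.intCongr (fromBlocks 1 (of fun _ => r) 0 U) =
        (fromBlocks 1 (of fun _ i => r i + ∑ j, β j * U j i) 0 (U.map Int.cast))ᵀ *
          fromBlocks A 0 0 T *
          fromBlocks 1 (of fun _ i => r i + ∑ j, β j * U j i) 0 (U.map Int.cast) := by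
      have hLW : L * (fromBlocks 1 (of fun _ => r) 0 U).map (Int.cast : ℤ → ℝ) =
          fromBlocks 1 (of fun _ i => r i + ∑ j, β j * U j i) 0 (U.map Int.cast) := by
        simp only [L, fromBlocks_map, fromBlocks_multiply]
        ext (i | i) (j | j) <;> simp [Matrix.mul_apply]
      rw [intCongr, hSL, ← hLW, transpose_mul]
      simp only [Matrix.mul_assoc]
    rw [hM]
    simp only [fromBlocks_transpose, fromBlocks_multiply]
    refine ⟨by simp [A], fun i => ?_⟩
    simp [A, Matrix.mul_apply, intCongr]
    ring

/-- Hermite reduction of quadratic forms. -/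
lemma exists_hermite_reduction (n : ℕ) : ∃ γ > (0 : ℝ), ∀ c > (0 : ℝ), ∀ V : ℝ, ∃ C : ℝ,
    ∀ S : Matrix (Fin n) (Fin n) ℝ, S.IsSymm → S.det ≤ V →
      (∀ U : Matrix (Fin n) (Fin n) ℤ, IsUnit U.det → ∀ i, c ≤ S.intCongr U i i) →
      γ * c ^ n ≤ S.det ∧
        ∃ U : Matrix (Fin n) (Fin n) ℤ, IsUnit U.det ∧ ∀ i, S.intCongr U i i ≤ C := by
  induction n with
  | zero => exact ⟨1, one_pos, fun c _ V => ⟨0, fun S _ _ _ => by simp⟩⟩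
  | succ n ih =>
    obtain ⟨γ, hγ, ih⟩ := ih
    refine ⟨γ / 2 ^ n, by positivity, fun c hc V => ?_⟩
    obtain ⟨C, hC⟩ := ih (c / 2) (by positivity) (V / c)
    let a₀ := max 1 (V * 2 ^ n / γ)
    refine ⟨a₀ + |C|, fun S hS hV hmin => ?_⟩
    let Z : Set ℝ :=
      {t | ∃ U : Matrix (Fin (n + 1)) (Fin (n + 1)) ℤ, IsUnit U.det ∧ ∃ i, t = S.intCongr U i i}
    have hZc : ∀ t ∈ Z, c ≤ t := by
      rintro t ⟨U, hU, i, rfl⟩; exact hmin U hU i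
    have hZne : Z.Nonempty := ⟨_, 1, by simp, 0, rfl⟩
    have hI : c ≤ sInf Z := le_csInf hZne hZc
    have hbdd : BddBelow Z := ⟨c, hZc⟩
    obtain ⟨a, ⟨U₀, hU₀, i₀, ha⟩, haI⟩ :=
      exists_lt_of_csInf_lt hZne (show sInf Z < 4 / 3 * sInf Z by linarith)
    have hca : c ≤ a := hZc a ⟨U₀, hU₀, i₀, ha⟩
    have ha0 : 0 < a := hc.trans_le hca
    have hlow : ∀ t ∈ Z, 3 / 4 * a ≤ t := fun t ht => by
      have := csInf_le hbdd ht; linarith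
    obtain ⟨e, he⟩ : ∃ e : Unit ⊕ Fin n ≃ Fin (n + 1), e (.inl ()) = i₀ := by
      let e₁ : Unit ⊕ Fin n ≃ Fin (n + 1) := Fintype.equivOfCardEq (by simp; omega)
      exact ⟨e₁.trans (Equiv.swap (e₁ (.inl ())) i₀), by simp⟩
    let S₁ := (S.intCongr U₀).submatrix e e
    have hS₁ : S₁.IsSymm := (hS.intCongr U₀).submatrix e
    have hdet₁ : S₁.det = S.det := by
      rw [det_submatrix_equiv_self, det_intCongr S hU₀]
    obtain ⟨β, T, hT, hdetT, hsq⟩ := exists_complete_square hS₁ (a := a)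
      (by simp [S₁, he, ha]) ha0.ne'
    have hlift : ∀ (r : Fin n → ℤ) (U : Matrix (Fin n) (Fin n) ℤ), IsUnit U.det →
        ∃ W : Matrix (Fin (n + 1)) (Fin (n + 1)) ℤ, IsUnit W.det ∧
          S.intCongr W (e (.inl ())) (e (.inl ())) = a ∧
          ∀ i, S.intCongr W (e (.inr i)) (e (.inr i)) =
            a * (r i + ∑ j, β j * U j i) ^ 2 + T.intCongr U i i := by
      intro r U hU
      refine ⟨U₀ * (fromBlocks 1 (of fun _ => r) 0 U).submatrix e.symm e.symm, ?_, ?_⟩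
      · rw [det_mul, det_submatrix_equiv_self, det_fromBlocks_zero₂₁]
        simpa using hU₀.mul hU
      · have h := hsq r U
        rw [intCongr_submatrix, ← intCongr_mul] at h
        simpa using h
    have hround : ∀ U : Matrix (Fin n) (Fin n) ℤ, ∃ r : Fin n → ℤ,
        ∀ i, (r i + ∑ j, β j * U j i) ^ 2 ≤ 1 / 4 := by
      intro U
      refine ⟨fun i => -round (∑ j, β j * U j i), fun i => ?_⟩
      have h := abs_sub_round (∑ j, β j * U j i)
      rw [abs_le] at h
      push_cast
      nlinarith
    have hTmin : ∀ U : Matrix (Fin n) (Fin n) ℤ, IsUnit U.det → ∀ i,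
        a / 2 ≤ T.intCongr U i i := by
      intro U hU i
      obtain ⟨r, hr⟩ := hround U
      obtain ⟨W, hW, -, h⟩ := hlift r U hU
      have h1 := hlow _ ⟨W, hW, e (.inr i), rfl⟩
      rw [h i] at h1
      nlinarith [hr i]
    have hSV : a * T.det ≤ V := by rw [← hdetT, hdet₁]; exact hV
    have hTdet : γ * (a / 2) ^ n ≤ T.det := by
      obtain ⟨_, h⟩ := ih (a / 2) (by positivity) T.det
      exact (h T hT le_rfl hTmin).1
    have hpow : γ / 2 ^ n * a ^ (n + 1) ≤ a * T.det := by
      calc γ / 2 ^ n * a ^ (n + 1) = a * (γ * (a / 2) ^ n) := by rw [div_pow, pow_succ]; ring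
        _ ≤ a * T.det := by gcongr
    have hV0 : 0 ≤ V := le_trans (by positivity) (hpow.trans hSV)
    have hTV : T.det ≤ V / c := by
      calc T.det ≤ V / a := by rw [le_div_iff₀ ha0]; linarith
        _ ≤ V / c := by gcongr
    have haa : a ≤ a₀ := by
      rcases le_total a 1 with h | h
      · exact h.trans (le_max_left _ _)
      · refine le_trans ?_ (le_max_right _ _)
        rw [le_div_iff₀ hγ]
        have h1 : a ≤ a ^ (n + 1) := le_self_pow₀ h (by omega)
        have h2 : γ * a ^ (n + 1) ≤ V * 2 ^ n := by
          rw [← div_le_iff₀ (by positivity)]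
          calc γ * a ^ (n + 1) / 2 ^ n = γ / 2 ^ n * a ^ (n + 1) := by ring
            _ ≤ V := hpow.trans hSV
        nlinarith
    refine ⟨?_, ?_⟩
    · rw [← hdet₁, hdetT]
      exact le_trans (by gcongr) hpow
    · obtain ⟨-, U, hU, hUC⟩ := hC T hT hTV fun U hU i => by
        have := hTmin U hU i; linarith
      obtain ⟨r, hr⟩ := hround U
      obtain ⟨W, hW, hW₀, h⟩ := hlift r U hU
      refine ⟨W, hW, fun j => ?_⟩
      obtain ⟨j, rfl⟩ := e.surjective j
      rcases j with ⟨⟩ | i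
      · rw [hW₀]
        linarith [abs_nonneg C]
      · rw [h i]
        have h1 := hUC i
        have h2 := le_abs_self C
        nlinarith [hr i]

end Matrix

/-- Simultaneous Diophantine approximation. -/
lemma exists_nat_mul_sub_int_lt {n : ℕ} (u : Fin n → ℝ) {ε : ℝ} (hε : 0 < ε) :
    ∃ q : ℕ, 1 ≤ q ∧ ∃ m : Fin n → ℤ, ∀ i, |q * u i - m i| < ε := by
  let x : ℕ → Fin n → ℝ := fun k i => Int.fract (k * u i)
  have hx : ∀ k, x k ∈ Set.Icc (0 : Fin n → ℝ) 1 := fun k =>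
    ⟨fun i => Int.fract_nonneg _, fun i => (Int.fract_lt_one _).le⟩
  obtain ⟨y, -, φ, hφ, hlim⟩ := isCompact_Icc.tendsto_subseq hx
  obtain ⟨N, hN⟩ := Metric.cauchySeq_iff.1 hlim.cauchySeq ε hε
  have hlt : φ N < φ (N + 1) := hφ (Nat.lt_succ_self N)
  refine ⟨φ (N + 1) - φ N, by omega,
    fun i => ⌊φ (N + 1) * u i⌋ - ⌊φ N * u i⌋, fun i => ?_⟩
  have h := (dist_le_pi_dist _ _ i).trans_lt (hN (N + 1) (by omega) N le_rfl)
  simp only [Function.comp, x, Real.dist_eq, Int.fract] at h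
  rw [Nat.cast_sub hlt.le]
  push_cast
  exact (congrArg abs (by ring)).trans_lt h

/-- A set is unavoidable if it meets every integer hyperplane. -/
def IsUnavoidable {n : ℕ} (K : Set (Fin n → ℝ)) : Prop :=
  ∀ m : Fin n → ℤ, m ≠ 0 → ∃ x ∈ K, ∑ i, (m i : ℝ) * x i = 1

namespace IsUnavoidable

variable {n : ℕ} {K : Set (Fin n → ℝ)}

lemma exists_pos (hK : IsUnavoidable K) (hb : Bornology.IsBounded K)
    {f : (Fin n → ℝ) →ₗ[ℝ] ℝ} (hf : f ≠ 0) : ∃ x ∈ K, 0 < f x := by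
  by_contra! hneg
  obtain ⟨R, hR0, hR⟩ := hb.exists_pos_norm_le
  have hfs : ∀ x, f x = ∑ i, f (Pi.single i 1) * x i := fun x => by
    rw [LinearMap.pi_apply_eq_sum_univ f x]
    refine Finset.sum_congr rfl fun i _ => ?_
    rw [smul_eq_mul, mul_comm]
    congr 2
    ext k
    simp [Pi.single_apply, eq_comm]
  obtain ⟨j, hj⟩ : ∃ j, f (Pi.single j 1) ≠ 0 := by
    by_contra! h
    exact hf (LinearMap.ext fun x => by simp [hfs x, h])
  let u : Fin n → ℝ := fun i => f (Pi.single i 1) / |f (Pi.single j 1)|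
  have hu : ∀ x ∈ K, ∑ i, u i * x i ≤ 0 := fun x hx => by
    have : ∑ i, u i * x i = f x / |f (Pi.single j 1)| := by
      rw [hfs x, Finset.sum_div]
      exact Finset.sum_congr rfl fun i _ => by simp only [u]; ring
    rw [this]
    exact div_nonpos_of_nonpos_of_nonneg (hneg x hx) (abs_nonneg _)
  have huj : |u j| = 1 := by simp [u, abs_div, div_self (abs_ne_zero.2 hj)]
  have hn : 0 ≤ (n : ℝ) * R := by positivity
  obtain ⟨q, hq, m, hm⟩ := exists_nat_mul_sub_int_lt u (ε := 1 / (n * R + 1)) (by positivity)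
  have hε : 1 / (n * R + 1) ≤ 1 := by
    rw [div_le_one (by positivity)]; linarith
  have hm0 : m ≠ 0 := by
    rintro rfl
    have h := hm j
    have hq' : (1 : ℝ) ≤ q := by exact_mod_cast hq
    simp only [Pi.zero_apply, Int.cast_zero, sub_zero, abs_mul, huj, Nat.abs_cast, mul_one] at h
    linarith
  obtain ⟨x, hx, hx1⟩ := hK m hm0
  have hdiff : ∑ i, (m i - q * u i) * x i ≤ ∑ _i : Fin n, 1 / (n * R + 1) * R := by
    refine Finset.sum_le_sum fun i _ => (le_abs_self _).trans ?_
    rw [abs_mul, abs_sub_comm]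
    have h1 := (hm i).le
    have h2 : |x i| ≤ R := (norm_le_pi_norm x i).trans (hR x hx)
    gcongr
  have hsplit : ∑ i, (m i : ℝ) * x i = q * ∑ i, u i * x i + ∑ i, (m i - q * u i) * x i := by
    rw [Finset.mul_sum, ← Finset.sum_add_distrib]
    exact Finset.sum_congr rfl fun i _ => by ring
  have h3 : (q : ℝ) * ∑ i, u i * x i ≤ 0 := mul_nonpos_of_nonneg_of_nonpos (by positivity) (hu x hx)
  have h4 : ∑ _i : Fin n, 1 / (n * R + 1) * R < 1 := by
    rw [Finset.sum_const, Finset.card_univ, Fintype.card_fin, nsmul_eq_mul,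
      show (n : ℝ) * (1 / (n * R + 1) * R) = n * R / (n * R + 1) by ring,
      div_lt_one (by positivity)]
    linarith
  linarith

lemma nonempty [NeZero n] (hK : IsUnavoidable K) : K.Nonempty := by
  obtain ⟨x, hx, -⟩ := hK (fun _ => 1) fun h => one_ne_zero (congrFun h 0)
  exact ⟨x, hx⟩

lemma zero_mem [NeZero n] (hK : IsUnavoidable K) (hc : IsCompact K) (hconv : Convex ℝ K) :
    0 ∈ K := by
  by_contra h0
  obtain ⟨f, s, hfs, hs⟩ := geometric_hahn_banach_closed_point hconv hc.isClosed h0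
  have hf0 : (f : (Fin n → ℝ) →ₗ[ℝ] ℝ) ≠ 0 := by
    intro h
    obtain ⟨x, hx⟩ := hK.nonempty
    have h1 := hfs x hx
    have h2 : f x = 0 := LinearMap.congr_fun h x
    rw [h2] at h1
    rw [map_zero] at hs
    linarith
  obtain ⟨x, hx, hpos⟩ := hK.exists_pos hc.isBounded hf0
  have h1 := hfs x hx
  rw [map_zero] at hs
  exact absurd hpos (by simpa using (h1.trans hs).le)

lemma interior_nonempty [NeZero n] (hK : IsUnavoidable K) (hc : IsCompact K)
    (hconv : Convex ℝ K) : (interior K).Nonempty := by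
  have h0 := hK.zero_mem hc hconv
  rw [hconv.interior_nonempty_iff_affineSpan_eq_top,
    AffineSubspace.affineSpan_eq_top_iff_vectorSpan_eq_top_of_nonempty _ _ _ ⟨0, h0⟩]
  by_contra hne
  obtain ⟨f, hf, hle⟩ := Submodule.exists_le_ker_of_lt_top _ (lt_top_iff_ne_top.2 hne)
  obtain ⟨x, hx, hpos⟩ := hK.exists_pos hc.isBounded hf
  have : f x = 0 := by
    simpa using hle (vsub_mem_vectorSpan ℝ hx h0)
  linarith

end IsUnavoidable

section UnimodularReduction

open Matrix

variable {n : ℕ} {K : Set (Fin n → ℝ)}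

/-- Points of `K` spanning a simplex of maximal volume with the origin control all linear
functionals on `K`. -/
lemma exists_matrix_rows_mem_abs_dotProduct_le (hc : IsCompact K) (hi : (interior K).Nonempty) :
    ∃ A : Matrix (Fin n) (Fin n) ℝ, (∀ i, A i ∈ K) ∧ A.det ≠ 0 ∧
      ∀ x ∈ K, ∀ m : Fin n → ℝ, |m ⬝ᵥ x| ≤ ∑ i, |m ⬝ᵥ A i| := by
  have hspan : Submodule.span ℝ K = ⊤ := Submodule.eq_top_of_nonempty_interior' _
    (hi.mono (interior_mono Submodule.subset_span))
  let b := Module.Basis.ofSpan hspan.ge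
  let e := b.indexEquiv (Pi.basisFun ℝ (Fin n))
  let B : Matrix (Fin n) (Fin n) ℝ := of fun i => b (e.symm i)
  have hB : ∀ i, B i ∈ K := fun i => Module.Basis.ofSpan_subset hspan.ge ⟨_, rfl⟩
  have hBdet : B.det ≠ 0 := by
    rw [← isUnit_iff_ne_zero, ← Matrix.isUnit_iff_isUnit_det,
      ← Matrix.linearIndependent_rows_iff_isUnit]
    exact b.linearIndependent.comp _ e.symm.injective
  have hcpt : IsCompact (Set.univ.pi fun _ : Fin n => K) := isCompact_univ_pi fun _ => hc
  obtain ⟨A, hA, hmax⟩ := hcpt.exists_isMaxOn ⟨B, fun i _ => hB i⟩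
    (f := fun A : Fin n → Fin n → ℝ => |(of A).det|)
    (Continuous.continuousOn (by
      exact (Continuous.matrix_det continuous_id).abs))
  rw [isMaxOn_iff] at hmax
  have hdet : (of A).det ≠ 0 := by
    have h := hmax B fun i _ => hB i
    intro h0
    rw [h0, abs_zero] at h
    exact hBdet (abs_nonpos_iff.1 h)
  refine ⟨of A, fun i => hA i trivial, hdet, fun x hx m => ?_⟩
  have hcr : (of A).det * (m ⬝ᵥ x) = ∑ i, (m ⬝ᵥ of A i) * ((of A).updateRow i x).det := by
    have h := congrArg (m ⬝ᵥ ·) (mulVec_cramer (of A)ᵀ x)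
    simp only [dotProduct_smul, det_transpose, smul_eq_mul] at h
    rw [← h, dotProduct_mulVec, dotProduct]
    refine Finset.sum_congr rfl fun i _ => ?_
    rw [cramer_transpose_apply, vecMul_transpose, mulVec, dotProduct_comm]
  have hle : |(of A).det| * |m ⬝ᵥ x| ≤ |(of A).det| * ∑ i, |m ⬝ᵥ of A i| := by
    rw [← abs_mul, hcr, Finset.mul_sum]
    refine (Finset.abs_sum_le_sum_abs _ _).trans (Finset.sum_le_sum fun i _ => ?_)
    rw [abs_mul, mul_comm]
    refine mul_le_mul_of_nonneg_right ?_ (abs_nonneg _)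
    refine hmax ((of A).updateRow i x) fun j _ => ?_
    rcases eq_or_ne j i with rfl | hj
    · rwa [updateRow_self]
    · rw [updateRow_ne hj]; exact hA j trivial
  exact le_of_mul_le_mul_left hle (abs_pos.2 hdet)

lemma ofReal_abs_det_le_volume [NeZero n] (hconv : Convex ℝ K) (h0 : 0 ∈ K)
    {A : Matrix (Fin n) (Fin n) ℝ} (hA : ∀ i, A i ∈ K) :
    ENNReal.ofReal (|A.det| * (1 / n) ^ n) ≤ volume K := by
  have hn : (0 : ℝ) < n := by exact_mod_cast Nat.pos_of_ne_zero (NeZero.ne n)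
  have hsub : Matrix.toLin' Aᵀ '' Set.Icc 0 (fun _ => (1 / n : ℝ)) ⊆ K := by
    rintro _ ⟨t, ⟨ht0, ht1⟩, rfl⟩
    have h : Matrix.toLin' Aᵀ t = ∑ i, t i • A i := by
      ext j
      simp [Matrix.mulVec, dotProduct, mul_comm]
    have h' : ∑ i, t i • A i = ∑ i, (1 / n : ℝ) • ((n * t i) • A i) :=
      Finset.sum_congr rfl fun i _ => by
        rw [smul_smul, ← mul_assoc, one_div, inv_mul_cancel₀ hn.ne', one_mul]
    rw [h, h']
    refine hconv.sum_mem (fun _ _ => by positivity) ?_ fun i _ =>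
      hconv.smul_mem_of_zero_mem h0 (hA i) ⟨mul_nonneg hn.le (ht0 i), ?_⟩
    · simp [hn.ne']
    · rw [← le_div_iff₀' hn]
      exact ht1 i
  refine le_trans (le_of_eq ?_) (measure_mono hsub)
  rw [Measure.addHaar_image_linearMap, LinearMap.det_toLin', det_transpose, Real.volume_Icc_pi,
    ENNReal.ofReal_mul (abs_nonneg _), ENNReal.ofReal_pow (by positivity)]
  simp

/-- Unavoidable convex bodies of bounded volume are uniformly bounded up to unimodular
transformations. -/
lemma IsUnavoidable.exists_unimodular_abs_le (n : ℕ) [NeZero n] (V : ℝ) : ∃ R : ℝ,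
    ∀ K : Set (Fin n → ℝ), IsCompact K → Convex ℝ K → (interior K).Nonempty →
      IsUnavoidable K → volume K ≤ ENNReal.ofReal V →
      ∃ U : Matrix (Fin n) (Fin n) ℤ, IsUnit U.det ∧
        ∀ x ∈ K, ∀ i, |∑ j, (U j i : ℝ) * x j| ≤ R := by
  obtain ⟨γ, -, hγ⟩ := exists_hermite_reduction n
  have hn : (0 : ℝ) < n := by exact_mod_cast Nat.pos_of_ne_zero (NeZero.ne n)
  obtain ⟨C, hC⟩ := hγ (1 / n) (by positivity) ((|V| * n ^ n) ^ 2)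
  refine ⟨√(n * C), fun K hc hconv hi hK hV => ?_⟩
  obtain ⟨A, hAK, hA0, hA⟩ := exists_matrix_rows_mem_abs_dotProduct_le hc hi
  have hQ : ∀ (U : Matrix (Fin n) (Fin n) ℤ) i, (Aᵀ * A).intCongr U i i =
      ∑ k, |(fun j => (U j i : ℝ)) ⬝ᵥ A k| ^ 2 := fun U i => by
    have : (Aᵀ * A).intCongr U =
        (A * U.map (Int.cast : ℤ → ℝ))ᵀ * (A * U.map (Int.cast : ℤ → ℝ)) := by
      simp only [intCongr, transpose_mul, Matrix.mul_assoc]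
    rw [this, Matrix.mul_apply]
    refine Finset.sum_congr rfl fun k _ => ?_
    rw [sq_abs, sq, transpose_apply, Matrix.mul_apply, dotProduct_comm]
    rfl
  have hdet : |A.det| ≤ |V| * n ^ n := by
    have h := (ofReal_abs_det_le_volume hconv (hK.zero_mem hc hconv) hAK).trans hV
    have h2 := (ENNReal.ofReal_le_ofReal_iff (abs_nonneg V)).1
      (h.trans (ENNReal.ofReal_le_ofReal (le_abs_self V)))
    rwa [one_div, inv_pow, ← div_eq_mul_inv, div_le_iff₀ (by positivity)] at h2
  have hCS : ∀ f : Fin n → ℝ, (∑ k, |f k|) ^ 2 ≤ n * ∑ k, |f k| ^ 2 := fun f => by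
    simpa using sq_sum_le_card_mul_sum_sq (s := Finset.univ) (f := fun k => |f k|)
  obtain ⟨-, U, hU, hUC⟩ := hC (Aᵀ * A) (isSymm_transpose_mul_self A)
    (by
      rw [det_mul, det_transpose, ← sq, ← sq_abs]
      gcongr)
    (fun U hU i => by
      have hm : (fun j => U j i) ≠ 0 := fun h => by
        apply hU.ne_zero
        exact det_eq_zero_of_column_eq_zero i fun j => congrFun h j
      obtain ⟨x, hx, hx1⟩ := hK _ hm
      have h1 := hA x hx fun j => (U j i : ℝ)
      have h2 : (fun j => (U j i : ℝ)) ⬝ᵥ x = 1 := hx1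
      rw [h2, abs_one] at h1
      rw [hQ, div_le_iff₀' hn]
      exact (one_le_pow₀ h1).trans (hCS _))
  refine ⟨U, hU, fun x hx i => (hA x hx fun j => (U j i : ℝ)).trans (Real.le_sqrt_of_sq_le ?_)⟩
  refine (hCS _).trans ?_
  rw [← hQ]
  exact mul_le_mul_of_nonneg_left (hUC i) hn.le

end UnimodularReduction

namespace TopologicalSpace.NonemptyCompacts

lemma subset_thickening_of_dist_lt {α : Type*} [MetricSpace α] {K L : NonemptyCompacts α} {ε : ℝ}
    (h : dist K L < ε) : (K : Set α) ⊆ Metric.thickening ε L := fun _ hx =>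
  Metric.mem_thickening_iff.2 <| Metric.exists_dist_lt_of_hausdorffDist_lt hx h <|
    Metric.hausdorffEDist_ne_top_of_nonempty_of_bounded K.nonempty L.nonempty
      K.isCompact.isBounded L.isCompact.isBounded

lemma isClosed_setOf_convex {E : Type*} [NormedAddCommGroup E] [NormedSpace ℝ E] :
    IsClosed {K : NonemptyCompacts E | Convex ℝ (K : Set E)} := by
  refine isClosed_of_closure_subset fun K hK x hx y hy a b ha hb hab => ?_
  rw [← K.isCompact.isClosed.closure_eq, Metric.mem_closure_iff]
  intro ε hε
  obtain ⟨L, hL, hKL⟩ := Metric.mem_closure_iff.1 hK (ε / 2) (half_pos hε)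
  have h1 : a • x + b • y ∈ Metric.thickening (ε / 2) (L : Set E) :=
    (Convex.thickening hL _) (subset_thickening_of_dist_lt hKL hx)
      (subset_thickening_of_dist_lt hKL hy) ha hb hab
  obtain ⟨z, hz, hz'⟩ := Metric.mem_thickening_iff.1 h1
  rw [dist_comm] at hKL
  obtain ⟨w, hw, hw'⟩ := Metric.mem_thickening_iff.1 (subset_thickening_of_dist_lt hKL hz)
  exact ⟨w, hw, (dist_triangle _ z _).trans_lt (by linarith)⟩

lemma isClosed_setOf_isUnavoidable {n : ℕ} :
    IsClosed {K : NonemptyCompacts (Fin n → ℝ) | IsUnavoidable (K : Set (Fin n → ℝ))} := by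
  refine isClosed_of_closure_subset fun K hK m hm => ?_
  let g : (Fin n → ℝ) →L[ℝ] ℝ := ∑ i, (m i : ℝ) • ContinuousLinearMap.proj i
  have hg : ∀ x, g x = ∑ i, (m i : ℝ) * x i := fun x => by simp [g]
  suffices h : (1 : ℝ) ∈ g '' K by
    obtain ⟨x, hx, h1⟩ := h
    exact ⟨x, hx, (hg x).symm.trans h1⟩
  rw [← (K.isCompact.image g.continuous).isClosed.closure_eq, Metric.mem_closure_iff]
  intro ε hε
  obtain ⟨δ, hδ, hδε⟩ := Metric.uniformContinuous_iff.1 g.uniformContinuous ε hε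
  obtain ⟨L, hL, hKL⟩ := Metric.mem_closure_iff.1 hK δ hδ
  obtain ⟨y, hy, hy1⟩ := hL m hm
  rw [dist_comm] at hKL
  obtain ⟨x, hx, hxy⟩ := Metric.mem_thickening_iff.1 (subset_thickening_of_dist_lt hKL hy)
  refine ⟨g x, ⟨x, hx, rfl⟩, ?_⟩
  rw [← hy1, ← hg]
  exact hδε hxy

/-- The Lebesgue measure is lower semicontinuous on convex bodies. -/
lemma lowerSemicontinuousOn_addHaar_setOf_convex {E : Type*} [NormedAddCommGroup E]
    [NormedSpace ℝ E] [FiniteDimensional ℝ E] [MeasurableSpace E] [BorelSpace E]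
    (μ : Measure E) [μ.IsAddHaarMeasure] :
    LowerSemicontinuousOn (fun K : NonemptyCompacts E => μ (K : Set E))
      {K | Convex ℝ (K : Set E)} := by
  intro K hK v hv
  change v < μ (K : Set E) at hv
  rw [← measure_sdiff_null (Convex.addHaar_frontier μ hK), self_sdiff_frontier] at hv
  obtain ⟨C, hCK, hC, hvC⟩ := isOpen_interior.exists_lt_isCompact hv
  obtain ⟨δ, hδ, hCδ⟩ := hC.exists_thickening_subset_open isOpen_interior hCK
  filter_upwards [self_mem_nhdsWithin, mem_nhdsWithin_of_mem_nhds
    (Metric.ball_mem_nhds K (half_pos hδ))] with L hL hLK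
  refine hvC.trans_le (measure_mono fun x hx => ?_)
  by_contra hxL
  obtain ⟨f, s, hfs, hsx⟩ := geometric_hahn_banach_closed_point hL L.isCompact.isClosed hxL
  obtain ⟨w, hw, hmax⟩ := (isCompact_closedBall (0 : E) (δ / 2)).exists_isMaxOn
    ⟨0, Metric.mem_closedBall_self (half_pos hδ).le⟩ f.continuous.continuousOn
  rw [isMaxOn_iff] at hmax
  have hz : x + w ∈ (K : Set E) := by
    refine interior_subset (hCδ (Metric.mem_thickening_iff.2 ⟨x, hx, ?_⟩))
    rw [mem_closedBall_zero_iff] at hw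
    rw [dist_eq_norm, add_sub_cancel_left]
    linarith
  rw [Metric.mem_ball, dist_comm] at hLK
  obtain ⟨y, hy, hyw⟩ := Metric.mem_thickening_iff.1 (subset_thickening_of_dist_lt hLK hz)
  have h1 := hmax (x + w - y) (by
    rw [mem_closedBall_zero_iff, ← dist_eq_norm]; exact hyw.le)
  have h2 := hfs y hy
  rw [map_sub, map_add] at h1
  linarith

end TopologicalSpace.NonemptyCompacts

lemma isUnavoidable_Icc (n : ℕ) : IsUnavoidable (Set.Icc (-1 : Fin n → ℝ) 1) := by
  intro m hm
  obtain ⟨i, hi⟩ := Function.ne_iff.1 hm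
  have hi' : (m i : ℝ) ≠ 0 := by exact_mod_cast hi
  have h1 : |(m i : ℝ)⁻¹| ≤ 1 := by
    rw [abs_inv]
    exact inv_le_one_of_one_le₀ (by exact_mod_cast Int.one_le_abs hi)
  rw [abs_le] at h1
  refine ⟨Pi.single i (m i : ℝ)⁻¹, ⟨fun j => ?_, fun j => ?_⟩, ?_⟩
  · rcases eq_or_ne j i with rfl | h
    · simpa using h1.1
    · simp [h]
  · rcases eq_or_ne j i with rfl | h
    · simpa using h1.2
    · simp [h]
  · simp [Pi.single_apply, hi']

lemma IsUnavoidable.image_unimodular {n : ℕ} {K : Set (Fin n → ℝ)} (hK : IsUnavoidable K)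
    {U : Matrix (Fin n) (Fin n) ℤ} (hU : IsUnit U.det) :
    IsUnavoidable (Matrix.toLin' (U.map (Int.cast : ℤ → ℝ))ᵀ '' K) := by
  intro m hm
  have hm' : U *ᵥ m ≠ 0 := fun h => hm <| by
    have hinj := Matrix.mulVec_injective_of_isUnit ((Matrix.isUnit_iff_isUnit_det U).2 hU)
    exact hinj (h.trans (Matrix.mulVec_zero U).symm)
  obtain ⟨x, hx, hx1⟩ := hK _ hm'
  refine ⟨_, ⟨x, hx, rfl⟩, ?_⟩
  have hcast : (fun i => ((U *ᵥ m) i : ℝ)) =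
      U.map (Int.cast : ℤ → ℝ) *ᵥ fun i => (m i : ℝ) := by
    ext i; simp [Matrix.mulVec, dotProduct]
  calc ∑ i, (m i : ℝ) * Matrix.toLin' (U.map (Int.cast : ℤ → ℝ))ᵀ x i
      = (fun i => (m i : ℝ)) ⬝ᵥ (U.map (Int.cast : ℤ → ℝ))ᵀ *ᵥ x := rfl
    _ = (fun i => ((U *ᵥ m) i : ℝ)) ⬝ᵥ x := by
      rw [Matrix.dotProduct_mulVec, Matrix.vecMul_transpose, hcast]
    _ = 1 := hx1

/-- Among all unavoidable convex bodies in `ℝⁿ` (compact convex sets with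
nonempty interior meeting every integer hyperplane) there is one of minimal volume. -/
theorem stmt_2 (n : ℕ) :
    ∃ K₀ : Set (Fin n → ℝ),
      (IsCompact K₀ ∧ Convex ℝ K₀ ∧ (interior K₀).Nonempty ∧
        (∀ m : Fin n → ℤ, m ≠ 0 → ∃ x ∈ K₀, ∑ i, (m i : ℝ) * x i = 1)) ∧
      ∀ K : Set (Fin n → ℝ),
        IsCompact K → Convex ℝ K → (interior K).Nonempty →
        (∀ m : Fin n → ℤ, m ≠ 0 → ∃ x ∈ K, ∑ i, (m i : ℝ) * x i = 1) →
        volume K₀ ≤ volume K := by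
  rcases eq_or_ne n 0 with rfl | hn
  · refine ⟨Set.univ, ⟨isCompact_univ, convex_univ, by simp,
      fun m hm => (hm (Subsingleton.elim _ _)).elim⟩, fun K _ _ hi _ => ?_⟩
    rw [Subsingleton.eq_univ_of_nonempty (hi.mono interior_subset)]
  have : NeZero n := ⟨hn⟩
  let Q : Set (Fin n → ℝ) := Set.Icc (-1) 1
  have hQ : IsUnavoidable Q := isUnavoidable_Icc n
  have hQc : IsCompact Q := isCompact_Icc
  have hQV : volume Q = ENNReal.ofReal (volume Q).toReal :=
    (ENNReal.ofReal_toReal hQc.measure_lt_top.ne).symm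
  obtain ⟨R, hR⟩ := IsUnavoidable.exists_unimodular_abs_le n (volume Q).toReal
  let B : Set (Fin n → ℝ) := Metric.closedBall 0 (max R 1)
  let G : Set (TopologicalSpace.NonemptyCompacts (Fin n → ℝ)) :=
    {K | (K : Set (Fin n → ℝ)) ⊆ B} ∩
      ({K | Convex ℝ (K : Set (Fin n → ℝ))} ∩ {K | IsUnavoidable (K : Set (Fin n → ℝ))})
  have hG : IsCompact G :=
    (TopologicalSpace.NonemptyCompacts.isCompact_subsets_of_isCompact
      (isCompact_closedBall _ _)).inter_right
      (TopologicalSpace.NonemptyCompacts.isClosed_setOf_convex.inter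
        TopologicalSpace.NonemptyCompacts.isClosed_setOf_isUnavoidable)
  have hmem : ∀ K : Set (Fin n → ℝ), IsCompact K → Convex ℝ K → IsUnavoidable K → K ⊆ B →
      ∃ L ∈ G, (L : Set (Fin n → ℝ)) = K := fun K hc hconv hK hKB =>
    ⟨⟨⟨K, hc⟩, hK.nonempty⟩, ⟨hKB, hconv, hK⟩, rfl⟩
  obtain ⟨Q', hQ'G, hQ'⟩ := hmem Q hQc (convex_Icc _ _) hQ fun x hx => by
    rw [mem_closedBall_zero_iff]
    refine le_trans ?_ (le_max_right R 1)
    exact (pi_norm_le_iff_of_nonneg zero_le_one).2 fun i => abs_le.2 ⟨hx.1 i, hx.2 i⟩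
  obtain ⟨K₀, hK₀, hmin⟩ := LowerSemicontinuousOn.exists_isMinOn ⟨Q', hQ'G⟩ hG
    ((TopologicalSpace.NonemptyCompacts.lowerSemicontinuousOn_addHaar_setOf_convex
      (volume : Measure (Fin n → ℝ))).mono fun K hK => hK.2.1)
  rw [isMinOn_iff] at hmin
  refine ⟨K₀, ⟨K₀.isCompact, hK₀.2.1, hK₀.2.2.interior_nonempty K₀.isCompact hK₀.2.1, hK₀.2.2⟩,
    fun K hc hconv hi hK => ?_⟩
  rcases le_total (volume Q) (volume K) with h | h
  · exact (hQ' ▸ hmin Q' hQ'G).trans h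
  · obtain ⟨U, hU, hUR⟩ := hR K hc hconv hi hK (h.trans hQV.le)
    let T := Matrix.toLin' (U.map (Int.cast : ℤ → ℝ))ᵀ
    obtain ⟨L, hLG, hL⟩ := hmem (T '' K) (hc.image T.continuous_of_finiteDimensional)
      (hconv.linear_image T) (IsUnavoidable.image_unimodular hK hU) <| by
        rintro _ ⟨x, hx, rfl⟩
        rw [mem_closedBall_zero_iff]
        exact (pi_norm_le_iff_of_nonneg (by positivity)).2 fun i =>
          (hUR x hx i).trans (le_max_left _ _)
    have hdet : |LinearMap.det T| = 1 := by
      have h : (U.map (Int.cast : ℤ → ℝ)).det = (U.det : ℝ) :=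
        ((Int.castRingHom ℝ).map_det U).symm
      rw [LinearMap.det_toLin', Matrix.det_transpose, h]
      rcases Int.isUnit_iff.1 hU with h | h <;> simp [h]
    calc volume (K₀ : Set (Fin n → ℝ)) ≤ volume (L : Set (Fin n → ℝ)) := hmin L hLG
      _ = volume K := by
        rw [hL, Measure.addHaar_image_linearMap, hdet]
        simp
end

section
/- There exists a constant c_n depending only on the dimension n such that every unavoidable convex body in ℝⁿ of minimal volume (i.e., whose volume is ≤ the volume of every unavoidable convex body in ℝⁿ) is a polytope — the convex hull of a finite set of points — with at most c_n vertices. -/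
open MeasureTheory

open Matrix Set

/-- A set in `ℝⁿ` is unavoidable if it meets every integer hyperplane `m ⬝ᵥ x = 1`. -/
def Unavoidable {n : ℕ} (K : Set (Fin n → ℝ)) : Prop :=
  ∀ m : Fin n → ℤ, m ≠ 0 → ∃ x ∈ K, (fun i ↦ (m i : ℝ)) ⬝ᵥ x = 1

/-- Minkowski's theorem on linear forms. -/
theorem exists_int_abs_mulVec_lt {n : ℕ} (A : Matrix (Fin n) (Fin n) ℝ) (hA : A.det ≠ 0)
    (c : Fin n → ℝ) (hc : ∀ i, 0 < c i) (h : |A.det| < ∏ i, c i) :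
    ∃ m : Fin n → ℤ, m ≠ 0 ∧ ∀ i, |A i ⬝ᵥ (fun j ↦ (m j : ℝ))| < c i := by
  set B : Set (Fin n → ℝ) := univ.pi fun i ↦ Ioo (-c i) (c i) with hB
  have hBmem (y : Fin n → ℝ) : y ∈ B ↔ ∀ i, |y i| < c i := by
    simp [hB, abs_lt]
  have hvol : volume (ZSpan.fundamentalDomain (Pi.basisFun ℝ (Fin n))) *
      2 ^ Module.finrank ℝ (Fin n → ℝ) < volume (Matrix.toLin' A ⁻¹' B) := by
    rw [Measure.addHaar_preimage_linearMap _ (by simpa using hA), hB, Real.volume_pi_Ioo,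
      ← ENNReal.ofReal_prod_of_nonneg (fun i _ ↦ by linarith [hc i]),
      ← ENNReal.ofReal_mul (abs_nonneg _), ZSpan.fundamentalDomain_pi_basisFun, Real.volume_pi_Ico]
    simp only [sub_zero, ENNReal.ofReal_one, Finset.prod_const_one, one_mul,
      Module.finrank_fin_fun, LinearMap.det_toLin', sub_neg_eq_add, ← two_mul,
      Finset.prod_mul_distrib, Finset.prod_const, Finset.card_univ, Fintype.card_fin, abs_inv]
    rw [← ENNReal.ofReal_ofNat, ← ENNReal.ofReal_pow (by norm_num),
      ENNReal.ofReal_lt_ofReal_iff_of_nonneg (by positivity)]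
    have h0 : 0 < |A.det| := abs_pos.2 hA
    rw [inv_mul_eq_div, lt_div_iff₀ h0]
    exact mul_lt_mul_of_pos_left h (by positivity)
  have : Countable (Submodule.span ℤ (range (Pi.basisFun ℝ (Fin n)))).toAddSubgroup :=
    inferInstanceAs (Countable (Submodule.span ℤ (range (Pi.basisFun ℝ (Fin n)))))
  obtain ⟨x, hx0, hx⟩ := exists_ne_zero_mem_lattice_of_measure_mul_two_pow_lt_measure
    (ZSpan.isAddFundamentalDomain' (Pi.basisFun ℝ (Fin n)) volume)
    (s := Matrix.toLin' A ⁻¹' B)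
    (fun x hx ↦ by
      rw [mem_preimage, hBmem] at hx ⊢
      simpa [Matrix.mulVec_neg] using hx)
    ((convex_pi fun i _ ↦ convex_Ioo _ _).linear_preimage _) hvol
  have hxm := (Module.Basis.mem_span_iff_repr_mem ℤ (Pi.basisFun ℝ (Fin n)) (x : Fin n → ℝ)).1 x.2
  choose m hm using hxm
  have hm' : (fun j ↦ (m j : ℝ)) = (x : Fin n → ℝ) := by
    ext j
    simpa using hm j
  refine ⟨m, ?_, fun i ↦ ?_⟩
  · rintro rfl
    apply hx0
    ext j
    simp [← hm']
  · rw [hm']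
    exact (hBmem _).1 hx i

theorem zero_mem_of_unavoidable {n : ℕ} {K : Set (Fin n → ℝ)} (hK : IsCompact K)
    (hconv : Convex ℝ K) (hne : K.Nonempty) (hun : Unavoidable K) : (0 : Fin n → ℝ) ∈ K := by
  by_contra h0
  obtain ⟨f, s, hs0, hs⟩ := geometric_hahn_banach_point_closed hconv hK.isClosed h0
  rw [map_zero] at hs0
  set u : Fin n → ℝ := fun i ↦ f (Pi.single i 1) with hu
  have hf (x : Fin n → ℝ) : f x = u ⬝ᵥ x := by
    have := LinearMap.pi_apply_eq_sum_univ (f : (Fin n → ℝ) →ₗ[ℝ] ℝ) x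
    simp only [ContinuousLinearMap.coe_coe] at this
    rw [this, dotProduct]
    refine Finset.sum_congr rfl fun i _ ↦ ?_
    rw [smul_eq_mul, mul_comm, hu]
    congr 2
    ext j
    simp [Pi.single_apply, eq_comm]
  obtain ⟨R, hR⟩ := hK.isBounded.exists_norm_le
  obtain ⟨t, ht⟩ := exists_nat_gt (n * R / s)
  rw [div_lt_iff₀ hs0] at ht
  set m : Fin n → ℤ := fun i ↦ ⌈t * -u i⌉ with hm
  have key (x) (hx : x ∈ K) : (fun i ↦ (m i : ℝ)) ⬝ᵥ x < 0 := by
    have h1 : (fun i ↦ (m i : ℝ)) ⬝ᵥ x + t * (u ⬝ᵥ x) ≤ n * R := by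
      simp only [dotProduct, Finset.mul_sum, ← Finset.sum_add_distrib]
      calc _ ≤ ∑ i : Fin n, R := Finset.sum_le_sum fun i _ ↦ ?_
        _ = n * R := by simp
      have hxi : |x i| ≤ R := (norm_le_pi_norm x i).trans (hR x hx)
      have h2 := Int.ceil_lt_add_one ((t : ℝ) * -u i)
      have h3 := Int.le_ceil ((t : ℝ) * -u i)
      have : |(m i : ℝ) + t * u i| ≤ 1 := by
        rw [abs_le]; constructor <;> simp only [hm] <;> linarith
      calc (m i : ℝ) * x i + t * (u i * x i) = (m i + t * u i) * x i := by ring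
        _ ≤ |(m i + t * u i) * x i| := le_abs_self _
        _ = |m i + t * u i| * |x i| := abs_mul _ _
        _ ≤ 1 * R := mul_le_mul this hxi (abs_nonneg _) zero_le_one
        _ = R := one_mul R
    have h2 := hs x hx
    rw [hf] at h2
    have : (t : ℝ) * s ≤ t * (u ⬝ᵥ x) := mul_le_mul_of_nonneg_left h2.le (Nat.cast_nonneg t)
    linarith
  have hm0 : m ≠ 0 := by
    intro h
    obtain ⟨x, hx⟩ := hne
    have := key x hx
    rw [h] at this
    simp [dotProduct] at this
  obtain ⟨x, hx, hx1⟩ := hun m hm0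
  linarith [key x hx]

theorem exists_maximal_det {n : ℕ} {K : Set (Fin n → ℝ)} (hK : IsCompact K)
    (hint : (interior K).Nonempty) :
    ∃ X : Matrix (Fin n) (Fin n) ℝ, (∀ i, X i ∈ K) ∧ X.det ≠ 0 ∧
      ∀ Y : Matrix (Fin n) (Fin n) ℝ, (∀ i, Y i ∈ K) → |Y.det| ≤ |X.det| := by
  obtain ⟨X, hX, hmax⟩ := (isCompact_univ_pi fun _ : Fin n ↦ hK).exists_isMaxOn
    (univ_pi_nonempty_iff.2 fun _ ↦ hint.mono interior_subset)
    (f := fun Y : Fin n → Fin n → ℝ ↦ |(Matrix.of Y).det|)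
    ((Continuous.matrix_det continuous_id).abs.continuousOn)
  have hmax' (Y : Matrix (Fin n) (Fin n) ℝ) (hY : ∀ i, Y i ∈ K) : |Y.det| ≤ |(Matrix.of X).det| :=
    hmax (show (Y : Fin n → Fin n → ℝ) ∈ univ.pi fun _ ↦ K from fun i _ ↦ hY i)
  refine ⟨Matrix.of X, fun i ↦ hX i (mem_univ i), fun h0 ↦ ?_, hmax'⟩
  obtain ⟨b, hbK, hspan, hli⟩ := exists_linearIndependent ℝ K
  have htop : Submodule.span ℝ K = ⊤ := Submodule.eq_top_of_nonempty_interior' _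
    (hint.mono (interior_mono Submodule.subset_span))
  rw [htop] at hspan
  let B : Module.Basis b ℝ (Fin n → ℝ) := Module.Basis.mk hli (by simp [hspan])
  have e : b ≃ Fin n := B.indexEquiv (Pi.basisFun ℝ (Fin n))
  let Y : Matrix (Fin n) (Fin n) ℝ := fun i ↦ (e.symm i : Fin n → ℝ)
  have hYli : LinearIndependent ℝ Y := hli.comp _ e.symm.injective
  have hYdet : IsUnit Y := Matrix.linearIndependent_rows_iff_isUnit.1 hYli
  have := hmax' Y fun i ↦ hbK (e.symm i).2
  rw [h0, abs_zero] at this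
  exact ((Matrix.isUnit_iff_isUnit_det _).1 hYdet).ne_zero (abs_nonpos_iff.1 this)

/-- If the rows of `X` maximize `|det|` among tuples of points of `K`, then `K` lies in the
parallelepiped of combinations of these rows with coefficients in `[-1, 1]`. -/
theorem exists_coeff_of_maximal_det {n : ℕ} {K : Set (Fin n → ℝ)} {X : Matrix (Fin n) (Fin n) ℝ}
    (hX : ∀ i, X i ∈ K) (hdet : X.det ≠ 0)
    (hmax : ∀ Y : Matrix (Fin n) (Fin n) ℝ, (∀ i, Y i ∈ K) → |Y.det| ≤ |X.det|)
    {x : Fin n → ℝ} (hx : x ∈ K) : ∃ a : Fin n → ℝ, (∀ i, |a i| ≤ 1) ∧ x = ∑ i, a i • X i := by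
  have hxa : x = ∑ i, (x ᵥ* X⁻¹) i • X i := by
    rw [← Matrix.vecMul_eq_sum, Matrix.vecMul_vecMul, Matrix.nonsing_inv_mul _ hdet.isUnit,
      Matrix.vecMul_one]
  refine ⟨x ᵥ* X⁻¹, fun i ↦ ?_, hxa⟩
  have h1 := Matrix.det_updateRow_sum X i (x ᵥ* X⁻¹)
  rw [← hxa] at h1
  have h2 := hmax (X.updateRow i x) fun k ↦ by
    by_cases hk : k = i
    · subst hk; rwa [Matrix.updateRow_self]
    · rw [Matrix.updateRow_ne hk]; exact hX k
  rw [h1, smul_eq_mul, abs_mul] at h2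
  exact (mul_le_iff_le_one_left (abs_pos.2 hdet)).1 h2

theorem abs_dotProduct_le_of_coeff {n : ℕ} {X : Matrix (Fin n) (Fin n) ℝ} {x : Fin n → ℝ}
    (hx : ∃ a : Fin n → ℝ, (∀ i, |a i| ≤ 1) ∧ x = ∑ i, a i • X i) (y : Fin n → ℝ) :
    |x ⬝ᵥ y| ≤ ∑ i, |X i ⬝ᵥ y| := by
  obtain ⟨a, ha, rfl⟩ := hx
  rw [sum_dotProduct]
  refine (Finset.abs_sum_le_sum_abs _ _).trans (Finset.sum_le_sum fun i _ ↦ ?_)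
  rw [smul_dotProduct, smul_eq_mul, abs_mul]
  exact mul_le_of_le_one_left (abs_nonneg _) (ha i)

theorem abs_det_le_of_volume_le {n : ℕ} {K : Set (Fin n → ℝ)} {X : Matrix (Fin n) (Fin n) ℝ}
    (hconv : Convex ℝ K) (h0 : (0 : Fin n → ℝ) ∈ K) (hX : ∀ i, X i ∈ K)
    (hvol : volume K ≤ 2 ^ n) : |X.det| ≤ (2 * n) ^ n := by
  rcases Nat.eq_zero_or_pos n with rfl | hn
  · simp
  have hn' : (0 : ℝ) < n := Nat.cast_pos.2 hn
  have hsub : Matrix.toLin' Xᵀ '' Icc 0 (fun _ ↦ (n : ℝ)⁻¹) ⊆ K := by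
    rintro _ ⟨a, ⟨ha0, ha1⟩, rfl⟩
    rw [Matrix.toLin'_apply, Matrix.mulVec_transpose, Matrix.vecMul_eq_sum]
    have hsum : ∑ i, a i ≤ 1 := by
      calc ∑ i, a i ≤ ∑ _i : Fin n, (n : ℝ)⁻¹ := Finset.sum_le_sum fun i _ ↦ ha1 i
        _ = 1 := by simp [hn'.ne']
    have := hconv.sum_mem (t := Finset.univ) (w := fun o : Option (Fin n) ↦ o.elim (1 - ∑ i, a i) a)
      (z := fun o ↦ o.elim (0 : Fin n → ℝ) fun i ↦ X i) ?_ ?_ ?_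
    · rw [Fintype.sum_option] at this
      simpa using this
    · rintro (_ | i) _
      · simpa using hsum
      · exact ha0 i
    · simp [Fintype.sum_option]
    · rintro (_ | i) _
      · exact h0
      · exact hX i
  have h := (measure_mono hsub).trans hvol
  rw [Measure.addHaar_image_linearMap, Real.volume_Icc_pi] at h
  simp only [LinearMap.det_toLin', Matrix.det_transpose, Pi.zero_apply, sub_zero,
    Finset.prod_const, Finset.card_univ, Fintype.card_fin] at h
  rw [← ENNReal.ofReal_pow (by positivity), ← ENNReal.ofReal_mul (abs_nonneg _),
    ← ENNReal.ofReal_ofNat, ← ENNReal.ofReal_pow (by norm_num),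
    ENNReal.ofReal_le_ofReal_iff (by positivity), inv_pow, ← div_eq_mul_inv,
    div_le_iff₀ (by positivity)] at h
  rwa [mul_pow]

/-- For every direction `u`, an integer vector `m` that is bounded in the coordinates given by `X`
provides a point `p m` whose height in direction `u` is bounded below in terms of `u`. The vector
`m` comes from Minkowski's theorem on linear forms, as a good approximation to the ray through `u`. -/
theorem exists_bounded_int_dotProduct_ge {n : ℕ} {K : Set (Fin n → ℝ)}
    {X : Matrix (Fin n) (Fin n) ℝ} (hdet : X.det ≠ 0)
    (hcoeff : ∀ x ∈ K, ∃ a : Fin n → ℝ, (∀ i, |a i| ≤ 1) ∧ x = ∑ i, a i • X i)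
    {T : ℝ} (hT1 : 1 ≤ T) (hT : |X.det| < T * ((2 * n : ℝ)⁻¹) ^ (n - 1))
    {p : (Fin n → ℤ) → Fin n → ℝ} (hpK : ∀ m, m ≠ 0 → p m ∈ K)
    (hp : ∀ m, m ≠ 0 → (fun i ↦ (m i : ℝ)) ⬝ᵥ p m = 1) {u : Fin n → ℝ} (hu : u ≠ 0) :
    ∃ j, 0 < |X j ⬝ᵥ u| ∧ (∀ i, |X i ⬝ᵥ u| ≤ |X j ⬝ᵥ u|) ∧
      ∃ m : Fin n → ℤ, m ≠ 0 ∧ (∀ i, |X i ⬝ᵥ (fun k ↦ (m k : ℝ))| ≤ 2 * T) ∧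
        |X j ⬝ᵥ u| ≤ 2 * T * (u ⬝ᵥ p m) := by
  have hn : 0 < n := by
    rcases Nat.eq_zero_or_pos n with rfl | hn
    · exact (hu (Subsingleton.elim _ _)).elim
    · exact hn
  have : Nonempty (Fin n) := ⟨⟨0, hn⟩⟩
  have hn1 : (1 : ℝ) ≤ n := by exact_mod_cast hn
  set ε : ℝ := (2 * n : ℝ)⁻¹ with hε
  have hε0 : 0 < ε := by positivity
  have hnε : n * ε = 1 / 2 := by rw [hε]; field_simp
  have hε1 : ε ≤ 1 := by nlinarith
  obtain ⟨j, hj⟩ := Finite.exists_max fun i ↦ |X i ⬝ᵥ u|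
  have hU : 0 < |X j ⬝ᵥ u| := by
    by_contra! h
    apply hu
    apply Matrix.eq_zero_of_mulVec_eq_zero hdet
    ext i
    exact abs_nonpos_iff.1 ((hj i).trans h)
  have hU0 : X j ⬝ᵥ u ≠ 0 := abs_pos.1 hU
  let c : Fin n → ℝ := fun i ↦ if i = j then 0 else -(X i ⬝ᵥ u / X j ⬝ᵥ u)
  let A : Matrix (Fin n) (Fin n) ℝ := fun i k ↦ X i k + c i * X j k
  have hAdet : A.det = X.det :=
    Matrix.det_eq_of_forall_row_eq_smul_add_const c j (by simp [c]) fun _ _ ↦ rfl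
  have hA (i) (y : Fin n → ℝ) : A i ⬝ᵥ y = X i ⬝ᵥ y + c i * (X j ⬝ᵥ y) := by
    have : A i = X i + c i • X j := rfl
    rw [this, add_dotProduct, smul_dotProduct, smul_eq_mul]
  obtain ⟨m₀, hm₀, hbd₀⟩ := exists_int_abs_mulVec_lt A (by rwa [hAdet])
    (fun i ↦ if i = j then T else ε)
    (fun i ↦ by split_ifs <;> linarith) (by
      rw [hAdet, Finset.prod_ite, Finset.prod_const, Finset.prod_const,
        Finset.filter_eq' Finset.univ j, Finset.filter_ne' Finset.univ j]
      simpa using hT)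
  obtain ⟨m, hm, hbd, ht⟩ : ∃ m : Fin n → ℤ, m ≠ 0 ∧
      (∀ i, |A i ⬝ᵥ (fun k ↦ (m k : ℝ))| < if i = j then T else ε) ∧
      0 ≤ X j ⬝ᵥ (fun k ↦ (m k : ℝ)) / X j ⬝ᵥ u := by
    rcases le_total 0 (X j ⬝ᵥ (fun k ↦ (m₀ k : ℝ)) / X j ⬝ᵥ u) with h | h
    · exact ⟨m₀, hm₀, hbd₀, h⟩
    · have hneg : (fun k ↦ ((-m₀) k : ℝ)) = -fun k ↦ (m₀ k : ℝ) := by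
        ext k; simp
      refine ⟨-m₀, neg_ne_zero.2 hm₀, fun i ↦ ?_, ?_⟩
      · rw [hneg, dotProduct_neg, abs_neg]
        exact hbd₀ i
      · rw [hneg, dotProduct_neg, neg_div]
        linarith
  set v : Fin n → ℝ := fun k ↦ (m k : ℝ) with hv
  set t : ℝ := X j ⬝ᵥ v / X j ⬝ᵥ u with htdef
  have htU : X j ⬝ᵥ v = t * (X j ⬝ᵥ u) := by rw [htdef]; field_simp
  have hjT : |X j ⬝ᵥ v| < T := by
    have := hbd j
    rw [hA] at this
    simpa [c] using this
  have hdiff (i) : |X i ⬝ᵥ (v - t • u)| ≤ ε := by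
    rw [dotProduct_sub, dotProduct_smul, smul_eq_mul]
    by_cases hij : i = j
    · subst hij
      rw [htU, sub_self, abs_zero]
      exact hε0.le
    · have := hbd i
      rw [hA, if_neg hij] at this
      simp only [c, if_neg hij] at this
      have heq : X i ⬝ᵥ v - t * (X i ⬝ᵥ u) =
          X i ⬝ᵥ v + -(X i ⬝ᵥ u / X j ⬝ᵥ u) * (X j ⬝ᵥ v) := by
        rw [htdef]; ring
      rw [heq]
      exact this.le
  refine ⟨j, hU, hj, m, hm, fun i ↦ ?_, ?_⟩
  · have h1 : X i ⬝ᵥ v = X i ⬝ᵥ (v - t • u) + t * (X i ⬝ᵥ u) := by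
      rw [dotProduct_sub, dotProduct_smul, smul_eq_mul]; ring
    have h2 : |t * (X i ⬝ᵥ u)| ≤ T := by
      rw [abs_mul]
      calc |t| * |X i ⬝ᵥ u| ≤ |t| * |X j ⬝ᵥ u| := mul_le_mul_of_nonneg_left (hj i) (abs_nonneg _)
        _ = |X j ⬝ᵥ v| := by rw [htU, abs_mul]
        _ ≤ T := hjT.le
    rw [h1]
    linarith [abs_add_le (X i ⬝ᵥ (v - t • u)) (t * (X i ⬝ᵥ u)), hdiff i]
  · have h1 : |p m ⬝ᵥ (v - t • u)| ≤ 1 / 2 := by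
      refine (abs_dotProduct_le_of_coeff (hcoeff _ (hpK m hm)) _).trans ?_
      calc _ ≤ ∑ _i : Fin n, ε := Finset.sum_le_sum fun i _ ↦ hdiff i
        _ = 1 / 2 := by simp [hnε]
    have h2 : v ⬝ᵥ p m = 1 := hp m hm
    rw [dotProduct_sub, dotProduct_smul, smul_eq_mul, dotProduct_comm, h2,
      dotProduct_comm (p m) u] at h1
    have h3 : 1 / 2 ≤ t * (u ⬝ᵥ p m) := by linarith [(abs_le.1 h1).2]
    have h4 : 0 < u ⬝ᵥ p m := by
      by_contra! h
      linarith [mul_nonpos_of_nonneg_of_nonpos ht h]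
    rw [htU, abs_mul, abs_of_nonneg ht] at hjT
    nlinarith [mul_le_mul_of_nonneg_left h3 hU.le, mul_le_mul_of_nonneg_right hjT.le h4.le]

/-- The integer vectors bounded in the coordinates given by `X` are few, since unavoidability
separates them from each other. -/
theorem exists_finset_bounded_int {n : ℕ} {K : Set (Fin n → ℝ)} {X : Matrix (Fin n) (Fin n) ℝ}
    (hcoeff : ∀ x ∈ K, ∃ a : Fin n → ℝ, (∀ i, |a i| ≤ 1) ∧ x = ∑ i, a i • X i)
    (hun : Unavoidable K) (N : ℕ) :
    ∃ F : Finset (Fin n → ℤ), F.card ≤ (2 * ((n + 1) * N) + 1) ^ n ∧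
      ∀ m, m ∈ F ↔ m ≠ 0 ∧ ∀ i, |X i ⬝ᵥ (fun k ↦ (m k : ℝ))| ≤ N := by
  set G : Set (Fin n → ℤ) := {m | m ≠ 0 ∧ ∀ i, |X i ⬝ᵥ (fun k ↦ (m k : ℝ))| ≤ N} with hG
  let f : (Fin n → ℤ) → Fin n → ℤ := fun m i ↦ ⌊(n + 1) * (X i ⬝ᵥ (fun k ↦ (m k : ℝ)))⌋
  let M : ℤ := (n + 1) * N
  let B : Finset (Fin n → ℤ) := Fintype.piFinset fun _ ↦ Finset.Icc (-M) M
  have hmaps : MapsTo f G B := by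
    intro m hm
    simp only [B, Finset.mem_coe, Fintype.mem_piFinset, Finset.mem_Icc]
    intro i
    have h1 := abs_le.1 (hm.2 i)
    have h0 : (0 : ℝ) < n + 1 := by positivity
    constructor
    · rw [Int.le_floor]
      push_cast [M]
      nlinarith
    · have : ((f m i : ℤ) : ℝ) ≤ (M : ℝ) := by
        refine (Int.floor_le _).trans ?_
        push_cast [M]
        nlinarith
      exact_mod_cast this
  have hinj : InjOn f G := by
    intro m _ m' _ h
    by_contra hne
    obtain ⟨x, hx, hx1⟩ := hun (m - m') (sub_ne_zero.2 hne)
    have h1 := abs_dotProduct_le_of_coeff (hcoeff x hx) (fun i ↦ ((m - m') i : ℝ))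
    rw [dotProduct_comm, hx1, abs_one] at h1
    have h0 : (0 : ℝ) < n + 1 := by positivity
    have h2 (i) : |X i ⬝ᵥ (fun k ↦ ((m - m') k : ℝ))| ≤ ((n : ℝ) + 1)⁻¹ := by
      have h3 := Int.abs_sub_lt_one_of_floor_eq_floor (congrFun h i)
      rw [← mul_sub, ← dotProduct_sub, abs_mul, abs_of_pos h0] at h3
      have h4 : (fun k ↦ ((m - m') k : ℝ)) = (fun k ↦ (m k : ℝ)) - fun k ↦ (m' k : ℝ) := by
        ext k; simp
      rw [h4, ← one_div, le_div_iff₀ h0]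
      linarith
    have h5 := h1.trans (Finset.sum_le_sum fun i _ ↦ h2 i)
    simp only [Finset.sum_const, Finset.card_univ, Fintype.card_fin, nsmul_eq_mul] at h5
    rw [← div_eq_mul_inv, le_div_iff₀ h0] at h5
    linarith
  have hfin : G.Finite := Set.Finite.of_injOn hmaps hinj B.finite_toSet
  refine ⟨hfin.toFinset, ?_, fun m ↦ by simp [hG]⟩
  refine (Finset.card_le_card_of_injOn f (t := B) (by simpa using hmaps)
    (by simpa using hinj)).trans (le_of_eq ?_)
  simp only [B, Fintype.card_piFinset, Int.card_Icc, Finset.prod_const, Finset.card_univ,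
    Fintype.card_fin]
  congr 1
  simp only [M]
  have : ((n : ℤ) + 1) * N = (((n + 1) * N : ℕ) : ℤ) := by push_cast; ring
  rw [this]
  omega

theorem eq_of_subset_of_volume_le {n : ℕ} {K P : Set (Fin n → ℝ)}
    (hconv : Convex ℝ K) (hint : (interior K).Nonempty) (hP : IsCompact P) (hPK : P ⊆ K)
    (hvol : volume K ≤ volume P) : K = P := by
  refine Subset.antisymm (fun x hx ↦ ?_) hPK
  by_contra hxP
  have hcl : x ∈ closure (interior K) := by
    rw [hconv.closure_interior_eq_closure_of_nonempty_interior hint]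
    exact subset_closure hx
  obtain ⟨y, hyP, hyK⟩ := mem_closure_iff.1 hcl _ hP.isClosed.isOpen_compl hxP
  have hopen : IsOpen (Pᶜ ∩ interior K) := hP.isClosed.isOpen_compl.inter isOpen_interior
  have hpos : 0 < volume (Pᶜ ∩ interior K) := hopen.measure_pos _ ⟨y, hyP, hyK⟩
  have hle : volume P + volume (Pᶜ ∩ interior K) ≤ volume P := by
    rw [← measure_union (disjoint_compl_right.mono_right inter_subset_left) hopen.measurableSet]
    refine (measure_mono (union_subset hPK ?_)).trans hvol
    exact inter_subset_right.trans interior_subset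
  have hlt := ENNReal.lt_add_right (hP.measure_lt_top (μ := volume)).ne hpos.ne'
  exact absurd hle hlt.not_ge

theorem unavoidable_of_forall_exists_one_le {n : ℕ} {P : Set (Fin n → ℝ)} (hP : Convex ℝ P)
    (h : ∀ m : Fin n → ℤ, m ≠ 0 → ∃ x ∈ P, 1 ≤ (fun i ↦ (m i : ℝ)) ⬝ᵥ x) : Unavoidable P := by
  intro m hm
  obtain ⟨x, hx, hx1⟩ := h m hm
  obtain ⟨y, hy, hy1⟩ := h (-m) (neg_ne_zero.2 hm)
  have hneg : (fun k ↦ ((-m) k : ℝ)) = -fun k ↦ (m k : ℝ) := by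
    ext k; simp
  rw [hneg, neg_dotProduct] at hy1
  obtain ⟨z, hz, hz1⟩ := hP.isPreconnected.intermediate_value hy hx
    (f := fun x ↦ (fun i ↦ (m i : ℝ)) ⬝ᵥ x)
    (Continuous.dotProduct continuous_const continuous_id).continuousOn
    (show (1 : ℝ) ∈ Icc _ _ from ⟨by linarith, hx1⟩)
  exact ⟨z, hz, hz1⟩

theorem interior_convexHull_nonempty_of_forall_exists_pos {n : ℕ} {S : Set (Fin n → ℝ)}
    (hS : S.Nonempty) (h : ∀ u : Fin n → ℝ, u ≠ 0 → ∃ x ∈ S, 0 < u ⬝ᵥ x) :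
    (interior (convexHull ℝ S)).Nonempty := by
  rw [interior_convexHull_nonempty_iff_affineSpan_eq_top,
    AffineSubspace.affineSpan_eq_top_iff_vectorSpan_eq_top_of_nonempty ℝ _ _ hS]
  by_contra hne
  obtain ⟨f, hf0, hf⟩ := Submodule.exists_le_ker_of_lt_top _ (lt_top_iff_ne_top.2 hne)
  obtain ⟨u, rfl⟩ := (dotProductEquiv ℝ (Fin n)).surjective f
  have hu : u ≠ 0 := by
    rintro rfl
    exact hf0 (map_zero _)
  obtain ⟨x, hx, hx0⟩ := h u hu
  obtain ⟨y, hy, hy0⟩ := h (-u) (neg_ne_zero.2 hu)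
  have := hf (vsub_mem_vectorSpan ℝ hx hy)
  rw [LinearMap.mem_ker, dotProductEquiv_apply_apply, vsub_eq_sub, dotProduct_sub] at this
  rw [neg_dotProduct] at hy0
  linarith

theorem unavoidable_cube (n : ℕ) : Unavoidable (Icc (-1 : Fin n → ℝ) 1) := by
  intro m hm
  obtain ⟨i, hi⟩ := Function.ne_iff.1 hm
  have hi' : (m i : ℝ) ≠ 0 := by exact_mod_cast hi
  have h1 : (1 : ℝ) ≤ |(m i : ℝ)| := by exact_mod_cast Int.one_le_abs hi
  have h2 : |(m i : ℝ)⁻¹| ≤ 1 := by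
    rw [abs_inv]; exact inv_le_one_of_one_le₀ h1
  refine ⟨Pi.single i (m i : ℝ)⁻¹, ⟨fun k ↦ ?_, fun k ↦ ?_⟩, ?_⟩
  · by_cases hk : k = i
    · subst hk; simpa using (abs_le.1 h2).1
    · simp [hk]
  · by_cases hk : k = i
    · subst hk; simpa using (abs_le.1 h2).2
    · simp [hk]
  · simp [hi']

/-- An unavoidable convex body of volume at most `2 ^ n` contains boundedly many points whose convex
hull is an unavoidable convex body. -/
theorem exists_finset_convexHull_unavoidable {n : ℕ} (hn : 0 < n) {K : Set (Fin n → ℝ)}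
    (hK : IsCompact K) (hconv : Convex ℝ K) (hint : (interior K).Nonempty) (hun : Unavoidable K)
    (hvol : volume K ≤ 2 ^ n) :
    ∃ S : Finset (Fin n → ℝ),
      S.card ≤ (2 * ((n + 1) * (2 * (((2 * n) ^ n + 1) * (2 * n) ^ (n - 1)))) + 1) ^ n ∧
      (S : Set (Fin n → ℝ)) ⊆ K ∧ Unavoidable (convexHull ℝ (S : Set (Fin n → ℝ))) ∧
      (interior (convexHull ℝ (S : Set (Fin n → ℝ)))).Nonempty := by
  classical
  obtain ⟨X, hX, hdet, hmax⟩ := exists_maximal_det hK hint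
  have hcoeff (x) (hx : x ∈ K) := exists_coeff_of_maximal_det hX hdet hmax hx
  have hdetle := abs_det_le_of_volume_le hconv
    (zero_mem_of_unavoidable hK hconv (hint.mono interior_subset) hun) hX hvol
  set T : ℕ := ((2 * n) ^ n + 1) * (2 * n) ^ (n - 1) with hTdef
  have hT1 : (1 : ℝ) ≤ T := by
    have : 0 < T := by positivity
    exact_mod_cast this
  have hT : |X.det| < T * ((2 * n : ℝ)⁻¹) ^ (n - 1) := by
    have hn' : (0 : ℝ) < n := Nat.cast_pos.2 hn
    have : T * ((2 * n : ℝ)⁻¹) ^ (n - 1) = (2 * n) ^ n + 1 := by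
      rw [hTdef, inv_pow]
      push_cast
      field_simp
    linarith
  choose! p hpK hp using hun
  obtain ⟨F, hFcard, hF⟩ := exists_finset_bounded_int hcoeff (fun m hm ↦ ⟨p m, hpK m hm, hp m hm⟩)
    (2 * T)
  have hF' (m) (hm : m ∈ F) : m ≠ 0 := ((hF m).1 hm).1
  have key (u : Fin n → ℝ) (hu : u ≠ 0) : ∃ j, 0 < |X j ⬝ᵥ u| ∧
      (∀ i, |X i ⬝ᵥ u| ≤ |X j ⬝ᵥ u|) ∧ ∃ m ∈ F, |X j ⬝ᵥ u| ≤ 2 * T * (u ⬝ᵥ p m) := by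
    obtain ⟨j, h0, hj, m, hm, hm', h⟩ := exists_bounded_int_dotProduct_ge hdet hcoeff hT1 hT hpK
      hp hu
    exact ⟨j, h0, hj, m, (hF m).2 ⟨hm, by push_cast; exact hm'⟩, h⟩
  have hpos (u : Fin n → ℝ) (hu : u ≠ 0) : ∃ x ∈ (F.image p : Set (Fin n → ℝ)), 0 < u ⬝ᵥ x := by
    obtain ⟨j, h0, _, m, hm, h⟩ := key u hu
    exact ⟨p m, by simpa using ⟨m, hm, rfl⟩,
      pos_of_mul_pos_right (h0.trans_le h) (by positivity)⟩
  refine ⟨F.image p, Finset.card_image_le.trans hFcard, ?_, ?_, ?_⟩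
  · intro x hx
    obtain ⟨m, hm, rfl⟩ := Finset.mem_image.1 (Finset.mem_coe.1 hx)
    exact hpK m (hF' m hm)
  · refine unavoidable_of_forall_exists_one_le (convex_convexHull ℝ _) fun m hm ↦ ?_
    have hmem (m) (hm : m ∈ F) : p m ∈ convexHull ℝ (F.image p : Set (Fin n → ℝ)) :=
      subset_convexHull ℝ _ (by simpa using ⟨m, hm, rfl⟩)
    by_cases hmF : m ∈ F
    · exact ⟨p m, hmem m hmF, (hp m hm).ge⟩
    · have hu : (fun i ↦ (m i : ℝ)) ≠ 0 := fun h ↦ hm <| by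
        ext i
        simpa using congrFun h i
      obtain ⟨j, _, hj, m', hm', h⟩ := key _ hu
      refine ⟨p m', hmem m' hm', ?_⟩
      have : (2 * T : ℝ) < |X j ⬝ᵥ fun i ↦ (m i : ℝ)| := by
        by_contra! hle
        exact hmF ((hF m).2 ⟨hm, fun i ↦ by push_cast; exact (hj i).trans hle⟩)
      have h2 : (2 * T : ℝ) * 1 < 2 * T * ((fun i ↦ (m i : ℝ)) ⬝ᵥ p m') := by linarith
      exact (lt_of_mul_lt_mul_left h2 (by positivity)).le
  · refine interior_convexHull_nonempty_of_forall_exists_pos ?_ hpos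
    obtain ⟨x, hx, _⟩ := hpos (Pi.single ⟨0, hn⟩ 1) (by simp)
    exact ⟨x, hx⟩

/-- There is a constant `c` depending only on `n` such that every unavoidable
convex body in `ℝⁿ` of minimal volume is a polytope with at most `c` vertices. -/
theorem stmt_3 (n : ℕ) :
    ∃ c : ℕ, ∀ K : Set (Fin n → ℝ),
      IsCompact K → Convex ℝ K → (interior K).Nonempty →
      (∀ m : Fin n → ℤ, m ≠ 0 → ∃ x ∈ K, ∑ i, (m i : ℝ) * x i = 1) →
      (∀ K' : Set (Fin n → ℝ),
        IsCompact K' → Convex ℝ K' → (interior K').Nonempty →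
        (∀ m : Fin n → ℤ, m ≠ 0 → ∃ x ∈ K', ∑ i, (m i : ℝ) * x i = 1) →
        volume K ≤ volume K') →
      ∃ S : Finset (Fin n → ℝ), S.card ≤ c ∧ K = convexHull ℝ ↑S := by
  rcases Nat.eq_zero_or_pos n with rfl | hn
  · refine ⟨1, fun K _ _ hint _ _ ↦ ⟨{0}, by simp, ?_⟩⟩
    have : K = univ := Subsingleton.eq_univ_of_nonempty (hint.mono interior_subset)
    rw [this, Finset.coe_singleton, convexHull_singleton]
    exact (Set.eq_univ_of_forall fun x ↦ Subsingleton.elim _ _).symm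
  refine ⟨(2 * ((n + 1) * (2 * (((2 * n) ^ n + 1) * (2 * n) ^ (n - 1)))) + 1) ^ n,
    fun K hK hconv hint hun hmin ↦ ?_⟩
  have hvol : volume K ≤ 2 ^ n := by
    refine (hmin (Icc (-1) 1) isCompact_Icc (convex_Icc _ _) ?_ (unavoidable_cube n)).trans ?_
    · rw [← pi_univ_Icc, interior_pi_set finite_univ]
      simp only [interior_Icc]
      exact ⟨0, fun i _ ↦ by simp⟩
    · rw [Real.volume_Icc_pi]
      norm_num
  obtain ⟨S, hcard, hSK, hSun, hSint⟩ :=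
    exists_finset_convexHull_unavoidable hn hK hconv hint hun hvol
  have hS : IsCompact (convexHull ℝ (S : Set (Fin n → ℝ))) :=
    S.finite_toSet.isCompact_convexHull ℝ
  exact ⟨S, hcard, eq_of_subset_of_volume_le hconv hint hS (convexHull_min hSK hconv)
    (hmin _ hS (convex_convexHull ℝ _) hSint hSun)⟩
end
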